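/- For any 3-uniform hypergraph F, the uniform Turán density π_⋅(F) is positive if and only if for every labeling σ of V(F) there is some vertex v ∈ V(F) such that the link graph L_F(v) contains a monotone P3 with respect to σ. -/

import Mathlib

open Filter

/-- A 3-uniform hypergraph on vertex type `V`: a set of edges, each of size 3. -/
structure H3 (V : Type) [DecidableEq V] where
  edges : Finset (Finset V)
  card3 : ∀ e ∈ edges, e.card = 3

namespace H3

variable {V W : Type} [DecidableEq V] [DecidableEq W]

/-- `H` contains a copy of `F`: an injection of vertices mapping edges to edges. -/
def contains (H : H3 V) (F : H3 W) : Prop :=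
  ∃ f : W → V, Function.Injective f ∧ ∀ e ∈ F.edges, e.image f ∈ H.edges

/-- `H` is `F`-free. -/
def free (H : H3 V) (F : H3 W) : Prop := ¬ H.contains F

/-- The codegree of a pair of vertices: the number of edges containing both. -/
def codeg (H : H3 V) (u v : V) : ℕ :=
  (H.edges.filter fun e => u ∈ e ∧ v ∈ e).card

/-- The minimum codegree: the minimum of `codeg` over pairs of distinct vertices. -/
noncomputable def minCodeg [Fintype V] (H : H3 V) : ℕ :=
  sInf {d | ∃ u v : V, u ≠ v ∧ H.codeg u v = d}

/-- `H` is uniformly `(d, η)`-dense: every vertex subset `U` spans at least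
`d * C(|U|,3) - η * n^3` edges. -/
def uniformlyDense [Fintype V] (H : H3 V) (d η : ℝ) : Prop :=
  ∀ U : Finset V,
    d * (U.card.choose 3 : ℝ) - η * (Fintype.card V : ℝ) ^ 3
      ≤ ((H.edges.filter fun e => e ⊆ U).card : ℝ)

end H3

/-- The uniform Turán density `π_⋅(F)`. -/
noncomputable def uniformTuranDensity {W : Type} [DecidableEq W] (F : H3 W) : ℝ :=
  sSup {d : ℝ | 0 ≤ d ∧ d ≤ 1 ∧
    ∀ η : ℝ, 0 < η → ∀ n₀ : ℕ, ∃ n, n₀ ≤ n ∧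
      ∃ H : H3 (Fin n), H.free F ∧ H.uniformlyDense d η}

/-- The codegree Turán number `ex_co(n, F)`: the maximum minimum codegree of an
`n`-vertex `F`-free 3-graph. -/
noncomputable def exCodeg {W : Type} [DecidableEq W] (n : ℕ) (F : H3 W) : ℕ :=
  sSup {d | ∃ H : H3 (Fin n), H.free F ∧ H.minCodeg = d}

/-- The codegree Turán density `π_co(F) = lim_n ex_co(n,F)/n` (the limit exists,
so it coincides with the limsup). -/
noncomputable def codegTuranDensity {W : Type} [DecidableEq W] (F : H3 W) : ℝ :=
  Filter.limsup (fun n : ℕ => (exCodeg n F : ℝ) / n) Filter.atTop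

/-- The link graph of `v` in `F` contains a monotone `P₃` with respect to the
injection `σ` of the vertices into `ℕ`: a path `x y z` (i.e. `{x,y}` and
`{y,z}` are link edges, `x ≠ z`) with `σ x < σ y < σ z` or `σ x > σ y > σ z`. -/
def hasMonoP3 {V : Type} [DecidableEq V] (F : H3 V) (v : V) (σ : V → ℕ) : Prop :=
  ∃ x y z : V, ({x, y, v} : Finset V) ∈ F.edges ∧ ({y, z, v} : Finset V) ∈ F.edges ∧
    x ≠ z ∧ ((σ x < σ y ∧ σ y < σ z) ∨ (σ z < σ y ∧ σ y < σ x))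

section

open scoped BigOperators Classical

namespace UTD

section Expect
set_option linter.unusedSectionVars false
variable {ι : Type} [Fintype ι] [DecidableEq ι] {X : ι → Type} [∀ i, Fintype (X i)] [∀ i, Nonempty (X i)]

lemma expect_update (i : ι) (G : (∀ i, X i) → ℝ) :
    𝔼 w, 𝔼 x, G (Function.update w i x) = 𝔼 w, G w := by
  have h1 : 𝔼 w, 𝔼 x, G (Function.update w i x)
      = 𝔼 p : (∀ i, X i) × X i, G (Function.update p.1 i p.2) := by
    rw [← Finset.univ_product_univ, Finset.expect_product]
  have h2 : 𝔼 p : (∀ i, X i) × X i, G p.1 = 𝔼 w, G w := by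
    rw [← Finset.univ_product_univ, Finset.expect_product]
    simp
  rw [h1, ← h2]
  refine Fintype.expect_bijective
    (fun p : (∀ i, X i) × X i => (Function.update p.1 i p.2, p.1 i)) ?_ _ _ (fun p => rfl)
  refine Function.Involutive.bijective ?_
  rintro ⟨w, x⟩
  simp

/-- `G` does not depend on the coordinate `i`. -/
def Indep (i : ι) (G : (∀ i, X i) → ℝ) : Prop := ∀ w x, G (Function.update w i x) = G w

/-- `G` is a product of two `[0,1]`-valued functions, one ignoring `i`, the other ignoring `j`. -/
def Split₂ (i j : ι) (G : (∀ i, X i) → ℝ) : Prop :=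
  ∃ G₁ G₂ : (∀ i, X i) → ℝ, (∀ w, G₁ w ∈ Set.Icc (0 : ℝ) 1) ∧ (∀ w, G₂ w ∈ Set.Icc (0 : ℝ) 1) ∧
    Indep j G₁ ∧ Indep i G₂ ∧ ∀ w, G w = G₁ w * G₂ w

/-- `G` is a product of three `[0,1]`-valued functions, ignoring `k`, `j`, `i` respectively. -/
def Split₃ (i j k : ι) (G : (∀ i, X i) → ℝ) : Prop :=
  ∃ G₁ G₂ G₃ : (∀ i, X i) → ℝ, (∀ w, G₁ w ∈ Set.Icc (0 : ℝ) 1) ∧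
    (∀ w, G₂ w ∈ Set.Icc (0 : ℝ) 1) ∧ (∀ w, G₃ w ∈ Set.Icc (0 : ℝ) 1) ∧
    Indep k G₁ ∧ Indep j G₂ ∧ Indep i G₃ ∧ ∀ w, G w = G₁ w * G₂ w * G₃ w

lemma mul_mem_Icc {a b : ℝ} (ha : a ∈ Set.Icc (0 : ℝ) 1) (hb : b ∈ Set.Icc (0 : ℝ) 1) :
    a * b ∈ Set.Icc (0 : ℝ) 1 :=
  ⟨mul_nonneg ha.1 hb.1, mul_le_one₀ ha.2 hb.1 hb.2⟩

lemma prod_mem_Icc {α : Type} (s : Finset α) (f : α → ℝ) (h : ∀ a ∈ s, f a ∈ Set.Icc (0 : ℝ) 1) :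
    ∏ a ∈ s, f a ∈ Set.Icc (0 : ℝ) 1 :=
  ⟨Finset.prod_nonneg fun a ha => (h a ha).1,
    Finset.prod_le_one (fun a ha => (h a ha).1) fun a ha => (h a ha).2⟩

lemma one_mem_Icc : (1 : ℝ) ∈ Set.Icc (0 : ℝ) 1 := ⟨zero_le_one, le_rfl⟩

lemma Indep.one (i : ι) : Indep (X := X) i (fun _ => 1) := fun _ _ => rfl

lemma Indep.mul {i : ι} {G H : (∀ i, X i) → ℝ} (hG : Indep i G) (hH : Indep i H) :
    Indep i (fun w => G w * H w) := fun w x => by simp only [hG w x, hH w x]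

lemma Split₂.mul {i j : ι} {G H : (∀ i, X i) → ℝ} (hG : Split₂ i j G) (hH : Split₂ i j H) :
    Split₂ i j (fun w => G w * H w) := by
  obtain ⟨a, b, ha, hb, ha', hb', h⟩ := hG
  obtain ⟨c, d, hc, hd, hc', hd', h'⟩ := hH
  exact ⟨_, _, fun w => mul_mem_Icc (ha w) (hc w), fun w => mul_mem_Icc (hb w) (hd w),
    ha'.mul hc', hb'.mul hd', fun w => by simp only [h, h']; ring⟩

lemma Split₃.mul {i j k : ι} {G H : (∀ i, X i) → ℝ} (hG : Split₃ i j k G) (hH : Split₃ i j k H) :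
    Split₃ i j k (fun w => G w * H w) := by
  obtain ⟨a, b, c, ha, hb, hc, ha', hb', hc', h⟩ := hG
  obtain ⟨a₁, b₁, c₁, ha₁, hb₁, hc₁, ha₁', hb₁', hc₁', h'⟩ := hH
  exact ⟨_, _, _, fun w => mul_mem_Icc (ha w) (ha₁ w), fun w => mul_mem_Icc (hb w) (hb₁ w),
    fun w => mul_mem_Icc (hc w) (hc₁ w), ha'.mul ha₁', hb'.mul hb₁', hc'.mul hc₁',
    fun w => by simp only [h, h']; ring⟩

lemma Split₂.one (i j : ι) : Split₂ (X := X) i j (fun _ => 1) :=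
  ⟨fun _ => 1, fun _ => 1, fun _ => one_mem_Icc, fun _ => one_mem_Icc, fun _ _ => rfl,
    fun _ _ => rfl, fun _ => by simp⟩

lemma Split₃.one (i j k : ι) : Split₃ (X := X) i j k (fun _ => 1) :=
  ⟨fun _ => 1, fun _ => 1, fun _ => 1, fun _ => one_mem_Icc, fun _ => one_mem_Icc,
    fun _ => one_mem_Icc, fun _ _ => rfl, fun _ _ => rfl, fun _ _ => rfl, fun _ => by simp⟩

lemma Split₂.prod {α : Type} {i j : ι} (s : Finset α) {G : α → (∀ i, X i) → ℝ}
    (h : ∀ a ∈ s, Split₂ i j (G a)) : Split₂ i j (fun w => ∏ a ∈ s, G a w) := by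
  induction s using Finset.induction_on with
  | empty => simpa using Split₂.one i j
  | insert a s ha ih =>
    simp only [Finset.prod_insert ha]
    exact (h a (by simp)).mul (ih fun b hb => h b (by simp [hb]))

lemma Split₃.prod {α : Type} {i j k : ι} (s : Finset α) {G : α → (∀ i, X i) → ℝ}
    (h : ∀ a ∈ s, Split₃ i j k (G a)) : Split₃ i j k (fun w => ∏ a ∈ s, G a w) := by
  induction s using Finset.induction_on with
  | empty => simpa using Split₃.one i j k
  | insert a s ha ih =>
    simp only [Finset.prod_insert ha]
    exact (h a (by simp)).mul (ih fun b hb => h b (by simp [hb]))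

lemma Split₂.of_indep {i j : ι} {G : (∀ i, X i) → ℝ} (h01 : ∀ w, G w ∈ Set.Icc (0 : ℝ) 1)
    (h : Indep i G ∨ Indep j G) : Split₂ i j G := by
  rcases h with h | h
  · exact ⟨fun _ => 1, G, fun _ => one_mem_Icc, h01, fun _ _ => rfl, h, fun _ => by simp⟩
  · exact ⟨G, fun _ => 1, h01, fun _ => one_mem_Icc, h, fun _ _ => rfl, fun _ => by simp⟩

lemma Split₃.of_indep {i j k : ι} {G : (∀ i, X i) → ℝ} (h01 : ∀ w, G w ∈ Set.Icc (0 : ℝ) 1)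
    (h : Indep i G ∨ Indep j G ∨ Indep k G) : Split₃ i j k G := by
  rcases h with h | h | h
  · exact ⟨fun _ => 1, fun _ => 1, G, fun _ => one_mem_Icc, fun _ => one_mem_Icc, h01,
      fun _ _ => rfl, fun _ _ => rfl, h, fun _ => by simp⟩
  · exact ⟨fun _ => 1, G, fun _ => 1, fun _ => one_mem_Icc, h01, fun _ => one_mem_Icc,
      fun _ _ => rfl, h, fun _ _ => rfl, fun _ => by simp⟩
  · exact ⟨G, fun _ => 1, fun _ => 1, h01, fun _ => one_mem_Icc, fun _ => one_mem_Icc,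
      h, fun _ _ => rfl, fun _ _ => rfl, fun _ => by simp⟩

lemma abs_expect_le_of_forall {α : Type} [Fintype α] [Nonempty α] {f : α → ℝ} {τ : ℝ}
    (h : ∀ a, |f a| ≤ τ) : |𝔼 a, f a| ≤ τ :=
  (Finset.abs_expect_le _ _).trans (Finset.expect_le Finset.univ_nonempty fun a _ => h a)

lemma abs_expect_pair_le {i j : ι} (hij : i ≠ j) (D : X i → X j → ℝ) {τ : ℝ}
    (hD : ∀ (g₁ : X i → ℝ) (g₂ : X j → ℝ), (∀ x, g₁ x ∈ Set.Icc (0 : ℝ) 1) →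
      (∀ y, g₂ y ∈ Set.Icc (0 : ℝ) 1) → |𝔼 x, 𝔼 y, D x y * (g₁ x * g₂ y)| ≤ τ)
    {G : (∀ i, X i) → ℝ} (hG : Split₂ i j G) :
    |𝔼 w, D (w i) (w j) * G w| ≤ τ := by
  obtain ⟨a, b, ha, hb, ha', hb', h⟩ := hG
  rw [← expect_update j, ← expect_update i]
  refine abs_expect_le_of_forall fun w => ?_
  refine le_of_eq_of_le ?_ (hD (fun x => a (Function.update w i x))
    (fun y => b (Function.update w j y)) (fun x => ha _) (fun y => hb _))
  congr 1
  refine Finset.expect_congr rfl fun x _ => Finset.expect_congr rfl fun y _ => ?_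
  rw [h, ha', Function.update_comm hij, hb', Function.update_self, ← Function.update_comm hij,
    Function.update_self]

lemma abs_expect_triple_le {i j k : ι} (hij : i ≠ j) (hik : i ≠ k) (hjk : j ≠ k)
    (D : X i → X j → X k → ℝ) {τ : ℝ}
    (hD : ∀ (g₁ : X i → X j → ℝ) (g₂ : X i → X k → ℝ) (g₃ : X j → X k → ℝ),
      (∀ x y, g₁ x y ∈ Set.Icc (0 : ℝ) 1) → (∀ x y, g₂ x y ∈ Set.Icc (0 : ℝ) 1) →
      (∀ x y, g₃ x y ∈ Set.Icc (0 : ℝ) 1) →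
      |𝔼 x, 𝔼 y, 𝔼 z, D x y z * (g₁ x y * g₂ x z * g₃ y z)| ≤ τ)
    {G : (∀ i, X i) → ℝ} (hG : Split₃ i j k G) :
    |𝔼 w, D (w i) (w j) (w k) * G w| ≤ τ := by
  obtain ⟨a, b, c, ha, hb, hc, ha', hb', hc', h⟩ := hG
  rw [← expect_update k, ← expect_update j, ← expect_update i]
  refine abs_expect_le_of_forall fun w => ?_
  refine le_of_eq_of_le ?_ (hD (fun x y => a (Function.update (Function.update w i x) j y))
    (fun x z => b (Function.update (Function.update w i x) k z))
    (fun y z => c (Function.update (Function.update w j y) k z))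
    (fun _ _ => ha _) (fun _ _ => hb _) (fun _ _ => hc _))
  congr 1
  refine Finset.expect_congr rfl fun x _ => Finset.expect_congr rfl fun y _ =>
    Finset.expect_congr rfl fun z _ => ?_
  have e1 : b (Function.update (Function.update (Function.update w i x) j y) k z)
      = b (Function.update (Function.update w i x) k z) := by
    rw [Function.update_comm hjk, hb']
  have e2 : c (Function.update (Function.update (Function.update w i x) j y) k z)
      = c (Function.update (Function.update w j y) k z) := by
    rw [Function.update_comm hij, Function.update_comm hik, hc']
  have e3 : Function.update (Function.update (Function.update w i x) j y) k z i = x := by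
    rw [Function.update_of_ne hik, Function.update_of_ne hij, Function.update_self]
  have e4 : Function.update (Function.update (Function.update w i x) j y) k z j = y := by
    rw [Function.update_of_ne hjk, Function.update_self]
  rw [h, ha', e1, e2, e3, e4, Function.update_self]

end Expect

section Counting
set_option linter.unusedSectionVars false
variable {ι : Type} [Fintype ι] [DecidableEq ι] {X : ι → Type} [∀ i, Fintype (X i)] [∀ i, Nonempty (X i)]

lemma Indep.of_pair {i a b : ι} (ha : i ≠ a) (hb : i ≠ b) (Φ : X a → X b → ℝ) :
    Indep i (fun w : ∀ i, X i => Φ (w a) (w b)) := fun w x => by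
  simp only [Function.update_of_ne ha.symm, Function.update_of_ne hb.symm]

lemma Indep.of_triple {i a b c : ι} (ha : i ≠ a) (hb : i ≠ b) (hc : i ≠ c)
    (Φ : X a → X b → X c → ℝ) :
    Indep i (fun w : ∀ i, X i => Φ (w a) (w b) (w c)) := fun w x => by
  simp only [Function.update_of_ne ha.symm, Function.update_of_ne hb.symm,
    Function.update_of_ne hc.symm]

lemma abs_expect_prod_pairs_sub_le (P : ∀ i j, X i → X j → ℝ)
    (hP : ∀ i j x y, P i j x y ∈ Set.Icc (0 : ℝ) 1) (p : ι → ι → ℝ) {τ : ℝ}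
    (Y : Finset (ι × ι)) (hY : ∀ q ∈ Y, q.1 ≠ q.2) (hY' : ∀ q ∈ Y, (q.2, q.1) ∉ Y)
    (hp : ∀ q ∈ Y, p q.1 q.2 ∈ Set.Icc (0 : ℝ) 1)
    (hτ : ∀ q ∈ Y, ∀ (g₁ : X q.1 → ℝ) (g₂ : X q.2 → ℝ), (∀ x, g₁ x ∈ Set.Icc (0 : ℝ) 1) →
      (∀ y, g₂ y ∈ Set.Icc (0 : ℝ) 1) →
      |𝔼 x, 𝔼 y, (P q.1 q.2 x y - p q.1 q.2) * (g₁ x * g₂ y)| ≤ τ)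
    (B : (∀ i, X i) → ℝ) (hB : ∀ q ∈ Y, Split₂ q.1 q.2 B) :
    |𝔼 w, (∏ q ∈ Y, P q.1 q.2 (w q.1) (w q.2)) * B w - (∏ q ∈ Y, p q.1 q.2) * 𝔼 w, B w|
      ≤ Y.card * τ := by
  induction Y using Finset.induction_on with
  | empty => simp
  | insert q Y hq ih =>
    have ih := ih (fun r hr => hY r (by simp [hr])) (fun r hr h => hY' r (by simp [hr]) (by simp [h]))
      (fun r hr => hp r (by simp [hr])) (fun r hr => hτ r (by simp [hr]))
      (fun r hr => hB r (by simp [hr]))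
    simp only [Finset.prod_insert hq, Finset.card_insert_of_notMem hq]
    have hpq := hp q (by simp)
    have h1 : |𝔼 w : ∀ i, X i, (P q.1 q.2 (w q.1) (w q.2) - p q.1 q.2) *
        ((∏ r ∈ Y, P r.1 r.2 (w r.1) (w r.2)) * B w)| ≤ τ := by
      refine abs_expect_pair_le (hY q (by simp)) (fun x y => P q.1 q.2 x y - p q.1 q.2)
        (hτ q (by simp)) ?_
      refine Split₂.mul (Split₂.prod Y fun r hr => ?_) (hB q (by simp))
      refine Split₂.of_indep (fun w => hP _ _ _ _) ?_
      by_contra hcon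
      push Not at hcon
      have key : ∀ i : ι, ¬ Indep i (fun w : ∀ i, X i => P r.1 r.2 (w r.1) (w r.2)) →
          i = r.1 ∨ i = r.2 := by
        intro i hi
        by_contra h
        push Not at h
        exact hi (Indep.of_pair h.1 h.2 _)
      have hne := hY q (by simp)
      have hrq : r ≠ q := fun h => hq (h ▸ hr)
      have hsw := hY' r (by simp [hr])
      rcases key _ hcon.1 with h1 | h1 <;> rcases key _ hcon.2 with h2 | h2
      · exact hne (h1.trans h2.symm)
      · exact hrq (Prod.ext h1.symm h2.symm)
      · apply hsw
        rw [← h1, ← h2]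
        simp
      · exact hne (h1.trans h2.symm)
    have h2 : 𝔼 w : ∀ i, X i, P q.1 q.2 (w q.1) (w q.2) *
          (∏ r ∈ Y, P r.1 r.2 (w r.1) (w r.2)) * B w
        = 𝔼 w : ∀ i, X i, (P q.1 q.2 (w q.1) (w q.2) - p q.1 q.2) *
            ((∏ r ∈ Y, P r.1 r.2 (w r.1) (w r.2)) * B w)
          + p q.1 q.2 * 𝔼 w : ∀ i, X i, (∏ r ∈ Y, P r.1 r.2 (w r.1) (w r.2)) * B w := by
      rw [Finset.mul_expect, ← Finset.expect_add_distrib]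
      exact Finset.expect_congr rfl fun w _ => by ring
    rw [h2]
    set a := 𝔼 w : ∀ i, X i, (P q.1 q.2 (w q.1) (w q.2) - p q.1 q.2) *
            ((∏ r ∈ Y, P r.1 r.2 (w r.1) (w r.2)) * B w)
    set b := 𝔼 w : ∀ i, X i, (∏ r ∈ Y, P r.1 r.2 (w r.1) (w r.2)) * B w
    set c := (∏ r ∈ Y, p r.1 r.2) * 𝔼 w, B w
    have h3 : a + p q.1 q.2 * b - p q.1 q.2 * (∏ r ∈ Y, p r.1 r.2) * 𝔼 w, B w
        = a + p q.1 q.2 * (b - c) := by simp only [c]; ring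
    rw [h3]
    have h4 : |p q.1 q.2 * (b - c)| ≤ Y.card * τ := by
      rw [abs_mul, abs_of_nonneg hpq.1]
      exact (mul_le_of_le_one_left (abs_nonneg _) hpq.2).trans ih
    push_cast
    linarith [abs_add_le a (p q.1 q.2 * (b - c))]

lemma one_sub_sum_le_prod {α : Type} (s : Finset α) (q : α → ℝ)
    (h : ∀ a ∈ s, q a ∈ Set.Icc (0 : ℝ) 1) : 1 - ∑ a ∈ s, q a ≤ ∏ a ∈ s, (1 - q a) := by
  induction s using Finset.induction_on with
  | empty => simp
  | insert a s ha ih =>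
    have ih := ih fun b hb => h b (by simp [hb])
    rw [Finset.sum_insert ha, Finset.prod_insert ha]
    have h1 := h a (by simp)
    have h2 : ∏ a ∈ s, (1 - q a) ≤ 1 := (prod_mem_Icc s _ fun b hb => by
      have := h b (by simp [hb]); exact ⟨by linarith [this.2], by linarith [this.1]⟩).2
    nlinarith [h1.1, h1.2]

end Counting

section Main
set_option linter.unusedSectionVars false
variable {ι : Type} [Fintype ι] [LinearOrder ι] {X : ι → Type} [∀ i, Fintype (X i)]
  [∀ i, Nonempty (X i)]

/-- Product of a triple function over the triples of `E`, evaluated at `w`. -/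
noncomputable def tprod (E : Finset (ι × ι × ι)) (h : ∀ i j k, X i → X j → X k → ℝ)
    (w : ∀ i, X i) : ℝ := ∏ e ∈ E, h e.1 e.2.1 e.2.2 (w e.1) (w e.2.1) (w e.2.2)

/-- The pairs `i < j`. -/
noncomputable def ltPairs (ι : Type) [Fintype ι] [LinearOrder ι] : Finset (ι × ι) :=
  Finset.univ.filter fun q => q.1 < q.2

lemma split₃_of_pairs {P : ∀ i j, X i → X j → ℝ}
    (hP : ∀ i j x y, P i j x y ∈ Set.Icc (0 : ℝ) 1) {i j k : ι} (hij : i < j) (hjk : j < k) :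
    Split₃ i j k (fun w : ∀ i, X i => ∏ q ∈ ltPairs ι, P q.1 q.2 (w q.1) (w q.2)) := by
  refine Split₃.prod _ fun q _ => Split₃.of_indep (fun w => hP _ _ _ _) ?_
  have hik := hij.trans hjk
  by_contra hcon
  push Not at hcon
  have key : ∀ i : ι, ¬ Indep i (fun w : ∀ i, X i => P q.1 q.2 (w q.1) (w q.2)) →
      i = q.1 ∨ i = q.2 := by
    intro i hi
    by_contra h
    push Not at h
    exact hi (Indep.of_pair h.1 h.2 _)
  rcases key _ hcon.1 with h1 | h1 <;> rcases key _ hcon.2.1 with h2 | h2 <;>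
    rcases key _ hcon.2.2 with h3 | h3 <;> grind

lemma split₃_triple {h : ∀ i j k, X i → X j → X k → ℝ}
    (h01 : ∀ i j k x y z, h i j k x y z ∈ Set.Icc (0 : ℝ) 1) {i j k a b c : ι} (hij : i < j)
    (hjk : j < k) (hab : a < b) (hbc : b < c) (hne : (a, b, c) ≠ (i, j, k)) :
    Split₃ i j k (fun w : ∀ i, X i => h a b c (w a) (w b) (w c)) := by
  refine Split₃.of_indep (fun w => h01 _ _ _ _ _ _) ?_
  by_contra hcon
  push Not at hcon
  have key : ∀ i : ι, ¬ Indep i (fun w : ∀ i, X i => h a b c (w a) (w b) (w c)) →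
      i = a ∨ i = b ∨ i = c := by
    intro i hi
    by_contra h
    push Not at h
    exact hi (Indep.of_triple h.1 h.2.1 h.2.2 _)
  have := key _ hcon.1
  have := key _ hcon.2.1
  have := key _ hcon.2.2
  apply hne
  have h1 : i = a := by grind
  have h2 : j = b := by grind
  have h3 : k = c := by grind
  rw [h1, h2, h3]

lemma abs_expect_tprod_sub_le (W : (∀ i, X i) → ℝ) (E : Finset (ι × ι × ι))
    (hE : ∀ e ∈ E, e.1 < e.2.1 ∧ e.2.1 < e.2.2)
    (hW : ∀ e ∈ E, Split₃ e.1 e.2.1 e.2.2 W)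
    (h f : ∀ i j k, X i → X j → X k → ℝ)
    (hh : ∀ i j k x y z, h i j k x y z ∈ Set.Icc (0 : ℝ) 1)
    (hf : ∀ i j k x y z, f i j k x y z ∈ Set.Icc (0 : ℝ) 1) {δ : ℝ}
    (hδ : ∀ i j k, (i, j, k) ∈ E → ∀ (g₁ : X i → X j → ℝ) (g₂ : X i → X k → ℝ) (g₃ : X j → X k → ℝ),
      (∀ x y, g₁ x y ∈ Set.Icc (0 : ℝ) 1) → (∀ x y, g₂ x y ∈ Set.Icc (0 : ℝ) 1) →
      (∀ x y, g₃ x y ∈ Set.Icc (0 : ℝ) 1) →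
      |𝔼 x, 𝔼 y, 𝔼 z, (h i j k x y z - f i j k x y z) * (g₁ x y * g₂ x z * g₃ y z)| ≤ δ) :
    |𝔼 w, W w * tprod E h w - 𝔼 w, W w * tprod E f w| ≤ E.card * δ := by
  induction E using Finset.induction_on generalizing W with
  | empty => simp [tprod]
  | insert e E he ih =>
    obtain ⟨i, j, k⟩ := e
    have hlt := hE (i, j, k) (by simp)
    simp only at hlt
    have h1 : |𝔼 w : ∀ i, X i, (h i j k (w i) (w j) (w k) - f i j k (w i) (w j) (w k)) *
        (W w * tprod E h w)| ≤ δ := by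
      refine abs_expect_triple_le hlt.1.ne (hlt.1.trans hlt.2).ne hlt.2.ne
        (fun x y z => h i j k x y z - f i j k x y z) (hδ i j k (by simp)) ?_
      refine (hW (i, j, k) (by simp)).mul (Split₃.prod E fun r hr => ?_)
      have := hE r (by simp [hr])
      exact split₃_triple hh hlt.1 hlt.2 this.1 this.2 fun hr' => he (hr' ▸ hr)
    have h2 := ih (fun w => W w * f i j k (w i) (w j) (w k)) (fun r hr => hE r (by simp [hr]))
      (fun r hr => (hW r (by simp [hr])).mul (by
        have := hE r (by simp [hr])
        exact split₃_triple hf this.1 this.2 hlt.1 hlt.2 fun hr' => he (hr' ▸ hr)))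
      (fun a b c habc => hδ a b c (by simp [habc]))
    have h3 : 𝔼 w, W w * tprod (insert (i, j, k) E) h w
        - 𝔼 w, W w * tprod (insert (i, j, k) E) f w
        = 𝔼 w : ∀ i, X i, (h i j k (w i) (w j) (w k) - f i j k (w i) (w j) (w k)) *
          (W w * tprod E h w) +
          (𝔼 w, W w * f i j k (w i) (w j) (w k) * tprod E h w
          - 𝔼 w, W w * f i j k (w i) (w j) (w k) * tprod E f w) := by
      rw [← Finset.expect_sub_distrib, ← Finset.expect_sub_distrib, ← Finset.expect_add_distrib]
      refine Finset.expect_congr rfl fun w _ => ?_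
      simp only [tprod, Finset.prod_insert he]
      ring
    rw [h3, Finset.card_insert_of_notMem he]
    push_cast
    refine (abs_add_le _ _).trans ?_
    linarith

/-- Counting lemma: quasirandom pair graphs `P`, and triple functions `h` close to `f`, where `f`
is rarely below `θ` on the triangles of `P`. -/
lemma counting (P : ∀ i j, X i → X j → ℝ)
    (hP : ∀ i j x y, P i j x y ∈ Set.Icc (0 : ℝ) 1) (p : ι → ι → ℝ) {τ : ℝ}
    (hp : ∀ i j, i < j → p i j ∈ Set.Icc (0 : ℝ) 1)
    (hτ : ∀ i j, i < j → ∀ (g₁ : X i → ℝ) (g₂ : X j → ℝ), (∀ x, g₁ x ∈ Set.Icc (0 : ℝ) 1) →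
      (∀ y, g₂ y ∈ Set.Icc (0 : ℝ) 1) →
      |𝔼 x, 𝔼 y, (P i j x y - p i j) * (g₁ x * g₂ y)| ≤ τ)
    (E : Finset (ι × ι × ι)) (hE : ∀ e ∈ E, e.1 < e.2.1 ∧ e.2.1 < e.2.2)
    (h f : ∀ i j k, X i → X j → X k → ℝ)
    (hh : ∀ i j k x y z, h i j k x y z ∈ Set.Icc (0 : ℝ) 1)
    (hf : ∀ i j k x y z, f i j k x y z ∈ Set.Icc (0 : ℝ) 1) {δ θ ζ : ℝ}
    (hδ : ∀ i j k, (i, j, k) ∈ E → ∀ (g₁ : X i → X j → ℝ) (g₂ : X i → X k → ℝ) (g₃ : X j → X k → ℝ),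
      (∀ x y, g₁ x y ∈ Set.Icc (0 : ℝ) 1) → (∀ x y, g₂ x y ∈ Set.Icc (0 : ℝ) 1) →
      (∀ x y, g₃ x y ∈ Set.Icc (0 : ℝ) 1) →
      |𝔼 x, 𝔼 y, 𝔼 z, (h i j k x y z - f i j k x y z) * (g₁ x y * g₂ x z * g₃ y z)| ≤ δ)
    (hθ : 0 ≤ θ)
    (hζ : ∀ i j k, (i, j, k) ∈ E → 𝔼 x, 𝔼 y, 𝔼 z, P i j x y * P i k x z * P j k y z *
      (if f i j k x y z < θ then 1 else 0) ≤ ζ * (p i j * p i k * p j k)) :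
    θ ^ E.card * ((1 - E.card * ζ) * ∏ q ∈ ltPairs ι, p q.1 q.2
      - (1 + E.card) * ((ltPairs ι).card * τ)) - E.card * δ ≤ 𝔼 w, tprod E h w := by
  have hppos : ∀ q ∈ ltPairs ι, p q.1 q.2 ∈ Set.Icc (0 : ℝ) 1 := fun q hq =>
    hp _ _ (by simpa [ltPairs] using hq)
  have hne : ∀ q ∈ ltPairs ι, q.1 ≠ q.2 := fun q hq => by
    have : q.1 < q.2 := by simpa [ltPairs] using hq
    exact this.ne
  have hsw : ∀ q ∈ ltPairs ι, (q.2, q.1) ∉ ltPairs ι := fun q hq hq' => by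
    have h1 : q.1 < q.2 := by simpa [ltPairs] using hq
    have h2 : q.2 < q.1 := by simpa [ltPairs] using hq'
    exact lt_asymm h1 h2
  have hτ0 : ∀ q ∈ ltPairs ι, 0 ≤ τ := fun q hq =>
    (abs_nonneg _).trans (hτ q.1 q.2 (by simpa [ltPairs] using hq) (fun _ => 0) (fun _ => 0)
      (fun _ => by simp) (fun _ => by simp))
  set W : (∀ i, X i) → ℝ := fun w => ∏ q ∈ ltPairs ι, P q.1 q.2 (w q.1) (w q.2) with hW
  have hW01 : ∀ w, W w ∈ Set.Icc (0 : ℝ) 1 := fun w => prod_mem_Icc _ _ fun q _ => hP _ _ _ _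
  have hth : ∀ w, tprod E h w ∈ Set.Icc (0 : ℝ) 1 := fun w => prod_mem_Icc _ _ fun q _ =>
    hh _ _ _ _ _ _
  have h1 : 𝔼 w, W w * tprod E h w ≤ 𝔼 w, tprod E h w :=
    Finset.expect_le_expect fun w _ => mul_le_of_le_one_left (hth w).1 (hW01 w).2
  have h2 := abs_expect_tprod_sub_le W E hE
    (fun e he => split₃_of_pairs hP (hE e he).1 (hE e he).2) h f hh hf hδ
  have h3 : |𝔼 w, W w * 1 - (∏ q ∈ ltPairs ι, p q.1 q.2) * 𝔼 w : ∀ i, X i, (1 : ℝ)|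
      ≤ (ltPairs ι).card * τ :=
    abs_expect_prod_pairs_sub_le P hP p (ltPairs ι) hne hsw hppos
      (fun q hq => hτ _ _ (by simpa [ltPairs] using hq)) (fun _ => 1) (fun q _ => Split₂.one _ _)
  set q : ι × ι × ι → (∀ i, X i) → ℝ := fun e w =>
    if f e.1 e.2.1 e.2.2 (w e.1) (w e.2.1) (w e.2.2) < θ then 1 else 0 with hq
  have hq01 : ∀ e w, q e w ∈ Set.Icc (0 : ℝ) 1 := fun e w => by
    simp only [hq]; split_ifs <;> simp
  have h4 : ∀ w, θ ^ E.card * (W w - ∑ e ∈ E, W w * q e w) ≤ W w * tprod E f w := by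
    intro w
    have h5 : θ ^ E.card * (1 - ∑ e ∈ E, q e w) ≤ tprod E f w := by
      calc θ ^ E.card * (1 - ∑ e ∈ E, q e w) ≤ θ ^ E.card * ∏ e ∈ E, (1 - q e w) :=
            mul_le_mul_of_nonneg_left (one_sub_sum_le_prod E _ fun e _ => hq01 e w) (by positivity)
        _ = ∏ e ∈ E, θ * (1 - q e w) := by rw [Finset.prod_mul_distrib, Finset.prod_const]
        _ ≤ tprod E f w := by
            refine Finset.prod_le_prod (fun e _ => mul_nonneg hθ (by linarith [(hq01 e w).2]))
              fun e _ => ?_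
            simp only [hq]
            split_ifs with h6
            · simpa using (hf _ _ _ _ _ _).1
            · simpa using h6
    calc θ ^ E.card * (W w - ∑ e ∈ E, W w * q e w)
        = W w * (θ ^ E.card * (1 - ∑ e ∈ E, q e w)) := by rw [← Finset.mul_sum]; ring
      _ ≤ _ := mul_le_mul_of_nonneg_left h5 (hW01 w).1
  have h6 : ∀ e ∈ E, 𝔼 w, W w * q e w ≤
      ζ * (∏ q ∈ ltPairs ι, p q.1 q.2) + (ltPairs ι).card * τ := by
    rintro ⟨i, j, k⟩ he
    obtain ⟨hij, hjk⟩ := hE _ he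
    simp only at hij hjk
    have hik := hij.trans hjk
    set S : Finset (ι × ι) := {(i, j), (i, k), (j, k)} with hS
    have hSsub : S ⊆ ltPairs ι := by
      intro r hr
      simp only [hS, Finset.mem_insert, Finset.mem_singleton] at hr
      rcases hr with rfl | rfl | rfl <;> simpa [ltPairs]
    have hSprod : ∀ g : ι × ι → ℝ, ∏ r ∈ S, g r = g (i, j) * g (i, k) * g (j, k) := by
      intro g
      rw [hS, Finset.prod_insert, Finset.prod_insert, Finset.prod_singleton, mul_assoc]
      · simp [hij.ne]
      · simp [hij.ne, hjk.ne]
    set B : (∀ i, X i) → ℝ := fun w => P i j (w i) (w j) * P i k (w i) (w k) * P j k (w j) (w k) *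
      (if f i j k (w i) (w j) (w k) < θ then 1 else 0) with hB
    have hB01 : ∀ w, B w ∈ Set.Icc (0 : ℝ) 1 := fun w =>
      mul_mem_Icc (mul_mem_Icc (mul_mem_Icc (hP _ _ _ _) (hP _ _ _ _)) (hP _ _ _ _))
        (hq01 (i, j, k) w)
    have hBsplit : ∀ r ∈ ltPairs ι \ S, Split₂ r.1 r.2 B := by
      intro r hr
      refine Split₂.of_indep hB01 ?_
      have hr' := Finset.mem_sdiff.1 hr
      have hrlt : r.1 < r.2 := by simpa [ltPairs] using hr'.1
      by_contra hcon
      push Not at hcon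
      have key : ∀ a : ι, ¬ Indep a B → a = i ∨ a = j ∨ a = k := by
        intro a ha
        by_contra h
        push Not at h
        exact ha (Indep.of_triple h.1 h.2.1 h.2.2 (fun x y z => P i j x y * P i k x z * P j k y z *
          (if f i j k x y z < θ then 1 else 0)))
      apply hr'.2
      have k1 := key _ hcon.1
      have k2 := key _ hcon.2
      have : r = (r.1, r.2) := rfl
      rw [hS, this]
      rcases k1 with k1 | k1 | k1 <;> rcases k2 with k2 | k2 | k2 <;> rw [k1, k2] at hrlt ⊢ <;>
        first | (simp; done) | (exfalso; grind)
    have h7 := abs_expect_prod_pairs_sub_le P hP p (ltPairs ι \ S)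
      (fun r hr => hne r (Finset.mem_sdiff.1 hr).1)
      (fun r hr hr' => hsw r (Finset.mem_sdiff.1 hr).1 (Finset.mem_sdiff.1 hr').1)
      (fun r hr => hppos r (Finset.mem_sdiff.1 hr).1)
      (fun r hr => hτ _ _ (by simpa [ltPairs] using (Finset.mem_sdiff.1 hr).1)) B hBsplit
    have h8 : 𝔼 w, W w * q (i, j, k) w
        = 𝔼 w, (∏ r ∈ ltPairs ι \ S, P r.1 r.2 (w r.1) (w r.2)) * B w := by
      refine Finset.expect_congr rfl fun w _ => ?_
      rw [hW]
      simp only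
      rw [← Finset.prod_sdiff hSsub, hSprod]
      simp only [hB, hq]
      ring
    have h9 : 𝔼 w, B w ≤ ζ * (p i j * p i k * p j k) := by
      refine le_trans ?_ (hζ i j k he)
      rw [hB, ← expect_update k, ← expect_update j, ← expect_update i]
      refine Finset.expect_le Finset.univ_nonempty fun w _ => le_of_eq ?_
      refine Finset.expect_congr rfl fun x _ => Finset.expect_congr rfl fun y _ =>
        Finset.expect_congr rfl fun z _ => ?_
      have e3 : Function.update (Function.update (Function.update w i x) j y) k z i = x := by
        rw [Function.update_of_ne hik.ne, Function.update_of_ne hij.ne, Function.update_self]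
      have e4 : Function.update (Function.update (Function.update w i x) j y) k z j = y := by
        rw [Function.update_of_ne hjk.ne, Function.update_self]
      rw [e3, e4, Function.update_self]
    have hp1 : 0 ≤ ∏ r ∈ ltPairs ι \ S, p r.1 r.2 :=
      Finset.prod_nonneg fun r hr => (hppos r (Finset.mem_sdiff.1 hr).1).1
    have h10 : (∏ r ∈ ltPairs ι \ S, p r.1 r.2) * 𝔼 w, B w
        ≤ ζ * ∏ r ∈ ltPairs ι, p r.1 r.2 := by
      rw [← Finset.prod_sdiff hSsub, hSprod]
      calc _ ≤ (∏ r ∈ ltPairs ι \ S, p r.1 r.2) * (ζ * (p i j * p i k * p j k)) :=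
            mul_le_mul_of_nonneg_left h9 hp1
        _ = _ := by ring
    have h11 : ((ltPairs ι \ S).card : ℝ) * τ ≤ (ltPairs ι).card * τ := by
      refine mul_le_mul_of_nonneg_right (by exact_mod_cast Finset.card_le_card Finset.sdiff_subset)
        (hτ0 (i, j) (hSsub (by simp [hS])))
    rw [h8]
    linarith [(abs_le.1 h7).2]
  have h12 : θ ^ E.card * (𝔼 w, W w - ∑ e ∈ E, 𝔼 w, W w * q e w) ≤ 𝔼 w, W w * tprod E f w := by
    calc _ = 𝔼 w, θ ^ E.card * (W w - ∑ e ∈ E, W w * q e w) := by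
          rw [← Finset.mul_expect, Finset.expect_sub_distrib, Finset.expect_sum_comm]
      _ ≤ _ := Finset.expect_le_expect fun w _ => h4 w
  have h13 := Finset.sum_le_sum h6
  rw [Finset.sum_const, nsmul_eq_mul] at h13
  simp only [mul_one, Fintype.expect_const] at h3
  have h14 := (abs_le.1 h3).1
  have h15 := (abs_le.1 h2).1
  have h16 : θ ^ E.card * ((1 - E.card * ζ) * ∏ q ∈ ltPairs ι, p q.1 q.2
      - (1 + E.card) * ((ltPairs ι).card * τ)) ≤
      θ ^ E.card * (𝔼 w, W w - ∑ e ∈ E, 𝔼 w, W w * q e w) := by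
    refine mul_le_mul_of_nonneg_left ?_ (by positivity)
    linarith
  linarith

end Main

section Average
set_option linter.unusedSectionVars false
variable {Ω T T' : Type} [Fintype Ω] [Nonempty Ω]

/-- Conditional expectation of `f` with respect to the partition into fibres of `π`. -/
noncomputable def avg (π : Ω → T) (f : Ω → ℝ) (ω : Ω) : ℝ :=
  𝔼 ω' ∈ Finset.univ.filter (fun ω' => π ω' = π ω), f ω'

/-- `g` is constant on the fibres of `π`. -/
def Meas (π : Ω → T) (g : Ω → ℝ) : Prop := ∀ ω ω', π ω = π ω' → g ω = g ω'

lemma avg_meas (π : Ω → T) (f : Ω → ℝ) : Meas π (avg π f) := fun ω ω' h => by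
  simp only [avg, h]

lemma avg_mem_Icc (π : Ω → T) {f : Ω → ℝ} (hf : ∀ ω, f ω ∈ Set.Icc (0 : ℝ) 1) (ω : Ω) :
    avg π f ω ∈ Set.Icc (0 : ℝ) 1 :=
  ⟨Finset.expect_nonneg fun ω _ => (hf ω).1,
    Finset.expect_le ⟨ω, by simp⟩ fun ω _ => (hf ω).2⟩

lemma expect_avg_mul (π : Ω → T) (f : Ω → ℝ) {g : Ω → ℝ} (hg : Meas π g) :
    𝔼 ω, avg π f ω * g ω = 𝔼 ω, f ω * g ω := by
  rw [Finset.expect, Finset.expect]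
  congr 1
  have h1 : ∀ ω, avg π f ω * g ω =
      ∑ ω', if π ω' = π ω then
        ((Finset.univ.filter (fun ω'' => π ω'' = π ω')).card : ℝ)⁻¹ * (f ω' * g ω') else 0 := by
    intro ω
    rw [avg, Finset.expect_eq_sum_div_card, div_eq_inv_mul, mul_assoc, Finset.sum_mul,
      Finset.mul_sum, Finset.sum_filter]
    refine Finset.sum_congr rfl fun ω' _ => ?_
    split_ifs with h
    · rw [h, hg _ _ h]
    · rfl
  simp only [h1]
  rw [Finset.sum_comm]
  refine Finset.sum_congr rfl fun ω' _ => ?_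
  rw [← Finset.sum_filter, Finset.sum_const, nsmul_eq_mul]
  have : (Finset.univ.filter (fun ω'' => π ω' = π ω'')) =
    (Finset.univ.filter (fun ω'' => π ω'' = π ω')) := Finset.filter_congr fun _ _ => eq_comm
  rw [this, ← mul_assoc, mul_inv_cancel₀, one_mul]
  exact_mod_cast (Finset.card_pos.2 ⟨ω', by simp⟩).ne'

lemma abs_expect_sq_le (f : Ω → ℝ) : (𝔼 ω, |f ω|) ^ 2 ≤ 𝔼 ω, f ω ^ 2 := by
  have := Finset.expect_mul_sq_le_sq_mul_sq (Finset.univ : Finset Ω) (fun ω => |f ω|) (fun _ => 1)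
  simpa using this

lemma energy_increment (π : Ω → T) (π' : Ω → T') (hπ : ∀ ω ω', π' ω = π' ω' → π ω = π ω')
    (f : Ω → ℝ) :
    𝔼 ω, avg π' f ω ^ 2 = 𝔼 ω, avg π f ω ^ 2 + 𝔼 ω, (avg π' f ω - avg π f ω) ^ 2 := by
  have h1 : Meas π' (avg π f) := fun ω ω' h => avg_meas π f _ _ (hπ _ _ h)
  have h2 := expect_avg_mul π' f h1
  have h3 := expect_avg_mul π f (avg_meas π f)
  have h4 : 𝔼 ω, (avg π' f ω - avg π f ω) ^ 2 =
      𝔼 ω, avg π' f ω ^ 2 - 2 * 𝔼 ω, avg π' f ω * avg π f ω + 𝔼 ω, avg π f ω * avg π f ω := by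
    rw [Finset.mul_expect, ← Finset.expect_sub_distrib, ← Finset.expect_add_distrib]
    exact Finset.expect_congr rfl fun ω _ => by ring
  have h5 : 𝔼 ω, avg π f ω ^ 2 = 𝔼 ω, avg π f ω * avg π f ω :=
    Finset.expect_congr rfl fun ω _ => by ring
  rw [h4, h2, h5, h3]
  ring

lemma energy_gain (π : Ω → T) (π' : Ω → T') (hπ : ∀ ω ω', π' ω = π' ω' → π ω = π ω')
    (f g : Ω → ℝ) (hg : Meas π' g) (hg1 : ∀ ω, |g ω| ≤ 1) {δ : ℝ} (hδ : 0 ≤ δ)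
    (h : δ ≤ |𝔼 ω, (f ω - avg π f ω) * g ω|) :
    𝔼 ω, avg π f ω ^ 2 + δ ^ 2 ≤ 𝔼 ω, avg π' f ω ^ 2 := by
  rw [energy_increment π π' hπ f]
  have h1 : 𝔼 ω, (f ω - avg π f ω) * g ω = 𝔼 ω, (avg π' f ω - avg π f ω) * g ω := by
    simp only [sub_mul, Finset.expect_sub_distrib, expect_avg_mul π' f hg]
  have h2 : δ ≤ 𝔼 ω, |avg π' f ω - avg π f ω| := by
    refine h.trans ?_
    rw [h1]
    refine (Finset.abs_expect_le _ _).trans (Finset.expect_le_expect fun ω _ => ?_)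
    rw [abs_mul]
    exact mul_le_of_le_one_right (abs_nonneg _) (hg1 ω)
  have h3 := abs_expect_sq_le fun ω => avg π' f ω - avg π f ω
  have : δ ^ 2 ≤ (𝔼 ω, |avg π' f ω - avg π f ω|) ^ 2 := pow_le_pow_left₀ hδ h2 2
  linarith

lemma energy_mem_Icc (π : Ω → T) {f : Ω → ℝ} (hf : ∀ ω, f ω ∈ Set.Icc (0 : ℝ) 1) :
    𝔼 ω, avg π f ω ^ 2 ∈ Set.Icc (0 : ℝ) 1 :=
  ⟨Finset.expect_nonneg fun ω _ => sq_nonneg _,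
    Finset.expect_le Finset.univ_nonempty fun ω _ => by
      exact pow_le_one₀ (avg_mem_Icc π hf ω).1 (avg_mem_Icc π hf ω).2⟩

lemma exists_zero_one (L g : Ω → ℝ) (hg : ∀ ω, g ω ∈ Set.Icc (0 : ℝ) 1) :
    ∃ s : Ω → ℝ, (∀ ω, s ω = 0 ∨ s ω = 1) ∧ |𝔼 ω, L ω * g ω| ≤ |𝔼 ω, L ω * s ω| := by
  rcases le_total 0 (𝔼 ω, L ω * g ω) with h | h
  · refine ⟨fun ω => if 0 ≤ L ω then 1 else 0, fun ω => by dsimp only; split_ifs <;> simp, ?_⟩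
    rw [abs_of_nonneg h]
    refine le_trans (Finset.expect_le_expect fun ω _ => ?_) (le_abs_self _)
    have := hg ω
    dsimp only
    split_ifs with h0
    · nlinarith [this.2]
    · nlinarith [this.1]
  · refine ⟨fun ω => if L ω ≤ 0 then 1 else 0, fun ω => by dsimp only; split_ifs <;> simp, ?_⟩
    rw [abs_of_nonpos h]
    refine le_trans ?_ (neg_le_abs _)
    refine neg_le_neg (Finset.expect_le_expect fun ω _ => ?_)
    have := hg ω
    dsimp only
    split_ifs with h0
    · nlinarith [this.2]
    · nlinarith [this.1]

end Average

/-- Iterating a step that increases a bounded energy by a fixed amount. -/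
lemma exists_good_of_energy {S : Type} (size : S → ℕ) (en : S → ℝ) (good : S → Prop)
    (R : S → S → Prop) (hR : ∀ s, R s s) (hRt : ∀ a b c, R a b → R b c → R a c) {γ : ℝ} (hγ : 0 < γ)
    (hen : ∀ s, en s ∈ Set.Icc (0 : ℝ) 1) (g : ℕ → ℕ) (hg : Monotone g) (hg' : ∀ k, k ≤ g k)
    (step : ∀ s, ¬ good s → ∃ s', R s s' ∧ size s' ≤ g (size s) ∧ en s + γ ≤ en s') (s : S) :
    ∃ s', R s s' ∧ good s' ∧ size s' ≤ g^[⌈1 / γ⌉₊] (size s) := by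
  have key : ∀ n : ℕ, ∀ s, 1 - en s ≤ n * γ → ∃ s', R s s' ∧ good s' ∧ size s' ≤ g^[n] (size s) := by
    intro n
    induction n with
    | zero =>
      intro s hs
      by_contra hcon
      have hb : ¬ good s := fun h => hcon ⟨s, hR s, h, le_rfl⟩
      obtain ⟨s', -, -, h⟩ := step s hb
      have := (hen s').2
      simp at hs
      linarith
    | succ n ih =>
      intro s hs
      by_cases hb : good s
      · refine ⟨s, hR s, hb, ?_⟩
        exact Function.id_le_iterate_of_id_le hg' (n + 1) (size s)
      · obtain ⟨s', h1, h2, h3⟩ := step s hb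
        push_cast at hs
        obtain ⟨s'', h4, h5, h6⟩ := ih s' (by linarith)
        refine ⟨s'', hRt _ _ _ h1 h4, h5, h6.trans ?_⟩
        rw [Function.iterate_succ_apply]
        exact hg.iterate n h2
  refine key _ s ?_
  have h1 : 1 / γ ≤ ⌈1 / γ⌉₊ := Nat.le_ceil _
  rw [div_le_iff₀ hγ] at h1
  linarith [(hen s).1]

section Strong
set_option linter.unusedSectionVars false
variable {V : Type} [Fintype V] [Nonempty V]

lemma expect_triple (G : V × V × V → ℝ) : 𝔼 ω, G ω = 𝔼 x, 𝔼 y, 𝔼 z, G (x, y, z) := by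
  rw [← Finset.univ_product_univ, Finset.expect_product]
  refine Finset.expect_congr rfl fun x _ => ?_
  rw [← Finset.univ_product_univ, Finset.expect_product]

lemma expect_pair {α β : Type} [Fintype α] [Fintype β] (G : α × β → ℝ) :
    𝔼 ω, G ω = 𝔼 x, 𝔼 y, G (x, y) := by
  rw [← Finset.univ_product_univ, Finset.expect_product]

/-- The partition of triples induced by a colouring of pairs. -/
def triCol (c : V → V → ℕ) (ω : V × V × V) : ℕ × ℕ × ℕ :=
  (c ω.1 ω.2.1, c ω.1 ω.2.2, c ω.2.1 ω.2.2)

/-- `D` has correlation at most `δ` with triangles. -/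
def Unif (δ : ℝ) (D : V × V × V → ℝ) : Prop :=
  ∀ a b g : V → V → ℝ, (∀ x y, a x y ∈ Set.Icc (0 : ℝ) 1) → (∀ x y, b x y ∈ Set.Icc (0 : ℝ) 1) →
    (∀ x y, g x y ∈ Set.Icc (0 : ℝ) 1) →
    |𝔼 ω, D ω * (a ω.1 ω.2.1 * b ω.1 ω.2.2 * g ω.2.1 ω.2.2)| ≤ δ

lemma exists_zero_one_pair (D : V × V × V → ℝ) (u : V × V × V → ℝ) (p : V × V × V → V × V)
    (a : V → V → ℝ)
    (ha : ∀ x y, a x y ∈ Set.Icc (0 : ℝ) 1) :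
    ∃ s : V → V → ℝ, (∀ x y, s x y = 0 ∨ s x y = 1) ∧
      |𝔼 ω, D ω * (a (p ω).1 (p ω).2 * u ω)| ≤ |𝔼 ω, D ω * (s (p ω).1 (p ω).2 * u ω)| := by
  have key : ∀ t : V → V → ℝ, 𝔼 ω, D ω * (t (p ω).1 (p ω).2 * u ω)
      = 𝔼 q : V × V, (𝔼 ω : V × V × V, Fintype.card (V × V) * (if p ω = q then D ω * u ω else 0)) *
          t q.1 q.2 := by
    intro t
    simp only [Finset.expect_mul]
    rw [Finset.expect_comm]
    refine Finset.expect_congr rfl fun ω _ => ?_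
    rw [Finset.expect_eq_sum_div_card, Finset.sum_eq_single (p ω)]
    · have : (Fintype.card (V × V) : ℝ) ≠ 0 := by exact_mod_cast Fintype.card_ne_zero
      simp only [if_true, Finset.card_univ]
      field_simp
    · intro q _ hq
      simp [hq.symm]
    · simp
  obtain ⟨s, hs, h⟩ := exists_zero_one (fun q : V × V =>
    𝔼 ω : V × V × V, (Fintype.card (V × V) : ℝ) * (if p ω = q then D ω * u ω else 0))
    (fun q => a q.1 q.2) (fun q => ha _ _)
  refine ⟨fun x y => s (x, y), fun x y => hs _, ?_⟩
  rw [key, key (fun x y => s (x, y))]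
  exact h

lemma exists_zero_one_of_not_unif {δ : ℝ} {D : V × V × V → ℝ} (h : ¬ Unif δ D) :
    ∃ a b g : V → V → ℝ, (∀ x y, a x y = 0 ∨ a x y = 1) ∧ (∀ x y, b x y = 0 ∨ b x y = 1) ∧
    (∀ x y, g x y = 0 ∨ g x y = 1) ∧
    δ < |𝔼 ω, D ω * (a ω.1 ω.2.1 * b ω.1 ω.2.2 * g ω.2.1 ω.2.2)| := by
  unfold Unif at h
  push Not at h
  obtain ⟨a, b, g, ha, hb, hg, h⟩ := h
  obtain ⟨a', ha', h1⟩ := exists_zero_one_pair D (fun ω => b ω.1 ω.2.2 * g ω.2.1 ω.2.2)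
    (fun ω => (ω.1, ω.2.1)) a ha
  obtain ⟨b', hb', h2⟩ := exists_zero_one_pair D (fun ω => a' ω.1 ω.2.1 * g ω.2.1 ω.2.2)
    (fun ω => (ω.1, ω.2.2)) b hb
  obtain ⟨g', hg', h3⟩ := exists_zero_one_pair D (fun ω => a' ω.1 ω.2.1 * b' ω.1 ω.2.2)
    (fun ω => (ω.2.1, ω.2.2)) g hg
  refine ⟨a', b', g', ha', hb', hg', h.trans_le ?_⟩
  calc _ = |𝔼 ω, D ω * (a ω.1 ω.2.1 * (b ω.1 ω.2.2 * g ω.2.1 ω.2.2))| := by simp only [mul_assoc]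
    _ ≤ _ := h1
    _ = |𝔼 ω, D ω * (b ω.1 ω.2.2 * (a' ω.1 ω.2.1 * g ω.2.1 ω.2.2))| := by
        simp only [mul_left_comm]
    _ ≤ _ := h2
    _ = |𝔼 ω, D ω * (g ω.2.1 ω.2.2 * (a' ω.1 ω.2.1 * b' ω.1 ω.2.2))| := by
        congr 1
        exact Finset.expect_congr rfl fun ω _ => by ring
    _ ≤ _ := h3
    _ = _ := by
        congr 1
        exact Finset.expect_congr rfl fun ω _ => by ring

/-- Pair colourings using the colours below a bound. -/
structure PairCol (V : Type) where
  size : ℕ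
  col : V → V → ℕ
  col_lt : ∀ x y, col x y < size

/-- Refinement of pair colourings. -/
def PairCol.Refines (s s' : PairCol V) : Prop :=
  ∀ x y x' y', s'.col x y = s'.col x' y' → s.col x y = s.col x' y'

lemma PairCol.Refines.triCol {s s' : PairCol V} (h : s.Refines s') (ω ω' : V × V × V)
    (hω : triCol s'.col ω = triCol s'.col ω') : triCol s.col ω = triCol s.col ω' := by
  simp only [UTD.triCol, Prod.mk.injEq] at hω ⊢
  exact ⟨h _ _ _ _ hω.1, h _ _ _ _ hω.2.1, h _ _ _ _ hω.2.2⟩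

lemma exists_refines_unif (h : V × V × V → ℝ) (hh : ∀ ω, h ω ∈ Set.Icc (0 : ℝ) 1) {δ : ℝ}
    (hδ : 0 < δ) (s : PairCol V) : ∃ s' : PairCol V, s.Refines s' ∧
      Unif δ (fun ω => h ω - avg (triCol s'.col) h ω) ∧
      s'.size ≤ (fun k => 8 * k)^[⌈1 / δ ^ 2⌉₊] s.size := by
  refine exists_good_of_energy PairCol.size (fun s => 𝔼 ω, avg (triCol s.col) h ω ^ 2)
    (fun s => Unif δ (fun ω => h ω - avg (triCol s.col) h ω)) PairCol.Refines
    (fun s x y x' y' h => h) (fun a b c h1 h2 x y x' y' h => h1 _ _ _ _ (h2 _ _ _ _ h))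
    (by positivity) (fun s => energy_mem_Icc _ hh) (fun k => 8 * k)
    (fun a b hab => by dsimp only; omega) (fun k => by omega) ?_ s
  intro s hs
  obtain ⟨a, b, g, ha, hb, hg, hD⟩ := exists_zero_one_of_not_unif hs
  set bit : ℝ → ℕ := fun t => if t = 1 then 1 else 0 with hbit
  have hbit1 : ∀ t, bit t ≤ 1 := fun t => by simp only [hbit]; split_ifs <;> simp
  have hbit2 : ∀ t t' : ℝ, (t = 0 ∨ t = 1) → (t' = 0 ∨ t' = 1) → bit t = bit t' → t = t' := by
    rintro t t' (rfl | rfl) (rfl | rfl) <;> simp [hbit]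
  let s' : PairCol V := ⟨8 * s.size,
    fun x y => 8 * s.col x y + 4 * bit (a x y) + 2 * bit (b x y) + bit (g x y), fun x y => by
      have := s.col_lt x y
      have := hbit1 (a x y)
      have := hbit1 (b x y)
      have := hbit1 (g x y)
      omega⟩
  have hsplit : ∀ x y x' y', s'.col x y = s'.col x' y' →
      s.col x y = s.col x' y' ∧ a x y = a x' y' ∧ b x y = b x' y' ∧ g x y = g x' y' := by
    intro x y x' y' h
    simp only [s'] at h
    have h1 := hbit1 (a x y)
    have h2 := hbit1 (b x y)
    have h3 := hbit1 (g x y)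
    have h1' := hbit1 (a x' y')
    have h2' := hbit1 (b x' y')
    have h3' := hbit1 (g x' y')
    exact ⟨by omega, hbit2 _ _ (ha _ _) (ha _ _) (by omega), hbit2 _ _ (hb _ _) (hb _ _) (by omega),
      hbit2 _ _ (hg _ _) (hg _ _) (by omega)⟩
  have href : s.Refines s' := fun x y x' y' h => (hsplit x y x' y' h).1
  refine ⟨s', href, le_rfl, ?_⟩
  refine energy_gain (triCol s.col) (triCol s'.col) href.triCol h
    (fun ω => a ω.1 ω.2.1 * b ω.1 ω.2.2 * g ω.2.1 ω.2.2) ?_ ?_ hδ.le hD.le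
  · intro ω ω' hω
    simp only [triCol, Prod.mk.injEq] at hω
    dsimp only
    rw [(hsplit _ _ _ _ hω.1).2.1, (hsplit _ _ _ _ hω.2.1).2.2.1, (hsplit _ _ _ _ hω.2.2).2.2.2]
  · intro ω
    rcases ha ω.1 ω.2.1 with h1 | h1 <;> rcases hb ω.1 ω.2.2 with h2 | h2 <;>
      rcases hg ω.2.1 ω.2.2 with h3 | h3 <;> simp [h1, h2, h3]

end Strong

/-- Strong regularity for weighted triple systems with respect to pair colourings. -/
lemma strong_regularity {ε : ℝ} (hε : 0 < ε) (Φ : ℕ → ℝ) (hΦ : ∀ k, 0 < Φ k) :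
    ∃ M : ℕ, ∀ (V : Type) [Fintype V] [Nonempty V] (h : V × V × V → ℝ),
      (∀ ω, h ω ∈ Set.Icc (0 : ℝ) 1) → ∃ K ≤ M, ∃ (c : V → V → Fin K) (F : Fin K → Fin K → Fin K → ℝ)
        (f : V × V × V → ℝ), (∀ i j k, F i j k ∈ Set.Icc (0 : ℝ) 1) ∧
        (∀ ω, f ω ∈ Set.Icc (0 : ℝ) 1) ∧
        𝔼 ω, |f ω - F (c ω.1 ω.2.1) (c ω.1 ω.2.2) (c ω.2.1 ω.2.2)| ≤ ε ∧
        Unif (Φ K) (fun ω => h ω - f ω) := by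
  set G : ℕ → ℕ := fun K => ∑ k ∈ Finset.range (K + 1), (fun k => 8 * k)^[⌈1 / Φ k ^ 2⌉₊] k with hG
  have hG1 : ∀ K, (fun k => 8 * k)^[⌈1 / Φ K ^ 2⌉₊] K ≤ G K := fun K =>
    Finset.single_le_sum (f := fun k => (fun k => 8 * k)^[⌈1 / Φ k ^ 2⌉₊] k)
      (fun _ _ => Nat.zero_le _) (by simp)
  have hGmono : Monotone G := fun a b hab =>
    Finset.sum_le_sum_of_subset (Finset.range_subset_range.2 (by omega))
  have hGle : ∀ K, K ≤ G K := fun K => le_trans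
    (Function.id_le_iterate_of_id_le (f := fun k => 8 * k) (fun k => by simp only [id]; omega) _ K) (hG1 K)
  refine ⟨G^[⌈1 / ε ^ 2⌉₊] 1, ?_⟩
  intro V _ _ h hh
  obtain ⟨s, -, ⟨s', hss', hu, hd⟩, hsize⟩ := exists_good_of_energy (S := PairCol V) PairCol.size
    (fun s => 𝔼 ω, avg (triCol s.col) h ω ^ 2)
    (fun s => ∃ s' : PairCol V, s.Refines s' ∧
      Unif (Φ s.size) (fun ω => h ω - avg (triCol s'.col) h ω) ∧
      𝔼 ω, |avg (triCol s'.col) h ω - avg (triCol s.col) h ω| ≤ ε)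
    (fun _ _ => True) (fun _ => trivial) (fun _ _ _ _ _ => trivial) (γ := ε ^ 2) (by positivity)
    (fun s => energy_mem_Icc _ hh) G hGmono hGle (by
      intro s hs
      obtain ⟨s', h1, h2, h3⟩ := exists_refines_unif h hh (hΦ s.size) s
      refine ⟨s', trivial, h3.trans (hG1 _), ?_⟩
      by_contra hcon
      refine hs ⟨s', h1, h2, ?_⟩
      push Not at hcon
      rw [energy_increment _ _ h1.triCol] at hcon
      have h4 := abs_expect_sq_le fun ω => avg (triCol s'.col) h ω - avg (triCol s.col) h ω
      exact le_of_lt (lt_of_pow_lt_pow_left₀ 2 hε.le (by linarith)))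
    ⟨1, fun _ _ => 0, fun _ _ => by omega⟩
  refine ⟨s.size, hsize, fun x y => ⟨s.col x y, s.col_lt x y⟩,
    fun i j k => if hω : ∃ ω, triCol s.col ω = (i.1, j.1, k.1) then
      avg (triCol s.col) h hω.choose else 0, avg (triCol s'.col) h, ?_, fun ω => avg_mem_Icc _ hh ω,
    ?_, hu⟩
  · intro i j k
    dsimp only
    split_ifs
    · exact avg_mem_Icc _ hh _
    · simp
  · refine le_of_eq_of_le (Finset.expect_congr rfl fun ω _ => ?_) hd
    have hex : ∃ ω', triCol s.col ω' = (s.col ω.1 ω.2.1, s.col ω.1 ω.2.2, s.col ω.2.1 ω.2.2) :=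
      ⟨ω, rfl⟩
    dsimp only
    rw [dif_pos hex, avg_meas _ h _ ω hex.choose_spec]

section Szemeredi
set_option linter.unusedSectionVars false
variable {V : Type} [Fintype V] [Nonempty V]

/-- Indicator of the cell `a` of the partition `A`. -/
noncomputable def ind {T : Type} (A : V → T) (a : T) (x : V) : ℝ := if A x = a then 1 else 0

/-- Normalised size of the cell `a`. -/
noncomputable def mass {T : Type} (A : V → T) (a : T) : ℝ := 𝔼 x, ind A a x

lemma ind_mem_Icc {T : Type} (A : V → T) (a : T) (x : V) : ind A a x ∈ Set.Icc (0 : ℝ) 1 := by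
  unfold ind; split_ifs <;> simp

/-- Every colour is quasirandom between the cells `a` and `b`, with density `p a b`. -/
def PairReg {K : ℕ} {T : Type} (τ : ℝ) (c : V → V → Fin K) (A : V → T) (p : T → T → Fin K → ℝ)
    (a b : T) : Prop :=
  ∀ (α : Fin K) (g₁ g₂ : V → ℝ), (∀ x, g₁ x ∈ Set.Icc (0 : ℝ) 1) →
    (∀ x, g₂ x ∈ Set.Icc (0 : ℝ) 1) →
    |𝔼 x, 𝔼 y, ((if c x y = α then 1 else 0) - p a b α) * (ind A a x * g₁ x * (ind A b y * g₂ y))|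
      ≤ τ * (mass A a * mass A b)

/-- Density of colour `α` between cells `a` and `b`. -/
noncomputable def cellDensity {K : ℕ} {T : Type} (c : V → V → Fin K) (A : V → T) (a b : T)
    (α : Fin K) : ℝ :=
  𝔼 x ∈ Finset.univ.filter (fun x => A x = a), 𝔼 y ∈ Finset.univ.filter (fun y => A y = b),
    if c x y = α then 1 else 0

lemma cellDensity_nonneg {K : ℕ} {T : Type} (c : V → V → Fin K) (A : V → T) (a b : T)
    (α : Fin K) : 0 ≤ cellDensity c A a b α :=
  Finset.expect_nonneg fun _ _ => Finset.expect_nonneg fun _ _ => by split_ifs <;> simp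

lemma expect_le_one {α : Type} (s : Finset α) (f : α → ℝ) (hf : ∀ a ∈ s, f a ≤ 1) :
    𝔼 a ∈ s, f a ≤ 1 := by
  rcases s.eq_empty_or_nonempty with rfl | hs
  · simp
  · exact Finset.expect_le hs hf

lemma sum_cellDensity_le {K : ℕ} {T : Type} (c : V → V → Fin K) (A : V → T) (a b : T) :
    ∑ α, cellDensity c A a b α ≤ 1 := by
  unfold cellDensity
  rw [← Finset.expect_sum_comm]
  refine expect_le_one _ _ fun x _ => ?_
  rw [← Finset.expect_sum_comm]
  refine expect_le_one _ _ fun y _ => ?_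
  simp

/-- The partition of `V × V × Fin K` induced by a vertex partition. -/
def cellCol {K : ℕ} {T : Type} (A : V → T) (ω : V × V × Fin K) : T × T × Fin K :=
  (A ω.1, A ω.2.1, ω.2.2)

lemma avg_cellCol {K : ℕ} {T : Type} (c : V → V → Fin K) (A : V → T) (ω : V × V × Fin K) :
    avg (cellCol A) (fun ω => if c ω.1 ω.2.1 = ω.2.2 then 1 else 0) ω
      = cellDensity c A (A ω.1) (A ω.2.1) ω.2.2 := by
  unfold avg cellDensity
  have : ∀ inst : DecidablePred fun ω' : V × V × Fin K => cellCol A ω' = cellCol A ω,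
      @Finset.filter _ (fun ω' : V × V × Fin K => cellCol A ω' = cellCol A ω) inst Finset.univ
      = Finset.univ.filter (fun x => A x = A ω.1) ×ˢ
        (Finset.univ.filter (fun y => A y = A ω.2.1) ×ˢ {ω.2.2}) := by
    intro inst
    ext ⟨x, y, α⟩
    simp only [cellCol, Finset.mem_filter, Finset.mem_univ, true_and, Prod.mk.injEq,
      Finset.mem_product, Finset.mem_singleton]
  rw [this, Finset.expect_product]
  refine Finset.expect_congr rfl fun x _ => ?_
  rw [Finset.expect_product]
  refine Finset.expect_congr rfl fun y _ => ?_
  simp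

lemma exists_witness {K : ℕ} {T : Type} {τ : ℝ} (c : V → V → Fin K) (hK : Nonempty (Fin K))
    (A : V → T) (p : T → T → Fin K → ℝ) (a b : T) :
    ∃ (α : Fin K) (s₁ s₂ : V → ℝ) (σ : ℝ), (∀ x, s₁ x = 0 ∨ s₁ x = 1) ∧ (∀ x, s₂ x = 0 ∨ s₂ x = 1) ∧
      |σ| ≤ 1 ∧ (if PairReg τ c A p a b then 0 else 1) * (τ * (mass A a * mass A b)) ≤
        σ * 𝔼 x, 𝔼 y, ((if c x y = α then 1 else 0) - p a b α) *
          (ind A a x * s₁ x * (ind A b y * s₂ y)) := by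
  by_cases h : PairReg τ c A p a b
  · obtain ⟨α⟩ := hK
    exact ⟨α, fun _ => 0, fun _ => 0, 0, by simp, by simp, by simp, by simp [h]⟩
  rw [if_neg h]
  unfold PairReg at h
  push Not at h
  obtain ⟨α, g₁, g₂, h1, h2, h3⟩ := h
  obtain ⟨s₁, hs₁, h4⟩ := exists_zero_one (fun x => 𝔼 y, ((if c x y = α then 1 else 0) - p a b α) *
          (ind A a x * (ind A b y * g₂ y))) g₁ h1
  obtain ⟨s₂, hs₂, h5⟩ := exists_zero_one (fun y => 𝔼 x, ((if c x y = α then 1 else 0) - p a b α) *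
          (ind A a x * s₁ x * ind A b y)) g₂ h2
  have h6 : τ * (mass A a * mass A b) ≤ |𝔼 x, 𝔼 y, ((if c x y = α then 1 else 0) - p a b α) *
          (ind A a x * s₁ x * (ind A b y * s₂ y))| := by
    refine h3.le.trans ?_
    calc _ = |𝔼 x, (𝔼 y, ((if c x y = α then 1 else 0) - p a b α) *
          (ind A a x * (ind A b y * g₂ y))) * g₁ x| := by
          congr 1
          refine Finset.expect_congr rfl fun x _ => ?_
          rw [Finset.expect_mul]
          exact Finset.expect_congr rfl fun y _ => by ring
      _ ≤ _ := h4
      _ = |𝔼 y, (𝔼 x, ((if c x y = α then 1 else 0) - p a b α) *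
          (ind A a x * s₁ x * ind A b y)) * g₂ y| := by
          congr 1
          simp only [Finset.expect_mul]
          rw [Finset.expect_comm]
          exact Finset.expect_congr rfl fun x _ => Finset.expect_congr rfl fun y _ => by ring
      _ ≤ _ := h5
      _ = _ := by
          congr 1
          simp only [Finset.expect_mul]
          rw [Finset.expect_comm]
          exact Finset.expect_congr rfl fun x _ => Finset.expect_congr rfl fun y _ => by ring
  refine ⟨α, s₁, s₂, SignType.sign (𝔼 x, 𝔼 y, ((if c x y = α then 1 else 0) - p a b α) *
          (ind A a x * s₁ x * (ind A b y * s₂ y))), hs₁, hs₂, ?_, ?_⟩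
  · rcases lt_trichotomy (𝔼 x, 𝔼 y, ((if c x y = α then (1 : ℝ) else 0) - p a b α) *
          (ind A a x * s₁ x * (ind A b y * s₂ y))) 0 with h | h | h
    · rw [sign_neg h]; simp
    · rw [h]; simp
    · rw [sign_pos h]; simp
  · rw [sign_mul_self, one_mul]
    exact h6

lemma sum_ind {t : ℕ} (A : V → Fin t) (G : Fin t → ℝ) (x : V) : ∑ a, ind A a x * G a = G (A x) := by
  simp [ind]

lemma sum_mass_mul {t : ℕ} (A : V → Fin t) (G : Fin t → ℝ) :
    ∑ a, mass A a * G a = 𝔼 x, G (A x) := by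
  unfold mass
  simp only [Finset.expect_mul]
  rw [← Finset.expect_sum_comm]
  simp only [sum_ind]

end Szemeredi

/-- Regular partitions for colourings of pairs. -/
lemma szemeredi_partition {τ : ℝ} (hτ : 0 < τ) (K : ℕ) :
    ∃ T : ℕ, ∀ (V : Type) [Fintype V] [Nonempty V] (c : V → V → Fin K),
      ∃ t ≤ T, ∃ (A : V → Fin t) (p : Fin t → Fin t → Fin K → ℝ), (∀ a b α, 0 ≤ p a b α) ∧
        (∀ a b, ∑ α, p a b α ≤ 1) ∧
        𝔼 x, 𝔼 y, (if PairReg τ c A p (A x) (A y) then (0 : ℝ) else 1) ≤ τ := by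
  set g : ℕ → ℕ := fun t => t * (2 ^ t * 2 ^ t) with hg
  refine ⟨g^[⌈1 / (τ ^ 2 / K) ^ 2⌉₊] 1, ?_⟩
  intro V _ _ c
  have hK : Nonempty (Fin K) := ⟨c (Classical.arbitrary V) (Classical.arbitrary V)⟩
  have hKpos : 0 < K := Fin.pos_iff_nonempty.2 hK
  have hKpos' : (0 : ℝ) < K := by exact_mod_cast hKpos
  set f : V × V × Fin K → ℝ := fun ω => if c ω.1 ω.2.1 = ω.2.2 then 1 else 0 with hf
  have hf01 : ∀ ω, f ω ∈ Set.Icc (0 : ℝ) 1 := fun ω => by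
    simp only [hf]; split_ifs <;> simp
  obtain ⟨⟨t, A⟩, -, hgood, hsize⟩ := exists_good_of_energy (S := Σ t : ℕ, (V → Fin t)) (fun s => s.1)
    (fun s => 𝔼 ω, avg (cellCol s.2) f ω ^ 2)
    (fun s => 𝔼 x, 𝔼 y, (if PairReg τ c s.2 (cellDensity c s.2) (s.2 x) (s.2 y)
      then (0 : ℝ) else 1) ≤ τ)
    (fun _ _ => True) (fun _ => trivial) (fun _ _ _ _ _ => trivial)
    (γ := (τ ^ 2 / K) ^ 2) (by positivity)
    (fun s => energy_mem_Icc _ hf01) g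
    (fun a b hab => Nat.mul_le_mul hab (Nat.mul_le_mul (Nat.pow_le_pow_right (by norm_num) hab)
      (Nat.pow_le_pow_right (by norm_num) hab)))
    (fun k => Nat.le_mul_of_pos_right _ (by positivity)) (by
      rintro ⟨t, A⟩ hs
      simp only at hs
      push Not at hs
      choose α s₁ s₂ σ h1 h2 h3 h4 using exists_witness c hK A (cellDensity c A)
      let A₀ : V → Fin t × (Fin t → Bool) × (Fin t → Bool) := fun x =>
        (A x, fun b => decide (s₁ (A x) b x = 1), fun a => decide (s₂ a (A x) x = 1))
      let e := Fintype.equivFin (Fin t × (Fin t → Bool) × (Fin t → Bool))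
      refine ⟨⟨_, fun x => e (A₀ x)⟩, trivial, ?_, ?_⟩
      · simp [hg]
      have hA₀ : ∀ x x', e (A₀ x) = e (A₀ x') → A x = A x' ∧ (∀ b, s₁ (A x) b x = s₁ (A x) b x') ∧
          ∀ a, s₂ a (A x) x = s₂ a (A x) x' := by
        intro x x' h
        have h := e.injective h
        simp only [A₀, Prod.mk.injEq] at h
        refine ⟨h.1, fun b => ?_, fun a => ?_⟩
        · have h5 := congrFun h.2.1 b
          rw [← h.1, decide_eq_decide] at h5
          rcases h1 (A x) b x with h6 | h6 <;> rcases h1 (A x) b x' with h7 | h7 <;> simp_all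
        · have h5 := congrFun h.2.2 a
          rw [← h.1, decide_eq_decide] at h5
          rcases h2 a (A x) x with h6 | h6 <;> rcases h2 a (A x) x' with h7 | h7 <;> simp_all
      refine energy_gain (cellCol A) (cellCol fun x => e (A₀ x)) ?_ f
        (fun ω => σ (A ω.1) (A ω.2.1) * ((if ω.2.2 = α (A ω.1) (A ω.2.1) then 1 else 0) *
          (s₁ (A ω.1) (A ω.2.1) ω.1 * s₂ (A ω.1) (A ω.2.1) ω.2.1))) ?_ ?_ (by positivity) ?_
      · intro ω ω' h
        simp only [cellCol, Prod.mk.injEq] at h ⊢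
        exact ⟨(hA₀ _ _ h.1).1, (hA₀ _ _ h.2.1).1, h.2.2⟩
      · intro ω ω' h
        simp only [cellCol, Prod.mk.injEq] at h
        obtain ⟨h5, h6, h7⟩ := h
        have h5 := hA₀ _ _ h5
        have h6 := hA₀ _ _ h6
        dsimp only
        rw [h5.2.1, h6.2.2, h5.1, h6.1, h7]
      · intro ω
        have h5 := h3 (A ω.1) (A ω.2.1)
        rcases h1 (A ω.1) (A ω.2.1) ω.1 with h6 | h6 <;>
          rcases h2 (A ω.1) (A ω.2.1) ω.2.1 with h7 | h7 <;> simp only [h6, h7] <;> split_ifs <;>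
          simp [h5]
      · refine le_trans ?_ (le_abs_self _)
        have e1 : 𝔼 ω, (f ω - avg (cellCol A) f ω) *
            (σ (A ω.1) (A ω.2.1) * ((if ω.2.2 = α (A ω.1) (A ω.2.1) then 1 else 0) *
            (s₁ (A ω.1) (A ω.2.1) ω.1 * s₂ (A ω.1) (A ω.2.1) ω.2.1)))
            = 𝔼 x, 𝔼 y, (1 / (K : ℝ)) * (σ (A x) (A y) *
              (((if c x y = α (A x) (A y) then 1 else 0) - cellDensity c A (A x) (A y) (α (A x) (A y)))
                * (s₁ (A x) (A y) x * s₂ (A x) (A y) y))) := by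
          rw [expect_pair]
          refine Finset.expect_congr rfl fun x _ => ?_
          rw [expect_pair]
          refine Finset.expect_congr rfl fun y _ => ?_
          rw [Finset.expect_eq_sum_div_card, Finset.sum_eq_single (α (A x) (A y))]
          · rw [hf, avg_cellCol]
            simp
            ring
          · intro b _ hb
            simp [hb]
          · simp
        have e2 : 𝔼 x, 𝔼 y, (1 / (K : ℝ)) * (σ (A x) (A y) *
              (((if c x y = α (A x) (A y) then 1 else 0) - cellDensity c A (A x) (A y) (α (A x) (A y)))
                * (s₁ (A x) (A y) x * s₂ (A x) (A y) y)))
            = (1 / (K : ℝ)) * ∑ a, ∑ b, σ a b * 𝔼 x, 𝔼 y, ((if c x y = α a b then 1 else 0)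
              - cellDensity c A a b (α a b)) * (ind A a x * s₁ a b x * (ind A b y * s₂ a b y)) := by
          simp only [← Finset.mul_expect]
          congr 1
          simp only [Finset.mul_expect]
          simp only [← Finset.expect_sum_comm]
          refine Finset.expect_congr rfl fun x _ => Finset.expect_congr rfl fun y _ => ?_
          rw [← sum_ind A (fun a => σ a (A y) *
              (((if c x y = α a (A y) then 1 else 0) - cellDensity c A a (A y) (α a (A y)))
                * (s₁ a (A y) x * s₂ a (A y) y))) x]
          refine Finset.sum_congr rfl fun a _ => ?_
          rw [← sum_ind A (fun b => σ a b *
              (((if c x y = α a b then 1 else 0) - cellDensity c A a b (α a b))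
                * (s₁ a b x * s₂ a b y))) y, Finset.mul_sum]
          exact Finset.sum_congr rfl fun b _ => by ring
        rw [e1, e2]
        have e3 : τ * 𝔼 x, 𝔼 y, (if PairReg τ c A (cellDensity c A) (A x) (A y) then (0 : ℝ) else 1)
            = ∑ a, ∑ b, (if PairReg τ c A (cellDensity c A) a b then 0 else 1) *
              (τ * (mass A a * mass A b)) := by
          rw [Finset.mul_expect]
          rw [← sum_mass_mul A (fun a => τ * 𝔼 y,
            (if PairReg τ c A (cellDensity c A) a (A y) then (0 : ℝ) else 1))]
          refine Finset.sum_congr rfl fun a _ => ?_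
          rw [← sum_mass_mul A (fun b =>
            (if PairReg τ c A (cellDensity c A) a b then (0 : ℝ) else 1)), Finset.mul_sum,
            Finset.mul_sum]
          exact Finset.sum_congr rfl fun b _ => by ring
        have e4 := Finset.sum_le_sum fun a (_ : a ∈ Finset.univ) =>
          Finset.sum_le_sum fun b (_ : b ∈ Finset.univ) => h4 a b
        rw [← e3] at e4
        rw [div_eq_inv_mul, ← one_div]
        refine mul_le_mul_of_nonneg_left (le_trans ?_ e4) (by positivity)
        rw [sq]
        exact mul_le_mul_of_nonneg_left hs.le hτ.le)
    ⟨1, fun _ => 0⟩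
  exact ⟨t, hsize, A, cellDensity c A, cellDensity_nonneg c A, sum_cellDensity_le c A, hgood⟩

section Ramsey

/-- Hypergraph Ramsey theorem for two colours. -/
lemma ramsey (r m : ℕ) : ∃ N : ℕ, ∀ (S : Finset ℕ), N ≤ S.card → ∀ P : Finset ℕ → Prop,
    ∃ T ⊆ S, T.card = m ∧
      ((∀ e ⊆ T, e.card = r → P e) ∨ (∀ e ⊆ T, e.card = r → ¬ P e)) := by
  induction r generalizing m with
  | zero =>
    refine ⟨m, fun S hS P => ?_⟩
    obtain ⟨T, hT, hc⟩ := Finset.exists_subset_card_eq hS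
    refine ⟨T, hT, hc, ?_⟩
    by_cases h : P ∅
    · exact Or.inl fun e _ he => by rwa [Finset.card_eq_zero.1 he]
    · exact Or.inr fun e _ he => by rwa [Finset.card_eq_zero.1 he]
  | succ r ih =>
    have key : ∀ L : ℕ, ∃ N : ℕ, ∀ (S : Finset ℕ), N ≤ S.card → ∀ P : Finset ℕ → Prop,
        ∃ U ⊆ S, U.card = L ∧ ∃ χ : ℕ → Prop, ∀ x ∈ U, ∀ e ⊆ U, e.card = r → (∀ y ∈ e, x < y) →
          (P (insert x e) ↔ χ x) := by
      intro L
      induction L with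
      | zero => exact ⟨0, fun S _ P => ⟨∅, by simp, by simp, fun _ => True, by simp⟩⟩
      | succ L ihL =>
        obtain ⟨N, hN⟩ := ihL
        obtain ⟨N', hN'⟩ := ih N
        refine ⟨N' + 1, fun S hS P => ?_⟩
        have hne : S.Nonempty := Finset.card_pos.1 (by omega)
        set x := S.min' hne with hx
        have hxS : x ∈ S := Finset.min'_mem _ _
        have hc : (S.erase x).card = S.card - 1 := Finset.card_erase_of_mem hxS
        obtain ⟨T, hTS, hTc, hT⟩ := hN' (S.erase x) (by omega) (fun e => P (insert x e))
        obtain ⟨U, hUT, hUc, χ, hχ⟩ := hN T hTc.ge P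
        have hlt : ∀ y ∈ U, x < y := fun y hy => by
          have h1 := hTS (hUT hy)
          exact lt_of_le_of_ne (Finset.min'_le _ _ (Finset.mem_of_mem_erase h1))
            (Finset.ne_of_mem_erase h1).symm
        have hxU : x ∉ U := fun h => lt_irrefl _ (hlt x h)
        have hsub : ∀ e ⊆ insert x U, ∀ z ∈ insert x U, (∀ y ∈ e, z < y) → e ⊆ U := by
          intro e he z hz hlt' y hy
          rcases Finset.mem_insert.1 (he hy) with h | h
          · have h2 := hlt' y hy
            rcases Finset.mem_insert.1 hz with h3 | h3
            · omega
            · have := hlt z h3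
              omega
          · exact h
        refine ⟨insert x U, ?_, by rw [Finset.card_insert_of_notMem hxU, hUc],
          fun z => if z = x then (∀ e ⊆ T, e.card = r → P (insert x e)) else χ z, ?_⟩
        · exact Finset.insert_subset hxS (hUT.trans (hTS.trans (Finset.erase_subset _ _)))
        · intro z hz e he hec hlt'
          have heU := hsub e he z hz hlt'
          by_cases hzx : z = x
          · subst hzx
            simp only [if_true]
            refine ⟨fun h => ?_, fun h => h e (heU.trans hUT) hec⟩
            rcases hT with hT | hT
            · exact hT
            · exact absurd h (hT e (heU.trans hUT) hec)
          · simp only [if_neg hzx]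
            exact hχ z ((Finset.mem_insert.1 hz).resolve_left hzx) e heU hec hlt'
    obtain ⟨N, hN⟩ := key (2 * m)
    refine ⟨N, fun S hS P => ?_⟩
    obtain ⟨U, hUS, hUc, χ, hχ⟩ := hN S hS P
    have hcard := Finset.card_filter_add_card_filter_not (s := U) χ
    have main : ∀ T ⊆ U, ∀ e ⊆ T, e.card = r + 1 → ∃ x ∈ T, (P e ↔ χ x) := by
      intro T hTU e he hec
      have hne : e.Nonempty := Finset.card_pos.1 (by omega)
      have hmem := Finset.min'_mem e hne
      refine ⟨e.min' hne, he hmem, ?_⟩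
      have h1 := hχ (e.min' hne) (hTU (he hmem)) (e.erase (e.min' hne))
        ((Finset.erase_subset _ _).trans (he.trans hTU))
        (by rw [Finset.card_erase_of_mem hmem, hec]; rfl)
        (fun y hy => lt_of_le_of_ne (Finset.min'_le _ _ (Finset.mem_of_mem_erase hy))
            (Finset.ne_of_mem_erase hy).symm)
      rwa [Finset.insert_erase hmem] at h1
    rcases (by omega : m ≤ (U.filter χ).card ∨ m ≤ (U.filter fun x => ¬ χ x).card) with h | h
    · obtain ⟨T, hT, hc⟩ := Finset.exists_subset_card_eq h
      have hTU := hT.trans (Finset.filter_subset _ _)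
      refine ⟨T, hTU.trans hUS, hc, Or.inl fun e he hec => ?_⟩
      obtain ⟨x, hx, hiff⟩ := main T hTU e he hec
      exact hiff.2 (Finset.mem_filter.1 (hT hx)).2
    · obtain ⟨T, hT, hc⟩ := Finset.exists_subset_card_eq h
      have hTU := hT.trans (Finset.filter_subset _ _)
      refine ⟨T, hTU.trans hUS, hc, Or.inr fun e he hec => ?_⟩
      obtain ⟨x, hx, hiff⟩ := main T hTU e he hec
      exact fun hP => (Finset.mem_filter.1 (hT hx)).2 (hiff.1 hP)

lemma exists_enum (T : Finset ℕ) : ∃ t : ℕ → ℕ, (∀ a b, a < b → b < T.card → t a < t b) ∧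
    (∀ a < T.card, t a ∈ T) ∧ ∀ j ∈ T, ∃ a < T.card, t a = j := by
  refine ⟨fun a => if h : a < T.card then T.orderEmbOfFin rfl ⟨a, h⟩ else 0, ?_, ?_, ?_⟩
  · intro a b hab hb
    simp only [dif_pos hb, dif_pos (hab.trans hb)]
    exact (T.orderEmbOfFin rfl).strictMono hab
  · intro a ha
    simp only [dif_pos ha]
    exact Finset.orderEmbOfFin_mem _ _ _
  · intro j hj
    have : j ∈ Set.range (T.orderEmbOfFin rfl) := by
      rw [Finset.range_orderEmbOfFin]; exact hj
    obtain ⟨⟨a, ha⟩, h⟩ := this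
    exact ⟨a, ha, by simp only [dif_pos ha]; exact h⟩

/-- The position of a third index relative to a pair `i < k`: above, between, or below. -/
def IsZone (Z : ℕ → ℕ → ℕ → Prop) : Prop :=
  (∀ i k j, Z i k j ↔ k < j) ∨ (∀ i k j, Z i k j ↔ i < j ∧ j < k) ∨ (∀ i k j, Z i k j ↔ j < i)

lemma IsZone.ne {Z : ℕ → ℕ → ℕ → Prop} (hZ : IsZone Z) {i k j : ℕ} (hik : i < k) (h : Z i k j) :
    j ≠ i ∧ j ≠ k := by
  rcases hZ with hZ | hZ | hZ <;> rw [hZ] at h <;> omega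

lemma IsZone.unique {Z : ℕ → ℕ → ℕ → Prop} (hZ : IsZone Z) {i k i' k' : ℕ} (h : i < k)
    (h' : i' < k') (h1 : i' ≠ i → i' ≠ k → Z i k i') (h2 : k' ≠ i → k' ≠ k → Z i k k')
    (h3 : i ≠ i' → i ≠ k' → Z i' k' i) (h4 : k ≠ i' → k ≠ k' → Z i' k' k) : i = i' ∧ k = k' := by
  rcases hZ with hZ | hZ | hZ <;> simp only [hZ] at h1 h2 h3 h4 <;> omega

lemma IsZone.exists_extremal {Z : ℕ → ℕ → ℕ → Prop} (hZ : IsZone Z) {T : Finset ℕ}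
    (hT : 2 ≤ T.card) : ∃ i ∈ T, ∃ k ∈ T, i < k ∧ ∀ j ∈ T, j ≠ i → j ≠ k → Z i k j := by
  obtain ⟨t, ht, htT, hTt⟩ := exists_enum T
  have hinj : ∀ a b, a < T.card → b < T.card → a ≠ b → t a ≠ t b := by
    intro a b ha hb hab
    rcases lt_or_gt_of_ne hab with h | h
    · exact (ht a b h hb).ne
    · exact (ht b a h ha).ne'
  rcases hZ with hZ | hZ | hZ
  · refine ⟨t 0, htT _ (by omega), t 1, htT _ (by omega), ht _ _ (by omega) (by omega), ?_⟩
    intro j hj hj0 hj1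
    obtain ⟨a, ha, rfl⟩ := hTt j hj
    rw [hZ]
    refine ht _ _ ?_ ha
    rcases a with _ | _ | a
    · exact absurd rfl hj0
    · exact absurd rfl hj1
    · omega
  · refine ⟨t 0, htT _ (by omega), t (T.card - 1), htT _ (by omega), ht _ _ (by omega) (by omega), ?_⟩
    intro j hj hj0 hj1
    obtain ⟨a, ha, rfl⟩ := hTt j hj
    rw [hZ]
    have h0 : a ≠ 0 := fun h => hj0 (by rw [h])
    have h1 : a ≠ T.card - 1 := fun h => hj1 (by rw [h])
    exact ⟨ht _ _ (by omega) (by omega), ht _ _ (by omega) (by omega)⟩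
  · refine ⟨t (T.card - 2), htT _ (by omega), t (T.card - 1), htT _ (by omega),
      ht _ _ (by omega) (by omega), ?_⟩
    intro j hj hj0 hj1
    obtain ⟨a, ha, rfl⟩ := hTt j hj
    rw [hZ]
    have h0 : a ≠ T.card - 2 := fun h => hj0 (by rw [h])
    have h1 : a ≠ T.card - 1 := fun h => hj1 (by rw [h])
    exact ht _ _ (by omega) (by omega)

lemma IsZone.exists_spaced {Z : ℕ → ℕ → ℕ → Prop} (hZ : IsZone Z) {m : ℕ} {T : Finset ℕ}
    (hT : (m + 1) * (m + 1) ≤ T.card) : ∃ I ⊆ T, I.card = m ∧ ∀ i ∈ I, ∀ k ∈ I, i < k →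
      m ≤ (T.filter fun j => Z i k j).card := by
  obtain ⟨t, ht, htT, hTt⟩ := exists_enum T
  have hle : ∀ a b, a ≤ b → b < T.card → t a ≤ t b := by
    intro a b hab hb
    rcases hab.eq_or_lt with h | h
    · rw [h]
    · exact (ht a b h hb).le
  have hidx : ∀ a < m, (m + 1) * a + m + m + 1 < T.card := by
    intro a ha
    have : (m + 1) * (a + 1) ≤ (m + 1) * m := Nat.mul_le_mul_left _ ha
    nlinarith
  have hbase : ∀ (Q : ℕ → Prop) (b : ℕ), b + m ≤ T.card → (∀ x < m, Q (t (b + x))) →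
      m ≤ (T.filter Q).card := by
    intro Q b hb hQ
    calc m = ((Finset.range m).image fun x => t (b + x)).card := by
          rw [Finset.card_image_of_injOn, Finset.card_range]
          intro x hx y hy hxy
          simp only [Finset.coe_range, Set.mem_Iio] at hx hy
          by_contra hne
          rcases lt_or_gt_of_ne hne with h | h
          · exact (ht (b + x) (b + y) (by omega) (by omega)).ne hxy
          · exact (ht (b + y) (b + x) (by omega) (by omega)).ne' hxy
      _ ≤ _ := by
          refine Finset.card_le_card fun j hj => ?_
          obtain ⟨x, hx, rfl⟩ := Finset.mem_image.1 hj
          have hx := Finset.mem_range.1 hx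
          exact Finset.mem_filter.2 ⟨htT _ (by omega), hQ x hx⟩
  refine ⟨(Finset.range m).image fun a => t ((m + 1) * a + m), ?_, ?_, ?_⟩
  · intro j hj
    obtain ⟨a, ha, rfl⟩ := Finset.mem_image.1 hj
    have := hidx a (Finset.mem_range.1 ha)
    exact htT _ (by omega)
  · rw [Finset.card_image_of_injOn, Finset.card_range]
    intro a ha b hb hab
    simp only [Finset.coe_range, Set.mem_Iio] at ha hb
    have h1 := hidx a ha
    have h2 := hidx b hb
    by_contra hne
    rcases lt_or_gt_of_ne hne with h | h
    · have : (m + 1) * a < (m + 1) * b := Nat.mul_lt_mul_of_pos_left h (Nat.succ_pos m)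
      exact (ht ((m + 1) * a + m) ((m + 1) * b + m) (by omega) (by omega)).ne hab
    · have : (m + 1) * b < (m + 1) * a := Nat.mul_lt_mul_of_pos_left h (Nat.succ_pos m)
      exact (ht ((m + 1) * b + m) ((m + 1) * a + m) (by omega) (by omega)).ne' hab
  · intro i hi k hk hik
    obtain ⟨a, ha, rfl⟩ := Finset.mem_image.1 hi
    obtain ⟨b, hb, rfl⟩ := Finset.mem_image.1 hk
    have h1 := hidx a (Finset.mem_range.1 ha)
    have h2 := hidx b (Finset.mem_range.1 hb)
    have hab : a < b := by
      by_contra hcon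
      have := Nat.mul_le_mul_left (m + 1) (not_lt.1 hcon)
      exact absurd (hle ((m + 1) * b + m) ((m + 1) * a + m) (by omega) (by omega)) (by omega)
    have h3 : (m + 1) * a + m + 1 ≤ (m + 1) * b := by
      have := Nat.mul_le_mul_left (m + 1) hab
      rw [Nat.succ_eq_add_one, mul_add] at this
      omega
    rcases hZ with hZ | hZ | hZ
    · refine hbase _ ((m + 1) * b + m + 1) (by omega) fun x hx => ?_
      rw [hZ]
      exact ht _ _ (by omega) (by omega)
    · refine hbase _ ((m + 1) * a + m + 1) (by omega) fun x hx => ?_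
      rw [hZ]
      exact ⟨ht _ _ (by omega) (by omega), ht _ _ (by omega) (by omega)⟩
    · refine hbase _ 0 (by omega) fun x hx => ?_
      rw [hZ]
      exact ht _ _ (by omega) (by omega)

end Ramsey

section Roles

lemma exists_role {κ : Type} [Fintype κ] {m : ℕ} {θ : ℝ} {J : Finset ℕ} {w : κ → ℝ}
    (hw : ∀ β, 0 ≤ w β) (hw1 : ∑ β, w β ≤ 1) {G : ℕ → κ → Prop} (hJ : (m : ℝ) < θ * J.card)
    (hG : ∀ j ∈ J, θ ≤ ∑ β, if G j β then w β else 0) :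
    ∃ β, m ≤ (J.filter fun j => G j β).card := by
  by_contra hcon
  push Not at hcon
  have h1 : θ * J.card ≤ ∑ j ∈ J, ∑ β, if G j β then w β else 0 := by
    calc θ * J.card = ∑ j ∈ J, θ := by rw [Finset.sum_const, nsmul_eq_mul, mul_comm]
      _ ≤ _ := Finset.sum_le_sum hG
  rw [Finset.sum_comm] at h1
  have h2 : ∑ β, ∑ j ∈ J, (if G j β then w β else 0) ≤ ∑ β, (m : ℝ) * w β := by
    refine Finset.sum_le_sum fun β _ => ?_
    rw [← Finset.sum_filter, Finset.sum_const, nsmul_eq_mul]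
    exact mul_le_mul_of_nonneg_right (by exact_mod_cast (hcon β).le) (hw β)
  rw [← Finset.mul_sum] at h2
  have h3 : (m : ℝ) * ∑ β, w β ≤ m * 1 := mul_le_mul_of_nonneg_left hw1 (Nat.cast_nonneg m)
  linarith

/-- If each pair `i < k` carries a subprobability weight on colours and each third index in the
zone of the pair accepts a positive proportion of the colours, then on a large index set one
colour per pair can be chosen that is accepted by all third indices. -/
lemma role {Z : ℕ → ℕ → ℕ → Prop} (hZ : IsZone Z) (m : ℕ) {θ : ℝ} (hθ : 0 < θ) :
    ∃ L : ℕ, ∀ (κ : Type) [Fintype κ] [Nonempty κ] (T : Finset ℕ), L ≤ T.card →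
      ∀ (w : ℕ → ℕ → κ → ℝ), (∀ i k β, 0 ≤ w i k β) → (∀ i k, ∑ β, w i k β ≤ 1) →
      ∀ G : ℕ → ℕ → ℕ → κ → Prop,
      (∀ i ∈ T, ∀ k ∈ T, i < k → ∀ j ∈ T, Z i k j → θ ≤ ∑ β, if G i k j β then w i k β else 0) →
      ∃ I ⊆ T, I.card = m ∧ ∃ B : ℕ → ℕ → κ,
        ∀ i ∈ I, ∀ k ∈ I, i < k → ∀ j ∈ I, Z i k j → G i k j (B i k) := by
  obtain ⟨R₀, hR₀⟩ := exists_nat_gt ((m : ℝ) / θ)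
  set R := max (R₀ + 2) ((m + 1) * (m + 1)) with hR
  obtain ⟨L, hL⟩ := ramsey (m + 2) R
  refine ⟨L, fun κ _ _ T hT w hw hw1 G hG => ?_⟩
  obtain ⟨T', hT', hc, hP⟩ := hL T hT (fun Q => ∃ i ∈ Q, ∃ k ∈ Q, i < k ∧
    (∀ j ∈ Q, j ≠ i → j ≠ k → Z i k j) ∧ ∃ β, ∀ j ∈ Q, j ≠ i → j ≠ k → G i k j β)
  have hR2 : R₀ + 2 ≤ T'.card := hc ▸ le_max_left _ _
  rcases hP with hP | hP
  · obtain ⟨I, hI, hIc, hsp⟩ := hZ.exists_spaced (T := T') (m := m) (hc ▸ le_max_right _ _)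
    have key : ∀ i k, ∃ β, i ∈ I → k ∈ I → i < k → ∀ j ∈ I, Z i k j → G i k j β := by
      intro i k
      by_cases h : i ∈ I ∧ k ∈ I ∧ i < k
      swap
      · exact ⟨Classical.arbitrary κ, fun h1 h2 h3 => absurd ⟨h1, h2, h3⟩ h⟩
      obtain ⟨hi, hk, hik⟩ := h
      obtain ⟨J, hJ1, hJ2, hJc⟩ := Finset.exists_subsuperset_card_eq
        (s := I.filter fun j => Z i k j) (t := T'.filter fun j => Z i k j) (n := m)
        (Finset.filter_subset_filter _ hI)
        ((Finset.card_le_card (Finset.filter_subset _ _)).trans hIc.le) (hsp i hi k hk hik)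
      have hJZ : ∀ j ∈ J, Z i k j := fun j hj => (Finset.mem_filter.1 (hJ2 hj)).2
      have hkJ : k ∉ J := fun h => (hZ.ne hik (hJZ k h)).2 rfl
      have hiJ : i ∉ insert k J := by
        intro h
        rcases Finset.mem_insert.1 h with h | h
        · omega
        · exact (hZ.ne hik (hJZ i h)).1 rfl
      have hQZ : ∀ j ∈ insert i (insert k J), j ≠ i → j ≠ k → Z i k j := by
        intro j hj h1 h2
        rcases Finset.mem_insert.1 hj with h | h
        · exact absurd h h1
        rcases Finset.mem_insert.1 h with h | h
        · exact absurd h h2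
        · exact hJZ j h
      obtain ⟨i', hi', k', hk', hik', hz, β, hβ⟩ := hP (insert i (insert k J)) (by
          refine Finset.insert_subset (hI hi) (Finset.insert_subset (hI hk) fun j hj => ?_)
          exact (Finset.mem_filter.1 (hJ2 hj)).1)
        (by rw [Finset.card_insert_of_notMem hiJ, Finset.card_insert_of_notMem hkJ, hJc])
      obtain ⟨rfl, rfl⟩ := hZ.unique hik hik' (hQZ i' hi') (hQZ k' hk')
        (hz i (by simp)) (hz k (by simp))
      refine ⟨β, fun _ _ _ j hj hjZ => ?_⟩
      have hn := hZ.ne hik hjZ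
      exact hβ j (Finset.mem_insert_of_mem (Finset.mem_insert_of_mem
        (hJ1 (Finset.mem_filter.2 ⟨hj, hjZ⟩)))) hn.1 hn.2
    choose B hB using key
    exact ⟨I, hI.trans hT', hIc, B, fun i hi k hk => hB i k hi hk⟩
  · exfalso
    obtain ⟨i, hi, k, hk, hik, hz⟩ := hZ.exists_extremal (T := T') (by omega)
    have hcard : ((T'.erase i).erase k).card = T'.card - 2 := by
      rw [Finset.card_erase_of_mem (Finset.mem_erase.2 ⟨by omega, hk⟩),
        Finset.card_erase_of_mem hi]
      omega
    have hmem : ∀ j ∈ (T'.erase i).erase k, j ∈ T' ∧ j ≠ i ∧ j ≠ k := by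
      intro j hj
      have h1 := Finset.mem_erase.1 hj
      have h2 := Finset.mem_erase.1 h1.2
      exact ⟨h2.2, h2.1, h1.1⟩
    obtain ⟨β, hβ⟩ := exists_role (J := (T'.erase i).erase k) (m := m) (θ := θ) (hw i k) (hw1 i k)
      (G := fun j β => G i k j β) (by
        rw [div_lt_iff₀ hθ] at hR₀
        have : (R₀ : ℝ) ≤ ((T'.erase i).erase k).card := by
          rw [hcard]
          exact_mod_cast (by omega : R₀ ≤ T'.card - 2)
        nlinarith) (fun j hj => by
        obtain ⟨h1, h2, h3⟩ := hmem j hj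
        exact hG i (hT' hi) k (hT' hk) hik j (hT' h1) (hz j h1 h2 h3))
    obtain ⟨J, hJ, hJc⟩ := Finset.exists_subset_card_eq hβ
    have hJ' : ∀ j ∈ J, (j ∈ T' ∧ j ≠ i ∧ j ≠ k) ∧ G i k j β := fun j hj =>
      ⟨hmem j (Finset.mem_filter.1 (hJ hj)).1, (Finset.mem_filter.1 (hJ hj)).2⟩
    have hkJ : k ∉ J := fun h => (hJ' k h).1.2.2 rfl
    have hiJ : i ∉ insert k J := by
      intro h
      rcases Finset.mem_insert.1 h with h | h
      · omega
      · exact (hJ' i h).1.2.1 rfl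
    refine hP (insert i (insert k J)) ?_ ?_ ⟨i, by simp, k, by simp, hik, ?_, β, ?_⟩
    · exact Finset.insert_subset hi (Finset.insert_subset hk fun j hj => (hJ' j hj).1.1)
    · rw [Finset.card_insert_of_notMem hiJ, Finset.card_insert_of_notMem hkJ, hJc]
    · intro j hj h1 h2
      refine hz j ?_ h1 h2
      rcases Finset.mem_insert.1 hj with h | h
      · exact absurd h h1
      rcases Finset.mem_insert.1 h with h | h
      · exact absurd h h2
      · exact (hJ' j h).1.1
    · intro j hj h1 h2
      rcases Finset.mem_insert.1 hj with h | h
      · exact absurd h h1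
      rcases Finset.mem_insert.1 h with h | h
      · exact absurd h h2
      · exact (hJ' j h).2

lemma le_sum_threshold {κ : Type} [Fintype κ] {w X : κ → ℝ} {s : ℝ} (hw : ∀ β, 0 ≤ w β)
    (hw1 : ∑ β, w β ≤ 1) (hX : ∀ β, X β ≤ 1) (hs : 0 ≤ s) (h : 2 * s ≤ ∑ β, w β * X β) :
    s ≤ ∑ β, if s ≤ X β then w β else 0 := by
  have h1 : ∑ β, w β * X β ≤ ∑ β, ((if s ≤ X β then w β else 0) + s * w β) := by
    refine Finset.sum_le_sum fun β _ => ?_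
    have h2 := hw β
    have h3 := hX β
    split_ifs with h4
    · nlinarith [mul_nonneg hs h2]
    · nlinarith
  rw [Finset.sum_add_distrib, ← Finset.mul_sum] at h1
  nlinarith

/-- Choosing one colour for each pair in each of the three possible positions. -/
lemma reduced (m : ℕ) {d : ℝ} (hd : 0 < d) :
    ∃ L : ℕ, ∀ (κ : Type) [Fintype κ] [Nonempty κ] (T : Finset ℕ), L ≤ T.card →
      ∀ (w : ℕ → ℕ → κ → ℝ), (∀ i k β, 0 ≤ w i k β) → (∀ i k, ∑ β, w i k β ≤ 1) →
      ∀ S : ℕ → ℕ → ℕ → κ → κ → κ → Prop,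
      (∀ i ∈ T, ∀ j ∈ T, ∀ k ∈ T, i < j → j < k →
        d ≤ ∑ α, w i j α * ∑ γ, w j k γ * ∑ β, if S i j k α β γ then w i k β else 0) →
      ∃ I ⊆ T, I.card = m ∧ ∃ R B G : ℕ → ℕ → κ,
        ∀ i ∈ I, ∀ j ∈ I, ∀ k ∈ I, i < j → j < k → S i j k (R i j) (B i k) (G j k) := by
  have hd2 : 0 < d / 2 := by positivity
  have hd4 : 0 < d / 4 := by positivity
  obtain ⟨L₁, hL₁⟩ := role (Z := fun i k j => i < j ∧ j < k) (Or.inr (Or.inl fun _ _ _ => Iff.rfl))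
    m hd4
  obtain ⟨L₂, hL₂⟩ := role (Z := fun i _ j => j < i) (Or.inr (Or.inr fun _ _ _ => Iff.rfl))
    L₁ hd4
  obtain ⟨L₃, hL₃⟩ := role (Z := fun _ k j => k < j) (Or.inl fun _ _ _ => Iff.rfl)
    L₂ hd2
  refine ⟨L₃, fun κ _ _ T hT w hw hw1 S hS => ?_⟩
  have hb : ∀ (i k : ℕ) (Q : κ → Prop), 0 ≤ ∑ β, (if Q β then w i k β else 0) ∧
      ∑ β, (if Q β then w i k β else 0) ≤ 1 := by
    intro i k Q
    refine ⟨Finset.sum_nonneg fun β _ => by split_ifs <;> simp [hw], le_trans ?_ (hw1 i k)⟩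
    exact Finset.sum_le_sum fun β _ => by split_ifs <;> simp [hw]
  obtain ⟨I₃, hI₃, hc₃, R, hR⟩ := hL₃ κ T hT w hw hw1
    (fun i j k α => d / 2 ≤ ∑ γ, w j k γ * ∑ β, if S i j k α β γ then w i k β else 0) (by
      intro i hi j hj hij k hk hjk
      refine le_sum_threshold (hw i j) (hw1 i j) (fun α => ?_) hd2.le ?_
      · refine le_trans (Finset.sum_le_sum fun γ _ => ?_) (hw1 j k)
        exact mul_le_of_le_one_right (hw j k γ) (hb _ _ _).2
      · have := hS i hi j hj k hk hij hjk
        linarith)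
  obtain ⟨I₂, hI₂, hc₂, G, hG⟩ := hL₂ κ I₃ hc₃.ge w hw hw1
    (fun j k i γ => d / 4 ≤ ∑ β, if S i j k (R i j) β γ then w i k β else 0) (by
      intro j hj k hk hjk i hi hij
      refine le_sum_threshold (hw j k) (hw1 j k) (fun α => (hb _ _ _).2) hd4.le ?_
      have := hR i hi j hj hij k hk hjk
      linarith)
  obtain ⟨I₁, hI₁, hc₁, B, hB⟩ := hL₁ κ I₂ hc₂.ge w hw hw1
    (fun i k j β => S i j k (R i j) β (G j k)) (by
      intro i hi k hk hik j hj hj'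
      exact hG j hj k hk hj'.2 i hi hj'.1)
  exact ⟨I₁, hI₁.trans (hI₂.trans hI₃), hc₁, R, B, G, fun i hi j hj k hk hij hjk =>
    hB i hi k hk (hij.trans hjk) j hj ⟨hij, hjk⟩⟩

end Roles

section Triples

/-- Sorted triples of elements of `Fin n` correspond to three-element subsets. -/
lemma sum_sorted_triples {n : ℕ} (g : Finset (Fin n) → ℝ) :
    ∑ x : Fin n, ∑ y : Fin n, ∑ z : Fin n, (if x < y ∧ y < z then g {x, y, z} else 0)
      = ∑ e ∈ Finset.univ.filter (fun e : Finset (Fin n) => e.card = 3), g e := by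
  rw [← Finset.sum_congr rfl fun x _ => Finset.sum_product' Finset.univ Finset.univ
      fun y z => if x < y ∧ y < z then g {x, y, z} else 0,
    ← Finset.sum_product' Finset.univ (Finset.univ ×ˢ Finset.univ)
      fun x (p : Fin n × Fin n) => if x < p.1 ∧ p.1 < p.2 then g {x, p.1, p.2} else 0,
    ← Finset.sum_filter]
  refine Finset.sum_bij (fun p _ => {p.1, p.2.1, p.2.2}) ?_ ?_ ?_ ?_
  · rintro ⟨x, y, z⟩ h
    obtain ⟨-, h1, h2⟩ := Finset.mem_filter.1 h
    dsimp only at h1 h2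
    refine Finset.mem_filter.2 ⟨Finset.mem_univ _, Finset.card_eq_three.2
      ⟨x, y, z, h1.ne, (h1.trans h2).ne, h2.ne, rfl⟩⟩
  · rintro ⟨x, y, z⟩ h ⟨x', y', z'⟩ h' heq
    obtain ⟨-, h1, h2⟩ := Finset.mem_filter.1 h
    obtain ⟨-, h1', h2'⟩ := Finset.mem_filter.1 h'
    dsimp only at h1 h2 h1' h2' heq
    have := Finset.ext_iff.1 heq
    have e1 := this x
    have e2 := this y
    have e3 := this z
    have e4 := this x'
    have e5 := this y'
    have e6 := this z'
    simp at e1 e2 e3 e4 e5 e6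
    simp only [Prod.mk.injEq]
    omega
  · intro e he
    obtain ⟨a, b, c, hab, hac, hbc, rfl⟩ := Finset.card_eq_three.1 (Finset.mem_filter.1 he).2
    have key : ∀ x y z : Fin n, x < y → y < z → ({x, y, z} : Finset (Fin n)) = {a, b, c} →
        ∃ (p : Fin n × Fin n × Fin n) (_ : p ∈ (Finset.univ ×ˢ (Finset.univ ×ˢ Finset.univ)).filter
          fun p : Fin n × Fin n × Fin n => p.1 < p.2.1 ∧ p.2.1 < p.2.2),
          ({p.1, p.2.1, p.2.2} : Finset (Fin n)) = {a, b, c} := fun x y z h1 h2 h3 =>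
      ⟨(x, y, z), by simp [h1, h2], h3⟩
    rcases lt_or_gt_of_ne hab with h1 | h1 <;> rcases lt_or_gt_of_ne hac with h2 | h2 <;>
      rcases lt_or_gt_of_ne hbc with h3 | h3
    · exact key a b c h1 h3 rfl
    · exact key a c b h2 h3 (by ext; simp; tauto)
    · omega
    · exact key c a b h2 h1 (by ext; simp; tauto)
    · exact key b a c h1 h2 (by ext; simp; tauto)
    · omega
    · exact key b c a h3 h2 (by ext; simp; tauto)
    · exact key c b a h3 h1 (by ext; simp; tauto)
  · intro p _
    rfl

lemma sum_eq_expect {V : Type} [Fintype V] [Nonempty V] (f : V → ℝ) :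
    ∑ x, f x = Fintype.card V * 𝔼 x, f x := by
  rw [Fintype.expect_eq_sum_div_card]
  field_simp

lemma sum_triple_eq_expect {V : Type} [Fintype V] [Nonempty V] (f : V → V → V → ℝ) :
    ∑ x, ∑ y, ∑ z, f x y z = (Fintype.card V : ℝ) ^ 3 * 𝔼 x, 𝔼 y, 𝔼 z, f x y z := by
  simp only [sum_eq_expect, ← Finset.mul_expect]
  ring

end Triples

section Box
set_option linter.unusedSectionVars false

variable {V : Type} [Fintype V] [Nonempty V]

/-- The fourth power of the box norm. -/
noncomputable def box (D : V → V → ℝ) : ℝ :=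
  𝔼 y, 𝔼 y', 𝔼 x, 𝔼 x', D x y * D x y' * (D x' y * D x' y')

lemma expect_sq_le {α : Type} [Fintype α] [Nonempty α] (f : α → ℝ) :
    (𝔼 x, f x) ^ 2 ≤ 𝔼 x, f x ^ 2 := by
  have := Finset.expect_mul_sq_le_sq_mul_sq (Finset.univ : Finset α) f (fun _ => 1)
  simpa using this

lemma expect_sq {α : Type} [Fintype α] (f : α → ℝ) :
    (𝔼 x, f x) ^ 2 = 𝔼 x, 𝔼 x', f x * f x' := by
  rw [sq, Finset.expect_mul_expect]

lemma box_eq (D : V → V → ℝ) : box D = 𝔼 y, 𝔼 y', (𝔼 x, D x y * D x y') ^ 2 := by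
  simp only [expect_sq, box]

lemma box_nonneg (D : V → V → ℝ) : 0 ≤ box D := by
  rw [box_eq]
  exact Finset.expect_nonneg fun _ _ => Finset.expect_nonneg fun _ _ => sq_nonneg _

lemma mul_sq_le_of_abs_le {a b : ℝ} (ha : |a| ≤ 1) : (a * b) ^ 2 ≤ b ^ 2 := by
  rw [mul_pow]
  have := (sq_le_one_iff_abs_le_one a).2 ha
  nlinarith [sq_nonneg b]

lemma expect_pow_four_le_box (D : V → V → ℝ) (a b : V → ℝ) (ha : ∀ x, |a x| ≤ 1)
    (hb : ∀ x, |b x| ≤ 1) : (𝔼 x, 𝔼 y, D x y * (a x * b y)) ^ 4 ≤ box D := by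
  have h1 : (𝔼 x, 𝔼 y, D x y * (a x * b y)) ^ 2
      ≤ 𝔼 y, 𝔼 y', b y * b y' * 𝔼 x, D x y * D x y' := by
    calc (𝔼 x, 𝔼 y, D x y * (a x * b y)) ^ 2 = (𝔼 x, a x * 𝔼 y, D x y * b y) ^ 2 := by
          congr 1
          refine Finset.expect_congr rfl fun x _ => ?_
          rw [Finset.mul_expect]
          exact Finset.expect_congr rfl fun y _ => by ring
      _ ≤ 𝔼 x, (a x * 𝔼 y, D x y * b y) ^ 2 := expect_sq_le _
      _ ≤ 𝔼 x, (𝔼 y, D x y * b y) ^ 2 :=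
          Finset.expect_le_expect fun x _ => mul_sq_le_of_abs_le (ha x)
      _ = _ := by
          simp only [expect_sq]
          rw [Finset.expect_comm]
          refine Finset.expect_congr rfl fun y _ => ?_
          rw [Finset.expect_comm]
          refine Finset.expect_congr rfl fun y' _ => ?_
          rw [Finset.mul_expect]
          exact Finset.expect_congr rfl fun x _ => by ring
  calc (𝔼 x, 𝔼 y, D x y * (a x * b y)) ^ 4 = ((𝔼 x, 𝔼 y, D x y * (a x * b y)) ^ 2) ^ 2 := by ring
    _ ≤ (𝔼 y, 𝔼 y', b y * b y' * 𝔼 x, D x y * D x y') ^ 2 :=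
        pow_le_pow_left₀ (sq_nonneg _) h1 2
    _ ≤ 𝔼 y, (𝔼 y', b y * b y' * 𝔼 x, D x y * D x y') ^ 2 := expect_sq_le _
    _ ≤ 𝔼 y, 𝔼 y', (b y * b y' * 𝔼 x, D x y * D x y') ^ 2 :=
        Finset.expect_le_expect fun y _ => expect_sq_le _
    _ ≤ 𝔼 y, 𝔼 y', (𝔼 x, D x y * D x y') ^ 2 :=
        Finset.expect_le_expect fun y _ => Finset.expect_le_expect fun y' _ =>
          mul_sq_le_of_abs_le (by
            rw [abs_mul]
            exact mul_le_one₀ (hb y) (abs_nonneg _) (hb y'))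
    _ = box D := (box_eq D).symm

/-- The deviation of the indicator of the colour `c` from its mean, on increasing pairs. -/
noncomputable def colDev {n : ℕ} (col : Fin n × Fin n → Fin 3) (c : Fin 3) (x y : Fin n) : ℝ :=
  if x < y then (if col (x, y) = c then 1 else 0) - 1 / 3 else 0

lemma abs_colDev_le {n : ℕ} (col : Fin n × Fin n → Fin 3) (c : Fin 3) (x y : Fin n) :
    |colDev col c x y| ≤ 1 := by
  unfold colDev
  split_ifs <;> rw [abs_le] <;> constructor <;> norm_num

lemma expect_colDev {n : ℕ} (c : Fin 3) {x x' y y' : Fin n} (hx : x ≠ x') (hy : y ≠ y') :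
    𝔼 col : Fin n × Fin n → Fin 3, colDev col c x y * colDev col c x y' *
      (colDev col c x' y * colDev col c x' y') = 0 := by
  rw [← expect_update (X := fun _ : Fin n × Fin n => Fin 3) (x, y)]
  refine Finset.expect_eq_zero fun col _ => ?_
  have h1 : ∀ t, colDev (Function.update col (x, y) t) c x y' = colDev col c x y' := by
    intro t
    unfold colDev
    rw [Function.update_of_ne (by simp [hy.symm])]
  have h2 : ∀ t, colDev (Function.update col (x, y) t) c x' y = colDev col c x' y := by
    intro t
    unfold colDev
    rw [Function.update_of_ne (by simp [hx.symm])]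
  have h3 : ∀ t, colDev (Function.update col (x, y) t) c x' y' = colDev col c x' y' := by
    intro t
    unfold colDev
    rw [Function.update_of_ne (by simp [hx.symm])]
  simp only [h1, h2, h3, mul_assoc]
  rw [← Finset.expect_mul]
  have h4 : 𝔼 t, colDev (Function.update col (x, y) t) c x y = 0 := by
    unfold colDev
    simp only [Function.update_self]
    split_ifs
    · rw [Finset.expect_sub_distrib, Fintype.expect_ite_eq', Fintype.expect_const]
      simp [NNRat.smul_def]
    · simp
  rw [h4, zero_mul]

lemma expect_box_colDev_le {n : ℕ} [NeZero n] (c : Fin 3) :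
    𝔼 col : Fin n × Fin n → Fin 3, box (colDev col c) ≤ 2 / n := by
  have h : ∀ y y' x x' : Fin n, 𝔼 col : Fin n × Fin n → Fin 3, colDev col c x y * colDev col c x y' *
      (colDev col c x' y * colDev col c x' y')
        ≤ (if y' = y then 1 else 0) + (if x' = x then (1 : ℝ) else 0) := by
    intro y y' x x'
    by_cases hx : x' = x
    · refine (expect_le_one _ _ fun col _ => ?_).trans (by
        rw [if_pos hx]
        split_ifs <;> norm_num)
      refine (le_abs_self _).trans ?_
      simp only [abs_mul]
      exact mul_le_one₀ (mul_le_one₀ (abs_colDev_le _ _ _ _) (abs_nonneg _) (abs_colDev_le _ _ _ _))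
        (by positivity)
        (mul_le_one₀ (abs_colDev_le _ _ _ _) (abs_nonneg _) (abs_colDev_le _ _ _ _))
    by_cases hy : y' = y
    · refine (expect_le_one _ _ fun col _ => ?_).trans (by
        rw [if_pos hy]
        split_ifs <;> norm_num)
      refine (le_abs_self _).trans ?_
      simp only [abs_mul]
      exact mul_le_one₀ (mul_le_one₀ (abs_colDev_le _ _ _ _) (abs_nonneg _) (abs_colDev_le _ _ _ _))
        (by positivity)
        (mul_le_one₀ (abs_colDev_le _ _ _ _) (abs_nonneg _) (abs_colDev_le _ _ _ _))
    rw [expect_colDev c (Ne.symm hx) (Ne.symm hy), if_neg hx, if_neg hy]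
    norm_num
  unfold box
  calc _ = 𝔼 y : Fin n, 𝔼 y' : Fin n, 𝔼 x : Fin n, 𝔼 x' : Fin n,
        𝔼 col : Fin n × Fin n → Fin 3, colDev col c x y * colDev col c x y' *
      (colDev col c x' y * colDev col c x' y') := by
        rw [Finset.expect_comm]
        refine Finset.expect_congr rfl fun y _ => ?_
        rw [Finset.expect_comm]
        refine Finset.expect_congr rfl fun y' _ => ?_
        rw [Finset.expect_comm]
        refine Finset.expect_congr rfl fun x _ => ?_
        rw [Finset.expect_comm]
    _ ≤ 𝔼 y : Fin n, 𝔼 y' : Fin n, 𝔼 x : Fin n, 𝔼 x' : Fin n,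
        ((if y' = y then 1 else 0) + (if x' = x then (1 : ℝ) else 0)) :=
        Finset.expect_le_expect fun y _ => Finset.expect_le_expect fun y' _ =>
          Finset.expect_le_expect fun x _ => Finset.expect_le_expect fun x' _ => h y y' x x'
    _ = 2 / n := by
        simp only [Finset.expect_add_distrib, Fintype.expect_const, Fintype.expect_ite_eq',
          Fintype.card_fin, NNRat.smul_def]
        push_cast
        ring

lemma exists_quasirandom_colouring {n : ℕ} [NeZero n] :
    ∃ col : Fin n × Fin n → Fin 3, ∀ c, box (colDev col c) ≤ 6 / n := by
  obtain ⟨col, -, h⟩ := Finset.exists_le_of_expect_le (s := Finset.univ)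
    (f := fun col : Fin n × Fin n → Fin 3 => ∑ c, box (colDev col c)) (a := (6 : ℝ) / n)
    Finset.univ_nonempty (by
      rw [Finset.expect_sum_comm]
      refine (Finset.sum_le_sum fun c _ => expect_box_colDev_le c).trans (le_of_eq ?_)
      simp
      ring)
  refine ⟨col, fun c => le_trans ?_ h⟩
  exact Finset.single_le_sum (f := fun c => box (colDev col c)) (fun c _ => box_nonneg _)
    (Finset.mem_univ c)

end Box

section Construction

/-- The 3-graph of triples `x < y < z` whose pairs have colours `0`, `1`, `2` in the
positions `xy`, `xz`, `yz`. -/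
noncomputable def colGraph {n : ℕ} (col : Fin n × Fin n → Fin 3) : H3 (Fin n) where
  edges := Finset.univ.filter fun e => ∃ x y z : Fin n, x < y ∧ y < z ∧ e = {x, y, z} ∧
    col (x, y) = 0 ∧ col (x, z) = 1 ∧ col (y, z) = 2
  card3 := by
    intro e he
    obtain ⟨-, x, y, z, h1, h2, rfl, -⟩ := Finset.mem_filter.1 he
    exact Finset.card_eq_three.2 ⟨x, y, z, h1.ne, (h1.trans h2).ne, h2.ne, rfl⟩

lemma mem_colGraph {n : ℕ} (col : Fin n × Fin n → Fin 3) {x y z : Fin n} (hxy : x < y)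
    (hyz : y < z) : {x, y, z} ∈ (colGraph col).edges ↔
      col (x, y) = 0 ∧ col (x, z) = 1 ∧ col (y, z) = 2 := by
  constructor
  · intro h
    obtain ⟨-, x', y', z', h1, h2, heq, hc⟩ := Finset.mem_filter.1 h
    have := Finset.ext_iff.1 heq
    have e1 := this x
    have e2 := this y
    have e3 := this z
    have e4 := this x'
    have e5 := this y'
    have e6 := this z'
    simp at e1 e2 e3 e4 e5 e6
    obtain ⟨rfl, rfl, rfl⟩ : x = x' ∧ y = y' ∧ z = z' := by omega
    exact hc
  · intro h
    exact Finset.mem_filter.2 ⟨Finset.mem_univ _, x, y, z, hxy, hyz, rfl, h⟩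

lemma colGraph_conflict {n : ℕ} (col : Fin n × Fin n → Fin 3) {x y z w : Fin n} (hxy : x < y)
    (hyz : y < z) (hwx : w ≠ x) (hwy : w ≠ y) (hwz : w ≠ z)
    (h1 : {x, y, w} ∈ (colGraph col).edges) (h2 : {y, z, w} ∈ (colGraph col).edges) : False := by
  have c1 : ({x, y, w} : Finset (Fin n)) = {w, x, y} := by ext; simp; tauto
  have c2 : ({x, y, w} : Finset (Fin n)) = {x, w, y} := by ext; simp; tauto
  have c3 : ({y, z, w} : Finset (Fin n)) = {w, y, z} := by ext; simp; tauto
  have c4 : ({y, z, w} : Finset (Fin n)) = {y, w, z} := by ext; simp; tauto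
  rcases lt_or_gt_of_ne hwy with h | h
  · rw [c3, mem_colGraph col h hyz] at h2
    rcases lt_or_gt_of_ne hwx with h' | h'
    · rw [c1, mem_colGraph col h' hxy, h2.1] at h1
      simp at h1
    · rw [c2, mem_colGraph col h' h, h2.1] at h1
      simp at h1
  · rw [mem_colGraph col hxy h] at h1
    rcases lt_or_gt_of_ne hwz with h' | h'
    · rw [c4, mem_colGraph col h h', h1.2.2] at h2
      simp at h2
    · rw [mem_colGraph col hyz h', h1.2.2] at h2
      simp at h2

lemma exists_labeling {W : Type} [Fintype W] {n : ℕ} {f : W → Fin n} (hf : Function.Injective f) :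
    ∃ σ : W ≃ Fin (Fintype.card W), ∀ x y, σ x < σ y ↔ f x < f y := by
  have hc : (Finset.univ.image f).card = Fintype.card W := by
    rw [Finset.card_image_of_injective _ hf, Finset.card_univ]
  let o := (Finset.univ.image f).orderIsoOfFin hc
  have hb : Function.Bijective fun x : W =>
      o.symm ⟨f x, Finset.mem_image_of_mem f (Finset.mem_univ x)⟩ := by
    rw [Fintype.bijective_iff_injective_and_card]
    refine ⟨fun x y h => hf ?_, by simp⟩
    exact congrArg Subtype.val (o.symm.injective h)
  refine ⟨Equiv.ofBijective _ hb, fun x y => ?_⟩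
  simp [Equiv.ofBijective_apply]

lemma colGraph_free {W : Type} [DecidableEq W] [Fintype W] {F : H3 W}
    (hF : ∀ σ : W ≃ Fin (Fintype.card W), ∃ v : W,
        hasMonoP3 F v (fun x => ((σ x : Fin (Fintype.card W)) : ℕ)))
    {n : ℕ} (col : Fin n × Fin n → Fin 3) : (colGraph col).free F := by
  rintro ⟨f, hf, hE⟩
  obtain ⟨σ, hσ⟩ := exists_labeling hf
  obtain ⟨v, x, y, z, h1, h2, hxz, hm⟩ := hF σ
  simp only [Fin.val_fin_lt, hσ] at hm
  have hne : ∀ a b, ({a, b, v} : Finset W) ∈ F.edges → v ≠ a ∧ v ≠ b := by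
    intro a b h
    have := F.card3 _ h
    constructor
    · rintro rfl
      have h3 : ({v, b, v} : Finset W) = {b, v} := by ext; simp
      rw [h3] at this
      have := Finset.card_le_two (a := b) (b := v)
      omega
    · rintro rfl
      have h3 : ({a, v, v} : Finset W) = {a, v} := by ext; simp
      rw [h3] at this
      have := Finset.card_le_two (a := a) (b := v)
      omega
  have g1 := hE _ h1
  have g2 := hE _ h2
  simp only [Finset.image_insert, Finset.image_singleton] at g1 g2
  have n1 := hne _ _ h1
  have n2 := hne _ _ h2
  rcases hm with ⟨a, b⟩ | ⟨a, b⟩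
  · exact colGraph_conflict col a b (hf.ne n1.1) (hf.ne n1.2) (hf.ne n2.2) g1 g2
  · rw [Finset.insert_comm] at g1 g2
    exact colGraph_conflict col a b (hf.ne n2.2) (hf.ne n1.2) (hf.ne n1.1) g2 g1

lemma abs_expect_third_le {V : Type} [Fintype V] [Nonempty V] {D : V → V → ℝ} {q : ℝ} (hq : 0 ≤ q)
    (hD : box D ≤ q ^ 4) (G : V → V → V → ℝ)
    (h : ∀ z, ∃ a b : V → ℝ, (∀ x, |a x| ≤ 1) ∧ (∀ x, |b x| ≤ 1) ∧
      ∀ x y, G z x y = D x y * (a x * b y)) :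
    |𝔼 z, 𝔼 x, 𝔼 y, G z x y| ≤ q := by
  refine abs_expect_le_of_forall fun z => ?_
  obtain ⟨a, b, ha, hb, hG⟩ := h z
  simp only [hG]
  have h1 := (expect_pow_four_le_box D a b ha hb).trans hD
  have h2 : |𝔼 x, 𝔼 y, D x y * (a x * b y)| ^ 4 ≤ q ^ 4 := by
    rwa [Even.pow_abs (by decide)]
  exact (pow_le_pow_iff_left₀ (abs_nonneg _) hq (by norm_num)).1 h2

lemma ite_and_sub_third (a b c d e f : Prop) [Decidable a] [Decidable b] [Decidable c]
    [Decidable d] [Decidable e] [Decidable f] :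
    (if a ∧ b ∧ c then (if d ∧ e ∧ f then (1 : ℝ) else 0) - 1 / 27 else 0)
      = (if a then 1 else 0) * (if b then 1 else 0) * (if c then 1 else 0) *
        ((if d then 1 else 0) * (if e then 1 else 0) * (if f then 1 else 0) - 1 / 27) := by
  by_cases a <;> by_cases b <;> by_cases c <;> by_cases d <;> by_cases e <;> by_cases f <;>
    simp [*]

lemma abs_colour_count {n : ℕ} [NeZero n] (col : Fin n × Fin n → Fin 3) {q : ℝ} (hq : 0 ≤ q)
    (hcol : ∀ c, box (colDev col c) ≤ q ^ 4) (U : Finset (Fin n)) :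
    |𝔼 x : Fin n, 𝔼 y : Fin n, 𝔼 z : Fin n, if x < y ∧ y < z then
      (if {x, y, z} ⊆ U then (if col (x, y) = 0 ∧ col (x, z) = 1 ∧ col (y, z) = 2 then (1 : ℝ) else 0)
        - 1 / 27 else 0) else 0| ≤ 2 * q := by
  set u : Fin n → ℝ := fun x => if x ∈ U then 1 else 0 with hu
  set e : Fin 3 → Fin n → Fin n → ℝ := fun c x y => if col (x, y) = c then 1 else 0 with he
  set l : Fin n → Fin n → ℝ := fun x y => if x < y then 1 else 0 with hl
  have hu1 : ∀ x, |u x| ≤ 1 := fun x => by simp only [hu]; split_ifs <;> simp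
  have he1 : ∀ c x y, |e c x y| ≤ 1 := fun c x y => by simp only [he]; split_ifs <;> simp
  have hl1 : ∀ x y, |l x y| ≤ 1 := fun x y => by simp only [hl]; split_ifs <;> simp
  have hm : ∀ {a b : ℝ}, |a| ≤ 1 → |b| ≤ 1 → |a * b| ≤ 1 := fun {a b} h1 h2 => by
    rw [abs_mul]; exact mul_le_one₀ h1 (abs_nonneg _) h2
  have hD : ∀ c x y, colDev col c x y = l x y * (e c x y - 1 / 3) := by
    intro c x y
    simp only [colDev, hl, he]
    split_ifs <;> ring
  have key : ∀ x y z : Fin n, (if x < y ∧ y < z then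
      (if {x, y, z} ⊆ U then (if col (x, y) = 0 ∧ col (x, z) = 1 ∧ col (y, z) = 2 then (1 : ℝ) else 0)
        - 1 / 27 else 0) else 0) =
      colDev col 0 x y * ((u x * e 1 x z) * (u y * e 2 y z * l y z * u z))
      + 1 / 3 * (colDev col 1 x z * ((u x * l x y) * (u z * e 2 y z * l y z * u y)))
      + 1 / 9 * (colDev col 2 y z * ((u y * u x * l x y) * u z)) := by
    intro x y z
    have h1 : (if {x, y, z} ⊆ U then (if col (x, y) = 0 ∧ col (x, z) = 1 ∧ col (y, z) = 2
        then (1 : ℝ) else 0) - 1 / 27 else 0)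
          = u x * u y * u z * (e 0 x y * e 1 x z * e 2 y z - 1 / 27) := by
      simp only [hu, he, Finset.insert_subset_iff, Finset.singleton_subset_iff]
      exact ite_and_sub_third _ _ _ _ _ _
    rw [h1]
    simp only [hD]
    by_cases hx : x < y
    · by_cases hy : y < z
      · have hz := hx.trans hy
        simp only [hl, hx, hy, hz, and_self, if_true]
        ring
      · simp [hl, hy]
    · simp [hl, hx]
  simp only [key, Finset.expect_add_distrib, ← Finset.mul_expect]
  have t1 : |𝔼 x : Fin n, 𝔼 y : Fin n, 𝔼 z : Fin n,
      colDev col 0 x y * ((u x * e 1 x z) * (u y * e 2 y z * l y z * u z))| ≤ q := by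
    rw [Finset.expect_congr rfl fun x _ => Finset.expect_comm _ _ _, Finset.expect_comm]
    exact abs_expect_third_le hq (hcol 0) (fun z x y =>
      colDev col 0 x y * ((u x * e 1 x z) * (u y * e 2 y z * l y z * u z))) fun z =>
      ⟨_, _, fun x => hm (hu1 x) (he1 1 x z), fun y =>
        hm (hm (hm (hu1 y) (he1 2 y z)) (hl1 y z)) (hu1 z), fun _ _ => rfl⟩
  have t2 : |𝔼 x : Fin n, 𝔼 y : Fin n, 𝔼 z : Fin n,
      colDev col 1 x z * ((u x * l x y) * (u z * e 2 y z * l y z * u y))| ≤ q := by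
    rw [Finset.expect_comm]
    exact abs_expect_third_le hq (hcol 1) (fun y x z =>
      colDev col 1 x z * ((u x * l x y) * (u z * e 2 y z * l y z * u y))) fun y =>
      ⟨_, _, fun x => hm (hu1 x) (hl1 x y), fun z =>
        hm (hm (hm (hu1 z) (he1 2 y z)) (hl1 y z)) (hu1 y), fun _ _ => rfl⟩
  have t3 : |𝔼 x : Fin n, 𝔼 y : Fin n, 𝔼 z : Fin n,
      colDev col 2 y z * ((u y * u x * l x y) * u z)| ≤ q :=
    abs_expect_third_le hq (hcol 2) (fun x y z =>
      colDev col 2 y z * ((u y * u x * l x y) * u z)) fun x =>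
      ⟨_, _, fun y => hm (hm (hu1 y) (hu1 x)) (hl1 x y), hu1, fun _ _ => rfl⟩
  simp only [← Finset.mul_expect] at t1 t2 t3
  have t1 := abs_le.1 t1
  have t2 := abs_le.1 t2
  have t3 := abs_le.1 t3
  rw [abs_le]
  constructor <;> linarith [t1.1, t1.2, t2.1, t2.2, t3.1, t3.2]

lemma one_div_mem_densities {W : Type} [DecidableEq W] [Fintype W] {F : H3 W}
    (hF : ∀ σ : W ≃ Fin (Fintype.card W), ∃ v : W,
        hasMonoP3 F v (fun x => ((σ x : Fin (Fintype.card W)) : ℕ)))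
    (η : ℝ) (hη : 0 < η) (n₀ : ℕ) :
    ∃ n, n₀ ≤ n ∧ ∃ H : H3 (Fin n), H.free F ∧ H.uniformlyDense (1 / 27) η := by
  obtain ⟨n₁, hn₁⟩ := exists_nat_gt (6 / (η / 2) ^ 4)
  set n := n₀ + n₁ + 1 with hn
  have hnpos : (0 : ℝ) < n := by exact_mod_cast Nat.succ_pos _
  obtain ⟨col, hcol⟩ := exists_quasirandom_colouring (n := n)
  refine ⟨n, by omega, colGraph col, colGraph_free hF col, fun U => ?_⟩
  have hq : (6 : ℝ) / n ≤ (η / 2) ^ 4 := by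
    rw [div_lt_iff₀ (by positivity)] at hn₁
    rw [div_le_iff₀ hnpos]
    have : (n₁ : ℝ) ≤ n := by exact_mod_cast (by omega : n₁ ≤ n)
    have h4 : 0 < (η / 2) ^ 4 := by positivity
    nlinarith
  have hmain := (abs_le.1 (abs_colour_count col (by positivity) (fun c => (hcol c).trans hq) U)).1
  have hmul := mul_le_mul_of_nonneg_left hmain (by positivity : (0 : ℝ) ≤ (n : ℝ) ^ 3)
  have hs := sum_triple_eq_expect fun x y z : Fin n => if x < y ∧ y < z then
      (if {x, y, z} ⊆ U then (if col (x, y) = 0 ∧ col (x, z) = 1 ∧ col (y, z) = 2 then (1 : ℝ) else 0)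
        - 1 / 27 else 0) else 0
  rw [Fintype.card_fin] at hs ⊢
  rw [← hs] at hmul
  have hconv : ∀ x y z : Fin n, (if x < y ∧ y < z then
      (if {x, y, z} ⊆ U then (if col (x, y) = 0 ∧ col (x, z) = 1 ∧ col (y, z) = 2 then (1 : ℝ) else 0)
        - 1 / 27 else 0) else 0) = if x < y ∧ y < z then
          (fun e : Finset (Fin n) => if e ⊆ U then (if e ∈ (colGraph col).edges then (1 : ℝ) else 0)
            - 1 / 27 else 0) {x, y, z} else 0 := by
    intro x y z
    by_cases h : x < y ∧ y < z
    · rw [if_pos h, if_pos h]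
      dsimp only
      simp only [mem_colGraph col h.1 h.2]
    · rw [if_neg h, if_neg h]
  simp only [hconv] at hmul
  rw [sum_sorted_triples (fun e : Finset (Fin n) => if e ⊆ U then
    (if e ∈ (colGraph col).edges then (1 : ℝ) else 0) - 1 / 27 else 0), ← Finset.sum_filter,
    Finset.sum_sub_distrib, Finset.sum_const, nsmul_eq_mul, Finset.sum_boole] at hmul
  have hA : (Finset.filter (fun e => e ⊆ U) (Finset.univ.filter fun e : Finset (Fin n) => e.card = 3))
      = U.powersetCard 3 := by
    ext e
    simp [Finset.mem_powersetCard, and_comm]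
  have hB : (Finset.filter (fun e => e ∈ (colGraph col).edges) (U.powersetCard 3))
      = (colGraph col).edges.filter fun e => e ⊆ U := by
    ext e
    simp only [Finset.mem_filter, Finset.mem_powersetCard]
    exact ⟨fun h => ⟨h.2, h.1.1⟩, fun h => ⟨⟨h.2, (colGraph col).card3 _ h.1⟩, h.1⟩⟩
  rw [hA, hB, Finset.card_powersetCard] at hmul
  linarith

end Construction

section WeightedDensity

/-- A multi-affine polynomial on the cube is minimised at a vertex of the cube. -/
lemma multiaffine_ge {V : Type} [Fintype V] [DecidableEq V] (E : Finset (Finset V)) (w : Finset V → ℝ)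
    {r : ℝ} (h : ∀ U : Finset V, r ≤ ∑ e ∈ E, w e * ∏ x ∈ e, (if x ∈ U then 1 else 0))
    (u : V → ℝ) (hu : ∀ x, u x ∈ Set.Icc (0 : ℝ) 1) : r ≤ ∑ e ∈ E, w e * ∏ x ∈ e, u x := by
  suffices H : ∀ (s : Finset V) (u : V → ℝ), (∀ x, u x ∈ Set.Icc (0 : ℝ) 1) →
      (∀ x ∉ s, u x = 0 ∨ u x = 1) → r ≤ ∑ e ∈ E, w e * ∏ x ∈ e, u x by
    exact H Finset.univ u hu (by simp)
  intro s
  induction s using Finset.induction_on with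
  | empty =>
    intro u _ h01
    convert h (Finset.univ.filter fun x => u x = 1) using 6 with e he x hx
    rcases h01 x (by simp) with h | h <;> simp [h]
  | insert v s hv ih =>
    intro u hu h01
    have key : ∀ t : ℝ, t = 0 ∨ t = 1 → r ≤ ∑ e ∈ E, w e * ∏ x ∈ e, Function.update u v t x := by
      intro t ht
      refine ih _ (fun x => ?_) (fun x hx => ?_)
      · by_cases hxv : x = v
        · subst hxv
          rw [Function.update_self]
          rcases ht with rfl | rfl <;> simp
        · rw [Function.update_of_ne hxv]
          exact hu x
      · by_cases hxv : x = v
        · subst hxv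
          rwa [Function.update_self]
        · rw [Function.update_of_ne hxv]
          exact h01 x (by simp [hxv, hx])
    have h0 := key 0 (Or.inl rfl)
    have h1 := key 1 (Or.inr rfl)
    have heq : ∑ e ∈ E, w e * ∏ x ∈ e, u x
        = (1 - u v) * ∑ e ∈ E, w e * ∏ x ∈ e, Function.update u v 0 x
          + u v * ∑ e ∈ E, w e * ∏ x ∈ e, Function.update u v 1 x := by
      rw [Finset.mul_sum, Finset.mul_sum, ← Finset.sum_add_distrib]
      refine Finset.sum_congr rfl fun e _ => ?_
      by_cases hve : v ∈ e
      · rw [Finset.prod_update_of_mem hve, Finset.prod_update_of_mem hve,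
          ← Finset.mul_prod_erase e u hve, Finset.sdiff_singleton_eq_erase]
        ring
      · rw [Finset.prod_update_of_notMem hve, Finset.prod_update_of_notMem hve]
        ring
    rw [heq]
    nlinarith [(hu v).1, (hu v).2]

lemma sum_distinct_triples {n : ℕ} (g : Finset (Fin n) → ℝ) :
    ∑ x : Fin n, ∑ y : Fin n, ∑ z : Fin n, (if x ≠ y ∧ x ≠ z ∧ y ≠ z then g {x, y, z} else 0)
      = 6 * ∑ e ∈ Finset.univ.filter (fun e : Finset (Fin n) => e.card = 3), g e := by
  rw [← sum_sorted_triples]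
  set s : Fin n → Fin n → Fin n → ℝ := fun x y z => if x < y ∧ y < z then g {x, y, z} else 0
    with hs
  have hpt : ∀ x y z : Fin n, (if x ≠ y ∧ x ≠ z ∧ y ≠ z then g {x, y, z} else 0)
      = s x y z + s x z y + s y x z + s y z x + s z x y + s z y x := by
    intro x y z
    have c1 : ({x, z, y} : Finset (Fin n)) = {x, y, z} := by ext; simp; tauto
    have c2 : ({y, x, z} : Finset (Fin n)) = {x, y, z} := by ext; simp; tauto
    have c3 : ({y, z, x} : Finset (Fin n)) = {x, y, z} := by ext; simp; tauto
    have c4 : ({z, x, y} : Finset (Fin n)) = {x, y, z} := by ext; simp; tauto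
    have c5 : ({z, y, x} : Finset (Fin n)) = {x, y, z} := by ext; simp; tauto
    simp only [hs, c1, c2, c3, c4, c5]
    generalize g {x, y, z} = r
    rcases lt_trichotomy x y with h1 | h1 | h1 <;> rcases lt_trichotomy x z with h2 | h2 | h2 <;>
      rcases lt_trichotomy y z with h3 | h3 | h3 <;>
      first
      | (exfalso; omega)
      | simp [h1, h2, h3, h1.ne, h1.ne', h2.ne, h2.ne', h3.ne, h3.ne', h1.not_gt, h2.not_gt, h3.not_gt]
      | (subst_vars; simp [not_lt_of_gt, *])
  simp only [hpt, Finset.sum_add_distrib]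
  have r1 : ∑ x, ∑ y, ∑ z, s x z y = ∑ x, ∑ y, ∑ z, s x y z :=
    Finset.sum_congr rfl fun x _ => Finset.sum_comm
  have r2 : ∑ x, ∑ y, ∑ z, s y x z = ∑ x, ∑ y, ∑ z, s x y z := Finset.sum_comm
  have r3 : ∑ x, ∑ y, ∑ z, s y z x = ∑ x, ∑ y, ∑ z, s x y z := by
    rw [Finset.sum_comm]
    exact Finset.sum_congr rfl fun x _ => Finset.sum_comm
  have r4 : ∑ x, ∑ y, ∑ z, s z x y = ∑ x, ∑ y, ∑ z, s x y z := by
    rw [Finset.sum_congr rfl fun x _ => Finset.sum_comm, Finset.sum_comm]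
  have r5 : ∑ x, ∑ y, ∑ z, s z y x = ∑ x, ∑ y, ∑ z, s x y z := by
    rw [Finset.sum_comm, Finset.sum_congr rfl fun x _ => Finset.sum_comm, Finset.sum_comm]
  rw [r1, r2, r3, r4, r5]
  ring

/-- The indicator of the edges of a 3-graph, as a function of three vertices. -/
noncomputable def edgeInd {n : ℕ} (H : H3 (Fin n)) (x y z : Fin n) : ℝ :=
  if {x, y, z} ∈ H.edges then 1 else 0

lemma edgeInd_mem_Icc {n : ℕ} (H : H3 (Fin n)) (x y z : Fin n) :
    edgeInd H x y z ∈ Set.Icc (0 : ℝ) 1 := by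
  unfold edgeInd; split_ifs <;> simp

lemma card_triple_le_two {V : Type} [DecidableEq V] {x y z : V} (h : ¬ (x ≠ y ∧ x ≠ z ∧ y ≠ z)) :
    ({x, y, z} : Finset V).card ≤ 2 := by
  by_cases h1 : x = y
  · subst h1
    have : ({x, x, z} : Finset V) = {x, z} := by ext; simp
    rw [this]
    exact Finset.card_le_two
  by_cases h2 : x = z
  · subst h2
    have : ({x, y, x} : Finset V) = {y, x} := by ext; simp
    rw [this]
    exact Finset.card_le_two
  have h3 : y = z := by tauto
  subst h3
  have : ({x, y, y} : Finset V) = {x, y} := by ext; simp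
  rw [this]
  exact Finset.card_le_two

lemma edgeInd_ne {n : ℕ} (H : H3 (Fin n)) {x y z : Fin n} (h : {x, y, z} ∈ H.edges) :
    x ≠ y ∧ x ≠ z ∧ y ≠ z := by
  by_contra hcon
  have h1 := card_triple_le_two hcon
  have h2 := H.card3 _ h
  omega

lemma weighted_density {n : ℕ} [NeZero n] {H : H3 (Fin n)} {d η : ℝ} (hd0 : 0 ≤ d) (hd1 : d ≤ 1)
    (hH : H.uniformlyDense d η) (u : Fin n → ℝ) (hu : ∀ x, u x ∈ Set.Icc (0 : ℝ) 1) :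
    d * (𝔼 x, u x) ^ 3 - 3 / n - 6 * η
      ≤ 𝔼 x, 𝔼 y, 𝔼 z, edgeInd H x y z * (u x * u y * u z) := by
  have hnpos : (0 : ℝ) < n := by exact_mod_cast Nat.pos_of_ne_zero (NeZero.ne n)
  set w : Finset (Fin n) → ℝ := fun e => (if e ∈ H.edges then 1 else 0) - d with hw
  have h1 := multiaffine_ge (Finset.univ.filter fun e : Finset (Fin n) => e.card = 3) w
    (r := - (η * (n : ℝ) ^ 3)) (by
      intro U
      have hU := hH U
      rw [Fintype.card_fin] at hU
      have hA : ∀ e : Finset (Fin n), ∏ x ∈ e, (if x ∈ U then (1 : ℝ) else 0)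
          = if e ⊆ U then 1 else 0 := by
        intro e
        rw [Finset.prod_ite_zero]
        simp [Finset.subset_iff]
      simp only [hA, mul_ite, mul_one, mul_zero]
      rw [← Finset.sum_filter]
      have hA : (Finset.filter (fun e => e ⊆ U)
          (Finset.univ.filter fun e : Finset (Fin n) => e.card = 3)) = U.powersetCard 3 := by
        ext e
        simp [Finset.mem_powersetCard, and_comm]
      have hB : (Finset.filter (fun e => e ∈ H.edges) (U.powersetCard 3))
          = H.edges.filter fun e => e ⊆ U := by
        ext e
        simp only [Finset.mem_filter, Finset.mem_powersetCard]
        exact ⟨fun h => ⟨h.2, h.1.1⟩, fun h => ⟨⟨h.2, H.card3 _ h.1⟩, h.1⟩⟩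
      rw [hA, hw, Finset.sum_sub_distrib, Finset.sum_const, nsmul_eq_mul, Finset.sum_boole, hB,
        Finset.card_powersetCard]
      linarith) u hu
  have h2 := sum_distinct_triples fun e : Finset (Fin n) => w e * ∏ x ∈ e, u x
  have h3 : ∀ x y z : Fin n, (if x ≠ y ∧ x ≠ z ∧ y ≠ z then
      w {x, y, z} * ∏ a ∈ ({x, y, z} : Finset (Fin n)), u a else 0)
      ≤ edgeInd H x y z * (u x * u y * u z) - d * (u x * u y * u z)
        + ((if y = x then 1 else 0) + (if z = x then 1 else 0) + (if z = y then 1 else 0)) := by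
    intro x y z
    have hp := mul_mem_Icc (mul_mem_Icc (hu x) (hu y)) (hu z)
    have hdp := mul_mem_Icc (Set.mem_Icc.2 ⟨hd0, hd1⟩) hp
    by_cases h : x ≠ y ∧ x ≠ z ∧ y ≠ z
    · rw [if_pos h, Finset.prod_insert (by simp [h.1, h.2.1]), Finset.prod_insert (by simp [h.2.2]),
        Finset.prod_singleton, if_neg h.1.symm, if_neg h.2.1.symm, if_neg h.2.2.symm]
      simp only [hw, edgeInd]
      linarith
    · rw [if_neg h]
      have hE : edgeInd H x y z = 0 := by
        unfold edgeInd
        rw [if_neg fun h' => h (edgeInd_ne H h')]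
      have hone : (1 : ℝ) ≤ (if y = x then 1 else 0) + (if z = x then 1 else 0)
          + (if z = y then 1 else 0) := by
        split_ifs <;> first | (exfalso; omega) | norm_num
      rw [hE]
      linarith [hdp.2]
  have h4 : ∑ x : Fin n, ∑ y : Fin n, ∑ z : Fin n, (if x ≠ y ∧ x ≠ z ∧ y ≠ z then
      w {x, y, z} * ∏ a ∈ ({x, y, z} : Finset (Fin n)), u a else 0) ≤ _ :=
    Finset.sum_le_sum fun x _ => Finset.sum_le_sum fun y _ => Finset.sum_le_sum fun z _ => h3 x y z
  rw [h2, sum_triple_eq_expect, Fintype.card_fin] at h4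
  have h5 : 𝔼 x : Fin n, 𝔼 y : Fin n, 𝔼 z : Fin n, (u x * u y * u z) = (𝔼 x, u x) ^ 3 := by
    simp only [← Finset.mul_expect, ← Finset.expect_mul]
    ring
  simp only [Finset.expect_add_distrib, Finset.expect_sub_distrib, Fintype.expect_const,
    Fintype.expect_ite_eq', Fintype.card_fin, NNRat.smul_def] at h4
  have h6 : 𝔼 x : Fin n, 𝔼 y : Fin n, 𝔼 z : Fin n, d * (u x * u y * u z) = d * (𝔼 x, u x) ^ 3 := by
    rw [← h5]
    simp only [← Finset.mul_expect]
  rw [h6] at h4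
  push_cast at h4
  have h7 : (n : ℝ) ^ 3 * (-(6 * η)) ≤ (n : ℝ) ^ 3 *
    (𝔼 x, 𝔼 y, 𝔼 z, edgeInd H x y z * (u x * u y * u z) - d * (𝔼 x, u x) ^ 3
      + 3 / n) := by
    refine le_trans ?_ (h4.trans (le_of_eq ?_))
    · linarith
    · congr 1
      ring
  have h8 := le_of_mul_le_mul_left h7 (by positivity)
  linarith

end WeightedDensity

section Marginals
set_option linter.unusedSectionVars false
variable {ι : Type} [Fintype ι] [DecidableEq ι] {X : ι → Type} [∀ i, Fintype (X i)]
  [∀ i, Nonempty (X i)]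

lemma expect_coord (i : ι) (G : X i → ℝ) : 𝔼 w : ∀ i, X i, G (w i) = 𝔼 x, G x := by
  rw [← expect_update i]
  simp only [Function.update_self]
  exact Fintype.expect_const _

lemma expect_coord₂ {i j : ι} (hij : i ≠ j) (G : X i → X j → ℝ) :
    𝔼 w : ∀ i, X i, G (w i) (w j) = 𝔼 x, 𝔼 y, G x y := by
  rw [← expect_update j]
  simp only [Function.update_self, Function.update_of_ne hij]
  exact expect_coord i fun x => 𝔼 y, G x y

lemma expect_coord₃ {i j k : ι} (hij : i ≠ j) (hik : i ≠ k) (hjk : j ≠ k)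
    (G : X i → X j → X k → ℝ) :
    𝔼 w : ∀ i, X i, G (w i) (w j) (w k) = 𝔼 x, 𝔼 y, 𝔼 z, G x y z := by
  rw [← expect_update k]
  simp only [Function.update_self, Function.update_of_ne hik, Function.update_of_ne hjk]
  exact expect_coord₂ hij fun x y => 𝔼 z, G x y z

end Marginals

section Cells

lemma exists_extension {V : Type} {p : V → Prop} (g : {x // p x} → ℝ) (hg : ∀ x, g x ∈ Set.Icc (0 : ℝ) 1) :
    ∃ G : V → ℝ, (∀ x, G x ∈ Set.Icc (0 : ℝ) 1) ∧ ∀ x, g x = G x := by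
  refine ⟨fun x => if h : p x then g ⟨x, h⟩ else 0, fun x => ?_, fun x => ?_⟩
  · dsimp only
    split_ifs
    · exact hg _
    · simp
  · simp [x.2]

lemma exists_extension₂ {V : Type} {p q : V → Prop} (g : {x // p x} → {x // q x} → ℝ)
    (hg : ∀ x y, g x y ∈ Set.Icc (0 : ℝ) 1) :
    ∃ G : V → V → ℝ, (∀ x y, G x y ∈ Set.Icc (0 : ℝ) 1) ∧ ∀ x y, g x y = G x y := by
  refine ⟨fun x y => if h : p x ∧ q y then g ⟨x, h.1⟩ ⟨y, h.2⟩ else 0, fun x y => ?_, fun x y => ?_⟩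
  · dsimp only
    split_ifs
    · exact hg _ _
    · simp
  · simp [x.2, y.2]

variable {V : Type} [Fintype V]

lemma expect_cell {T : Type} [DecidableEq T] (A : V → T) (a : T) (g : V → ℝ) :
    𝔼 x : {x // A x = a}, g x = (𝔼 x, ind A a x * g x) / mass A a := by
  rcases isEmpty_or_nonempty V with hV | hV
  · have : IsEmpty {x // A x = a} := ⟨fun x => hV.elim x.1⟩
    simp
  have hn : (Fintype.card V : ℝ) ≠ 0 := by exact_mod_cast Fintype.card_ne_zero
  have h1 : ∀ g : V → ℝ, 𝔼 x, ind A a x * g x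
      = (∑ x : {x // A x = a}, g x) / Fintype.card V := by
    intro g
    rw [Fintype.expect_eq_sum_div_card]
    congr 1
    simp only [ind, ite_mul, one_mul, zero_mul]
    rw [← Finset.sum_filter, ← Finset.sum_subtype_eq_sum_filter]
    simp
  have h2 : mass A a = (Fintype.card {x // A x = a} : ℝ) / Fintype.card V := by
    have := h1 fun _ => 1
    simpa [mass] using this
  rw [h1, h2, Fintype.expect_eq_sum_div_card]
  field_simp

lemma expect_cell₂ {T : Type} [DecidableEq T] (A : V → T) (a b : T) (g : V → V → ℝ) :
    𝔼 x : {x // A x = a}, 𝔼 y : {y // A y = b}, g x y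
      = (𝔼 x, 𝔼 y, ind A a x * ind A b y * g x y) / (mass A a * mass A b) := by
  simp only [fun x => expect_cell A b (g x)]
  rw [expect_cell A a fun x => (𝔼 y, ind A b y * g x y) / mass A b]
  rw [mul_comm (mass A a), ← div_div]
  congr 1
  rw [Finset.expect_div]
  refine Finset.expect_congr rfl fun x _ => ?_
  rw [mul_div_assoc', Finset.mul_expect]
  congr 1
  exact Finset.expect_congr rfl fun y _ => by ring

lemma expect_cell₃ {T : Type} [DecidableEq T] (A : V → T) (a b c : T) (g : V → V → V → ℝ) :
    𝔼 x : {x // A x = a}, 𝔼 y : {y // A y = b}, 𝔼 z : {z // A z = c}, g x y z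
      = (𝔼 x, 𝔼 y, 𝔼 z, ind A a x * ind A b y * ind A c z * g x y z)
        / (mass A a * mass A b * mass A c) := by
  simp only [fun x => expect_cell₂ A b c (g x)]
  rw [expect_cell A a fun x => (𝔼 y, 𝔼 z, ind A b y * ind A c z * g x y z) / (mass A b * mass A c)]
  rw [mul_assoc (mass A a), mul_comm (mass A a), ← div_div]
  congr 1
  rw [Finset.expect_div]
  refine Finset.expect_congr rfl fun x _ => ?_
  rw [mul_div_assoc', Finset.mul_expect]
  congr 1
  refine Finset.expect_congr rfl fun y _ => ?_
  rw [Finset.mul_expect]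
  exact Finset.expect_congr rfl fun z _ => by ring

lemma card_cell {T : Type} [DecidableEq T] [Nonempty V] (A : V → T) (a : T) :
    (Fintype.card {x // A x = a} : ℝ) = mass A a * Fintype.card V := by
  have h : mass A a = (∑ x, ind A a x) / Fintype.card V := Fintype.expect_eq_sum_div_card _
  have h2 : (∑ x, ind A a x) = (Fintype.card {x // A x = a} : ℝ) := by
    rw [Fintype.card_subtype, ← Finset.sum_boole]
    exact Finset.sum_congr rfl fun x _ => by unfold ind; congr
  rw [h, h2]
  field_simp

lemma pairReg_cell [Nonempty V] {τ : ℝ} {K t : ℕ} {c : V → V → Fin K} {A : V → Fin t}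
    {p : Fin t → Fin t → Fin K → ℝ} {a b : Fin t} (ha : 0 < mass A a) (hb : 0 < mass A b)
    (h : PairReg τ c A p a b) (α : Fin K) (g₁ : {x // A x = a} → ℝ) (g₂ : {x // A x = b} → ℝ)
    (hg₁ : ∀ x, g₁ x ∈ Set.Icc (0 : ℝ) 1) (hg₂ : ∀ x, g₂ x ∈ Set.Icc (0 : ℝ) 1) :
    |𝔼 x : {x // A x = a}, 𝔼 y : {x // A x = b},
      ((if c x y = α then 1 else 0) - p a b α) * (g₁ x * g₂ y)| ≤ τ := by
  obtain ⟨G₁, hG₁, e₁⟩ := exists_extension g₁ hg₁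
  obtain ⟨G₂, hG₂, e₂⟩ := exists_extension g₂ hg₂
  simp only [e₁, e₂]
  rw [expect_cell₂ A a b fun x y => ((if c x y = α then 1 else 0) - p a b α) * (G₁ x * G₂ y),
    abs_div, abs_of_pos (mul_pos ha hb), div_le_iff₀ (mul_pos ha hb)]
  refine (le_of_eq (congrArg abs ?_)).trans (h α G₁ G₂ hG₁ hG₂)
  exact Finset.expect_congr rfl fun x _ => Finset.expect_congr rfl fun y _ => by ring

lemma unif_cell [Nonempty V] {δ m : ℝ} {D : V × V × V → ℝ} (hD : Unif δ D) {T : Type} [DecidableEq T] {A : V → T} {a b c : T}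
    (hm : 0 < m) (ha : m ≤ mass A a) (hb : m ≤ mass A b) (hc : m ≤ mass A c)
    (g₁ : {x // A x = a} → {x // A x = b} → ℝ) (g₂ : {x // A x = a} → {x // A x = c} → ℝ)
    (g₃ : {x // A x = b} → {x // A x = c} → ℝ) (hg₁ : ∀ x y, g₁ x y ∈ Set.Icc (0 : ℝ) 1)
    (hg₂ : ∀ x y, g₂ x y ∈ Set.Icc (0 : ℝ) 1) (hg₃ : ∀ x y, g₃ x y ∈ Set.Icc (0 : ℝ) 1) :
    |𝔼 x : {x // A x = a}, 𝔼 y : {x // A x = b}, 𝔼 z : {x // A x = c},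
      D (x, y, z) * (g₁ x y * g₂ x z * g₃ y z)| ≤ δ / m ^ 3 := by
  obtain ⟨G₁, hG₁, e₁⟩ := exists_extension₂ g₁ hg₁
  obtain ⟨G₂, hG₂, e₂⟩ := exists_extension₂ g₂ hg₂
  obtain ⟨G₃, hG₃, e₃⟩ := exists_extension₂ g₃ hg₃
  simp only [e₁, e₂, e₃]
  have hpos : 0 < mass A a * mass A b * mass A c :=
    mul_pos (mul_pos (hm.trans_le ha) (hm.trans_le hb)) (hm.trans_le hc)
  have hle : m ^ 3 ≤ mass A a * mass A b * mass A c := by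
    calc m ^ 3 = m * m * m := by ring
      _ ≤ _ := mul_le_mul (mul_le_mul ha hb hm.le (hm.trans_le ha).le) hc hm.le
        (mul_pos (hm.trans_le ha) (hm.trans_le hb)).le
  have key := hD (fun x y => ind A a x * ind A b y * G₁ x y) (fun x z => ind A c z * G₂ x z) G₃
    (fun x y => mul_mem_Icc (mul_mem_Icc (ind_mem_Icc _ _ _) (ind_mem_Icc _ _ _)) (hG₁ x y))
    (fun x y => mul_mem_Icc (ind_mem_Icc _ _ _) (hG₂ x y)) hG₃
  have hδ : 0 ≤ δ := (abs_nonneg _).trans key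
  rw [expect_cell₃ A a b c fun x y z => D (x, y, z) * (G₁ x y * G₂ x z * G₃ y z), abs_div,
    abs_of_pos hpos]
  refine div_le_div₀ hδ ?_ (by positivity) hle
  rw [expect_triple] at key
  refine (le_of_eq (congrArg abs ?_)).trans key
  exact Finset.expect_congr rfl fun x _ => Finset.expect_congr rfl fun y _ =>
    Finset.expect_congr rfl fun z _ => by ring

end Cells

section TripleLemma
set_option linter.unusedSectionVars false

variable {X Y Z κ : Type} [Fintype X] [Nonempty X] [Fintype Y] [Nonempty Y] [Fintype Z] [Nonempty Z]
  [Fintype κ] [DecidableEq κ]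

lemma sum_colours (c₁ : X → Y → κ) (c₂ : X → Z → κ) (c₃ : Y → Z → κ)
    (G : X → Y → Z → κ → κ → κ → ℝ) :
    ∑ α, ∑ γ, ∑ β, 𝔼 x, 𝔼 y, 𝔼 z, (if c₁ x y = α then 1 else 0) * (if c₂ x z = β then 1 else 0)
        * (if c₃ y z = γ then 1 else 0) * G x y z α β γ
      = 𝔼 x, 𝔼 y, 𝔼 z, G x y z (c₁ x y) (c₂ x z) (c₃ y z) := by
  simp only [← Finset.expect_sum_comm]
  refine Finset.expect_congr rfl fun x _ => Finset.expect_congr rfl fun y _ =>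
    Finset.expect_congr rfl fun z _ => ?_
  simp

lemma abs_triangle_density_sub_le {c₁ : X → Y → κ} {c₂ : X → Z → κ} {c₃ : Y → Z → κ}
    {α β γ : κ} {q₁ q₂ q₃ τ : ℝ} (hq₁ : q₁ ∈ Set.Icc (0 : ℝ) 1) (hq₂ : q₂ ∈ Set.Icc (0 : ℝ) 1)
    (h₁ : ∀ (g₁ : X → ℝ) (g₂ : Y → ℝ), (∀ x, g₁ x ∈ Set.Icc (0 : ℝ) 1) →
      (∀ y, g₂ y ∈ Set.Icc (0 : ℝ) 1) →
      |𝔼 x, 𝔼 y, ((if c₁ x y = α then 1 else 0) - q₁) * (g₁ x * g₂ y)| ≤ τ)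
    (h₂ : ∀ (g₁ : X → ℝ) (g₂ : Z → ℝ), (∀ x, g₁ x ∈ Set.Icc (0 : ℝ) 1) →
      (∀ y, g₂ y ∈ Set.Icc (0 : ℝ) 1) →
      |𝔼 x, 𝔼 z, ((if c₂ x z = β then 1 else 0) - q₂) * (g₁ x * g₂ z)| ≤ τ)
    (h₃ : ∀ (g₁ : Y → ℝ) (g₂ : Z → ℝ), (∀ x, g₁ x ∈ Set.Icc (0 : ℝ) 1) →
      (∀ y, g₂ y ∈ Set.Icc (0 : ℝ) 1) →
      |𝔼 y, 𝔼 z, ((if c₃ y z = γ then 1 else 0) - q₃) * (g₁ y * g₂ z)| ≤ τ) :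
    |(𝔼 x, 𝔼 y, 𝔼 z, (if c₁ x y = α then (1 : ℝ) else 0) * (if c₂ x z = β then 1 else 0)
        * (if c₃ y z = γ then 1 else 0)) - q₁ * q₂ * q₃| ≤ 3 * τ := by
  have hite : ∀ (p : Prop) [Decidable p], (if p then (1 : ℝ) else 0) ∈ Set.Icc (0 : ℝ) 1 := by
    intro p _; split_ifs <;> simp
  have e : (𝔼 x, 𝔼 y, 𝔼 z, (if c₁ x y = α then (1 : ℝ) else 0) * (if c₂ x z = β then 1 else 0)
        * (if c₃ y z = γ then 1 else 0)) - q₁ * q₂ * q₃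
      = (𝔼 z, 𝔼 x, 𝔼 y, ((if c₁ x y = α then 1 else 0) - q₁) *
          ((if c₂ x z = β then 1 else 0) * (if c₃ y z = γ then 1 else 0)))
        + (𝔼 y, 𝔼 x, 𝔼 z, ((if c₂ x z = β then 1 else 0) - q₂) *
          (q₁ * (if c₃ y z = γ then 1 else 0)))
        + (𝔼 _x : X, 𝔼 y, 𝔼 z, ((if c₃ y z = γ then 1 else 0) - q₃) * (q₁ * q₂)) := by
    have s₁ : (𝔼 z, 𝔼 x, 𝔼 y, ((if c₁ x y = α then 1 else 0) - q₁) *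
          ((if c₂ x z = β then 1 else 0) * (if c₃ y z = γ then 1 else 0)))
        = 𝔼 x, 𝔼 y, 𝔼 z, ((if c₁ x y = α then 1 else 0) - q₁) *
          ((if c₂ x z = β then 1 else 0) * (if c₃ y z = γ then 1 else 0)) := by
      rw [Finset.expect_comm]
      exact Finset.expect_congr rfl fun x _ => Finset.expect_comm _ _ _
    rw [s₁, Finset.expect_comm (s := (Finset.univ : Finset Y)) (t := (Finset.univ : Finset X))]
    simp only [← Finset.expect_add_distrib]
    have s₂ : q₁ * q₂ * q₃ = 𝔼 _x : X, 𝔼 _y : Y, 𝔼 _z : Z, q₁ * q₂ * q₃ := by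
      simp only [Fintype.expect_const]
    rw [s₂]
    simp only [← Finset.expect_sub_distrib]
    refine Finset.expect_congr rfl fun x _ => Finset.expect_congr rfl fun y _ =>
      Finset.expect_congr rfl fun z _ => ?_
    ring
  rw [e]
  have b₁ := abs_expect_le_of_forall (f := fun z => 𝔼 x, 𝔼 y, ((if c₁ x y = α then 1 else 0) - q₁) *
      ((if c₂ x z = β then 1 else 0) * (if c₃ y z = γ then 1 else 0))) (τ := τ)
    (fun z => h₁ _ _ (fun _ => hite _) fun _ => hite _)
  have b₂ := abs_expect_le_of_forall (f := fun y => 𝔼 x, 𝔼 z, ((if c₂ x z = β then 1 else 0) - q₂) *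
      (q₁ * (if c₃ y z = γ then 1 else 0))) (τ := τ)
    (fun y => h₂ (fun _ => q₁) _ (fun _ => hq₁) fun _ => hite _)
  have b₃ := abs_expect_le_of_forall (f := fun _ : X => 𝔼 y, 𝔼 z,
      ((if c₃ y z = γ then 1 else 0) - q₃) * (q₁ * q₂)) (τ := τ)
    (fun _ => h₃ (fun _ => q₁) (fun _ => q₂) (fun _ => hq₁) fun _ => hq₂)
  exact (abs_add_three _ _ _).trans (by linarith)

/-- A triple of cells in which `F ∘ c` has large density contains, in the reduced sense, many
colour triples for which `f` is bounded below on most of the corresponding triangles. -/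
lemma sum_good_colours_ge {c₁ : X → Y → κ} {c₂ : X → Z → κ} {c₃ : Y → Z → κ}
    {p₁ p₂ p₃ : κ → ℝ} (hp₁ : ∀ α, 0 ≤ p₁ α) (hp₂ : ∀ α, 0 ≤ p₂ α) (hp₃ : ∀ α, 0 ≤ p₃ α)
    (hs₁ : ∑ α, p₁ α ≤ 1) (hs₂ : ∑ α, p₂ α ≤ 1) (hs₃ : ∑ α, p₃ α ≤ 1) {τ : ℝ}
    (h₁ : ∀ α, ∀ (g₁ : X → ℝ) (g₂ : Y → ℝ), (∀ x, g₁ x ∈ Set.Icc (0 : ℝ) 1) →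
      (∀ y, g₂ y ∈ Set.Icc (0 : ℝ) 1) →
      |𝔼 x, 𝔼 y, ((if c₁ x y = α then 1 else 0) - p₁ α) * (g₁ x * g₂ y)| ≤ τ)
    (h₂ : ∀ α, ∀ (g₁ : X → ℝ) (g₂ : Z → ℝ), (∀ x, g₁ x ∈ Set.Icc (0 : ℝ) 1) →
      (∀ y, g₂ y ∈ Set.Icc (0 : ℝ) 1) →
      |𝔼 x, 𝔼 z, ((if c₂ x z = α then 1 else 0) - p₂ α) * (g₁ x * g₂ z)| ≤ τ)
    (h₃ : ∀ α, ∀ (g₁ : Y → ℝ) (g₂ : Z → ℝ), (∀ x, g₁ x ∈ Set.Icc (0 : ℝ) 1) →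
      (∀ y, g₂ y ∈ Set.Icc (0 : ℝ) 1) →
      |𝔼 y, 𝔼 z, ((if c₃ y z = α then 1 else 0) - p₃ α) * (g₁ y * g₂ z)| ≤ τ)
    {F : κ → κ → κ → ℝ} (hF : ∀ α β γ, F α β γ ∈ Set.Icc (0 : ℝ) 1) {f : X → Y → Z → ℝ} {ε D : ℝ}
    (hf : 𝔼 x, 𝔼 y, 𝔼 z, |f x y z - F (c₁ x y) (c₂ x z) (c₃ y z)| ≤ ε)
    (hD : D ≤ 𝔼 x, 𝔼 y, 𝔼 z, F (c₁ x y) (c₂ x z) (c₃ y z))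
    {θ ζ p₀ : ℝ} (hθ : 0 < θ) (hζ : 0 < ζ) (hp₀ : 0 < p₀) :
    D - 3 * (Fintype.card κ : ℝ) ^ 3 * τ - 2 * θ - 3 * Fintype.card κ * p₀ - ε / (ζ * θ)
      ≤ ∑ α, p₁ α * ∑ γ, p₃ γ * ∑ β, if (2 * θ ≤ F α β γ ∧ p₀ ≤ p₁ α ∧ p₀ ≤ p₂ β ∧ p₀ ≤ p₃ γ ∧
          𝔼 x, 𝔼 y, 𝔼 z, (if c₁ x y = α then (1 : ℝ) else 0) * (if c₂ x z = β then 1 else 0)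
            * (if c₃ y z = γ then 1 else 0) * (if f x y z < θ then 1 else 0)
            ≤ ζ * (p₁ α * p₂ β * p₃ γ)) then p₂ β else 0 := by
  have le1 : ∀ {p : κ → ℝ}, (∀ α, 0 ≤ p α) → ∑ α, p α ≤ 1 → ∀ α, p α ∈ Set.Icc (0 : ℝ) 1 :=
    fun hp hs α => ⟨hp α, (Finset.single_le_sum (fun a _ => hp a) (Finset.mem_univ α)).trans hs⟩
  have hite : ∀ (p : Prop) [Decidable p], 0 ≤ (if p then (1 : ℝ) else 0) := by
    intro p _; split_ifs <;> simp
  set t : κ → κ → κ → ℝ := fun α β γ => 𝔼 x, 𝔼 y, 𝔼 z,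
    (if c₁ x y = α then (1 : ℝ) else 0) * (if c₂ x z = β then 1 else 0)
      * (if c₃ y z = γ then 1 else 0) with ht
  set e : κ → κ → κ → ℝ := fun α β γ => 𝔼 x, 𝔼 y, 𝔼 z,
    (if c₁ x y = α then (1 : ℝ) else 0) * (if c₂ x z = β then 1 else 0)
      * (if c₃ y z = γ then 1 else 0) * |f x y z - F α β γ| with he
  set b : κ → κ → κ → ℝ := fun α β γ => 𝔼 x, 𝔼 y, 𝔼 z,
    (if c₁ x y = α then (1 : ℝ) else 0) * (if c₂ x z = β then 1 else 0)
      * (if c₃ y z = γ then 1 else 0) * (if f x y z < θ then 1 else 0) with hb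
  have he0 : ∀ α β γ, 0 ≤ e α β γ := fun α β γ => Finset.expect_nonneg fun x _ =>
    Finset.expect_nonneg fun y _ => Finset.expect_nonneg fun z _ =>
      mul_nonneg (mul_nonneg (mul_nonneg (hite _) (hite _)) (hite _)) (abs_nonneg _)
  have hbe : ∀ α β γ, 2 * θ ≤ F α β γ → b α β γ * θ ≤ e α β γ := by
    intro α β γ h
    simp only [hb, he, Finset.expect_mul]
    refine Finset.expect_le_expect fun x _ => Finset.expect_le_expect fun y _ =>
      Finset.expect_le_expect fun z _ => ?_
    rw [mul_assoc]
    refine mul_le_mul_of_nonneg_left ?_ (mul_nonneg (mul_nonneg (hite _) (hite _)) (hite _))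
    split_ifs with h'
    · rw [abs_sub_comm, one_mul]
      exact le_trans (by linarith) (le_abs_self _)
    · simp
  have htq : ∀ α β γ, |t α β γ - p₁ α * p₂ β * p₃ γ| ≤ 3 * τ := fun α β γ =>
    abs_triangle_density_sub_le (le1 hp₁ hs₁ α) (le1 hp₂ hs₂ β) (h₁ α) (h₂ β) (h₃ γ)
  have point : ∀ α γ β, F α β γ * t α β γ - 3 * τ - 2 * θ * (p₁ α * p₂ β * p₃ γ)
      - ((if p₁ α < p₀ then 1 else 0) + (if p₂ β < p₀ then 1 else 0)
        + (if p₃ γ < p₀ then 1 else 0)) * (p₁ α * p₂ β * p₃ γ) - e α β γ / (ζ * θ)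
      ≤ p₁ α * (p₃ γ * if (2 * θ ≤ F α β γ ∧ p₀ ≤ p₁ α ∧ p₀ ≤ p₂ β ∧ p₀ ≤ p₃ γ ∧
          b α β γ ≤ ζ * (p₁ α * p₂ β * p₃ γ)) then p₂ β else 0) := by
    intro α γ β
    have hq : 0 ≤ p₁ α * p₂ β * p₃ γ := mul_nonneg (mul_nonneg (hp₁ _) (hp₂ _)) (hp₃ _)
    have hFt : F α β γ * t α β γ ≤ F α β γ * (p₁ α * p₂ β * p₃ γ) + 3 * τ := by
      have h3 := (abs_le.1 (htq α β γ)).2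
      have h4 := (abs_nonneg _).trans (htq α β γ)
      have := mul_le_mul_of_nonneg_left h3 (hF α β γ).1
      have := mul_le_mul_of_nonneg_right (hF α β γ).2 h4
      linarith
    have hF1 := mul_le_mul_of_nonneg_right (hF α β γ).2 hq
    have hE : 0 ≤ e α β γ / (ζ * θ) := div_nonneg (he0 _ _ _) (mul_pos hζ hθ).le
    have hi₁ := mul_nonneg (hite (p₁ α < p₀)) hq
    have hi₂ := mul_nonneg (hite (p₂ β < p₀)) hq
    have hi₃ := mul_nonneg (hite (p₃ γ < p₀)) hq
    have hθq := mul_nonneg hθ.le hq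
    by_cases hS : (2 * θ ≤ F α β γ ∧ p₀ ≤ p₁ α ∧ p₀ ≤ p₂ β ∧ p₀ ≤ p₃ γ ∧
          b α β γ ≤ ζ * (p₁ α * p₂ β * p₃ γ))
    · rw [if_pos hS]
      nlinarith
    rw [if_neg hS, mul_zero, mul_zero]
    by_cases k₀ : 2 * θ ≤ F α β γ
    swap
    · have := mul_le_mul_of_nonneg_right (not_le.1 k₀).le hq
      nlinarith
    by_cases k₁ : p₀ ≤ p₁ α
    swap
    · rw [if_pos (not_le.1 k₁)] at *
      nlinarith
    by_cases k₂ : p₀ ≤ p₂ β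
    swap
    · rw [if_pos (not_le.1 k₂)] at *
      nlinarith
    by_cases k₃ : p₀ ≤ p₃ γ
    swap
    · rw [if_pos (not_le.1 k₃)] at *
      nlinarith
    have k₄ : ζ * (p₁ α * p₂ β * p₃ γ) < b α β γ := by
      by_contra h
      exact hS ⟨k₀, k₁, k₂, k₃, not_lt.1 h⟩
    have k₅ : p₁ α * p₂ β * p₃ γ ≤ e α β γ / (ζ * θ) := by
      rw [le_div_iff₀ (mul_pos hζ hθ)]
      have := hbe α β γ k₀
      have := mul_le_mul_of_nonneg_right k₄.le hθ.le
      linarith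
    nlinarith
  have hsum := Finset.sum_le_sum fun α (_ : α ∈ Finset.univ) =>
    Finset.sum_le_sum fun γ (_ : γ ∈ Finset.univ) =>
    Finset.sum_le_sum fun β (_ : β ∈ Finset.univ) => point α γ β
  simp only [Finset.sum_sub_distrib, ← Finset.mul_sum] at hsum
  have S₁ : ∑ α, ∑ γ, ∑ β, F α β γ * t α β γ
      = 𝔼 x, 𝔼 y, 𝔼 z, F (c₁ x y) (c₂ x z) (c₃ y z) := by
    rw [← sum_colours c₁ c₂ c₃ fun _ _ _ α β γ => F α β γ]
    refine Finset.sum_congr rfl fun α _ => Finset.sum_congr rfl fun γ _ =>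
      Finset.sum_congr rfl fun β _ => ?_
    simp only [ht, Finset.mul_expect]
    refine Finset.expect_congr rfl fun x _ => Finset.expect_congr rfl fun y _ =>
      Finset.expect_congr rfl fun z _ => ?_
    ring
  have S₂ : ∑ α, ∑ γ, ∑ β, e α β γ / (ζ * θ) ≤ ε / (ζ * θ) := by
    simp only [← Finset.sum_div]
    refine div_le_div_of_nonneg_right ?_ (mul_pos hζ hθ).le
    refine le_trans (le_of_eq ?_) hf
    exact sum_colours c₁ c₂ c₃ fun x y z α β γ => |f x y z - F α β γ|
  have S₃ : 3 * ∑ _α : κ, ∑ _γ : κ, ∑ _β : κ, τ = 3 * (Fintype.card κ : ℝ) ^ 3 * τ := by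
    simp; ring
  have fac : ∀ a b c : κ → ℝ, ∑ α, ∑ γ, ∑ β, a α * b β * c γ
      = (∑ α, a α) * (∑ β, b β) * ∑ γ, c γ := by
    intro a b c
    simp only [← Finset.sum_mul, ← Finset.mul_sum]
  have small : ∀ p : κ → ℝ, (∀ α, 0 ≤ p α) →
      ∑ α, (if p α < p₀ then 1 else 0) * p α ≤ Fintype.card κ * p₀ := by
    intro p hp
    refine (Finset.sum_le_sum (g := fun _ => p₀) fun α _ => ?_).trans (by simp)
    split_ifs with h
    · linarith
    · simpa using hp₀.le
  have small0 : ∀ p : κ → ℝ, (∀ α, 0 ≤ p α) →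
      0 ≤ ∑ α, (if p α < p₀ then 1 else 0) * p α := fun p hp =>
    Finset.sum_nonneg fun α _ => mul_nonneg (hite _) (hp α)
  have pos : ∀ p : κ → ℝ, (∀ α, 0 ≤ p α) → 0 ≤ ∑ α, p α := fun p hp =>
    Finset.sum_nonneg fun α _ => hp α
  have m₃ : ∀ a b c k : ℝ, 0 ≤ a → 0 ≤ b → 0 ≤ c → a ≤ k → b ≤ 1 → c ≤ 1 → a * b * c ≤ k := by
    intro a b c k ha hb hc hk hb1 hc1
    have := mul_le_one₀ hb1 hc hc1
    have := mul_le_mul_of_nonneg_left this ha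
    linarith [mul_assoc a b c]
  have S₄ : ∑ α, ∑ γ, ∑ β, p₁ α * p₂ β * p₃ γ ≤ 1 := by
    rw [fac]
    exact m₃ _ _ _ _ (pos _ hp₁) (pos _ hp₂) (pos _ hp₃) hs₁ hs₂ hs₃
  have S₅ : ∑ α, ∑ γ, ∑ β, ((if p₁ α < p₀ then 1 else 0) + (if p₂ β < p₀ then 1 else 0)
        + (if p₃ γ < p₀ then 1 else 0)) * (p₁ α * p₂ β * p₃ γ) ≤ 3 * Fintype.card κ * p₀ := by
    have r : ∀ α γ β, ((if p₁ α < p₀ then 1 else 0) + (if p₂ β < p₀ then 1 else 0)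
        + (if p₃ γ < p₀ then 1 else 0)) * (p₁ α * p₂ β * p₃ γ)
        = (((if p₁ α < p₀ then 1 else 0) * p₁ α) * p₂ β * p₃ γ
          + p₁ α * ((if p₂ β < p₀ then 1 else 0) * p₂ β) * p₃ γ)
          + p₁ α * p₂ β * ((if p₃ γ < p₀ then (1 : ℝ) else 0) * p₃ γ) := by
      intros; ring
    simp only [r, Finset.sum_add_distrib]
    rw [fac (fun α => (if p₁ α < p₀ then 1 else 0) * p₁ α) p₂ p₃,
      fac p₁ (fun α => (if p₂ α < p₀ then 1 else 0) * p₂ α) p₃,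
      fac p₁ p₂ (fun α => (if p₃ α < p₀ then 1 else 0) * p₃ α)]
    have u₁ := m₃ _ _ _ _ (small0 _ hp₁) (pos _ hp₂) (pos _ hp₃) (small _ hp₁) hs₂ hs₃
    have u₂ := m₃ _ _ _ _ (small0 _ hp₂) (pos _ hp₁) (pos _ hp₃) (small _ hp₂) hs₁ hs₃
    have u₃ := m₃ _ _ _ _ (small0 _ hp₃) (pos _ hp₁) (pos _ hp₂) (small _ hp₃) hs₁ hs₂
    nlinarith
  have S₆ : 2 * θ * ∑ α, ∑ γ, ∑ β, p₁ α * p₂ β * p₃ γ ≤ 2 * θ := by nlinarith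
  rw [S₁, S₃] at hsum
  linarith

end TripleLemma

section Choice

variable {V : Type} [Fintype V] [Nonempty V]

lemma expect_cells_le {t : ℕ} (A : V → Fin t) {G : V → V → V → ℝ} (hG : ∀ x y z, 0 ≤ G x y z) :
    𝔼 x, 𝔼 y, 𝔼 z, (𝔼 u : {u // A u = A x}, 𝔼 v : {v // A v = A y}, 𝔼 w : {w // A w = A z},
      G u v w) ≤ 𝔼 x, 𝔼 y, 𝔼 z, G x y z := by
  simp only [expect_cell₃]
  set e : Fin t → Fin t → Fin t → ℝ := fun a b c =>
    𝔼 x, 𝔼 y, 𝔼 z, ind A a x * ind A b y * ind A c z * G x y z with he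
  have he0 : ∀ a b c, 0 ≤ e a b c := fun a b c => Finset.expect_nonneg fun x _ =>
    Finset.expect_nonneg fun y _ => Finset.expect_nonneg fun z _ =>
      mul_nonneg (mul_nonneg (mul_nonneg (ind_mem_Icc _ _ _).1 (ind_mem_Icc _ _ _).1)
        (ind_mem_Icc _ _ _).1) (hG _ _ _)
  have r : ∀ x y z, (𝔼 u, 𝔼 v, 𝔼 w, ind A (A x) u * ind A (A y) v * ind A (A z) w * G u v w)
      = e (A x) (A y) (A z) := fun _ _ _ => rfl
  simp only [r]
  have s₁ : ∀ x y, 𝔼 z, e (A x) (A y) (A z) / (mass A (A x) * mass A (A y) * mass A (A z))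
      = ∑ c, mass A c * (e (A x) (A y) c / (mass A (A x) * mass A (A y) * mass A c)) :=
    fun x y => (sum_mass_mul A fun c => e (A x) (A y) c / (mass A (A x) * mass A (A y) * mass A c)).symm
  simp only [s₁]
  have s₂ : ∀ x, 𝔼 y, ∑ c, mass A c * (e (A x) (A y) c / (mass A (A x) * mass A (A y) * mass A c))
      = ∑ b, mass A b * ∑ c, mass A c * (e (A x) b c / (mass A (A x) * mass A b * mass A c)) :=
    fun x => (sum_mass_mul A fun b => ∑ c, mass A c *
      (e (A x) b c / (mass A (A x) * mass A b * mass A c))).symm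
  simp only [s₂]
  rw [← sum_mass_mul A fun a => ∑ b, mass A b * ∑ c, mass A c *
      (e a b c / (mass A a * mass A b * mass A c))]
  have s₃ : 𝔼 x, 𝔼 y, 𝔼 z, G x y z = ∑ a, ∑ b, ∑ c, e a b c := by
    simp only [he, ← Finset.expect_sum_comm]
    refine Finset.expect_congr rfl fun x _ => Finset.expect_congr rfl fun y _ =>
      Finset.expect_congr rfl fun z _ => ?_
    simp only [← Finset.sum_mul, ← Finset.mul_sum]
    have h1 : ∀ x, ∑ a, ind A a x = 1 := fun x => by simpa using sum_ind A (fun _ => 1) x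
    simp [h1]
  rw [s₃]
  simp only [Finset.mul_sum]
  refine Finset.sum_le_sum fun a _ => Finset.sum_le_sum fun b _ => Finset.sum_le_sum fun c _ => ?_
  have : mass A a * (mass A b * (mass A c * (e a b c / (mass A a * mass A b * mass A c))))
      = (mass A a * mass A b * mass A c) * (e a b c / (mass A a * mass A b * mass A c)) := by ring
  rw [this]
  by_cases h : mass A a * mass A b * mass A c = 0
  · rw [h, zero_mul]; exact he0 _ _ _
  · rw [mul_div_cancel₀ _ h]

/-- Random representatives lie in large cells, pairwise regular, with small average error. -/
lemma exists_choice {t N : ℕ} (A : V → Fin t) (Q : Fin t → Fin t → Prop) {D : V → V → V → ℝ}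
    (hD : ∀ x y z, 0 ≤ D x y z) {τ ε ε' a₀ : ℝ}
    (hQ : 𝔼 x, 𝔼 y, (if Q (A x) (A y) then (0 : ℝ) else 1) ≤ τ)
    (hDε : 𝔼 x, 𝔼 y, 𝔼 z, D x y z ≤ ε) (ha₀ : 0 ≤ a₀) (hε' : 0 < ε') (hτ : 0 ≤ τ) (hε : 0 ≤ ε)
    (hlt : N * (t * a₀) + N ^ 2 * τ + N ^ 3 * (ε / ε') < 1) :
    ∃ x : ℕ → V, (∀ i < N, a₀ ≤ mass A (A (x i))) ∧
      (∀ i j, i < j → j < N → Q (A (x i)) (A (x j))) ∧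
      ∀ i j k, i < j → j < k → k < N → D (x i) (x j) (x k) ≤ ε' := by
  set b₁ : (Fin N → V) → Fin N → ℝ := fun w i => if a₀ ≤ mass A (A (w i)) then 0 else 1 with hb₁
  set b₂ : (Fin N → V) → Fin N → Fin N → ℝ := fun w i j =>
    if i < j then (if Q (A (w i)) (A (w j)) then 0 else 1) else 0 with hb₂
  set b₃ : (Fin N → V) → Fin N → Fin N → Fin N → ℝ := fun w i j k =>
    if i < j ∧ j < k then D (w i) (w j) (w k) / ε' else 0 with hb₃
  have p₁ : ∀ w i, 0 ≤ b₁ w i := by intro w i; simp only [hb₁]; split_ifs <;> simp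
  have p₂ : ∀ w i j, 0 ≤ b₂ w i j := by intro w i j; simp only [hb₂]; split_ifs <;> simp
  have p₃ : ∀ w i j k, 0 ≤ b₃ w i j k := by
    intro w i j k; simp only [hb₃]; split_ifs
    · exact div_nonneg (hD _ _ _) hε'.le
    · exact le_rfl
  have e₁ : ∀ i, 𝔼 w, b₁ w i ≤ t * a₀ := by
    intro i
    have := expect_coord (X := fun _ : Fin N => V) i
      (fun x => if a₀ ≤ mass A (A x) then (0 : ℝ) else 1)
    simp only [hb₁]
    rw [this, ← sum_mass_mul A fun a => if a₀ ≤ mass A a then (0 : ℝ) else 1]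
    refine (Finset.sum_le_sum (g := fun _ => a₀) fun a _ => ?_).trans (by simp)
    split_ifs with h
    · simpa using ha₀
    · linarith [not_le.1 h]
  have e₂ : ∀ i j, 𝔼 w, b₂ w i j ≤ τ := by
    intro i j
    by_cases h : i < j
    · simp only [hb₂, if_pos h]
      rw [expect_coord₂ (X := fun _ : Fin N => V) h.ne
        (fun x y => if Q (A x) (A y) then (0 : ℝ) else 1)]
      exact hQ
    · simp [hb₂, if_neg h, hτ]
  have e₃ : ∀ i j k, 𝔼 w, b₃ w i j k ≤ ε / ε' := by
    intro i j k
    by_cases h : i < j ∧ j < k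
    · simp only [hb₃, if_pos h, ← Finset.expect_div]
      rw [expect_coord₃ (X := fun _ : Fin N => V) h.1.ne (h.1.trans h.2).ne h.2.ne
        (fun x y z => D x y z)]
      exact div_le_div_of_nonneg_right hDε hε'.le
    · simp only [hb₃, if_neg h, Finset.expect_const_zero]
      exact div_nonneg hε hε'.le
  have total : 𝔼 w, (∑ i, b₁ w i + ∑ i, ∑ j, b₂ w i j + ∑ i, ∑ j, ∑ k, b₃ w i j k) < 1 := by
    refine lt_of_le_of_lt ?_ hlt
    simp only [Finset.expect_add_distrib, Finset.expect_sum_comm]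
    refine add_le_add (add_le_add ?_ ?_) ?_
    · refine (Finset.sum_le_sum fun i _ => e₁ i).trans (by simp)
    · refine (Finset.sum_le_sum fun i _ => Finset.sum_le_sum fun j _ => e₂ i j).trans ?_
      simp; apply le_of_eq; ring
    · refine (Finset.sum_le_sum fun i _ => Finset.sum_le_sum fun j _ =>
        Finset.sum_le_sum fun k _ => e₃ i j k).trans ?_
      simp; apply le_of_eq; ring
  obtain ⟨w, hw⟩ : ∃ w, ∑ i, b₁ w i + ∑ i, ∑ j, b₂ w i j + ∑ i, ∑ j, ∑ k, b₃ w i j k < 1 := by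
    by_contra h
    push Not at h
    exact not_lt.2 (Finset.le_expect Finset.univ_nonempty fun w _ => h w) total
  have q₁ : 0 ≤ ∑ i, b₁ w i := Finset.sum_nonneg fun i _ => p₁ w i
  have q₂ : 0 ≤ ∑ i, ∑ j, b₂ w i j := Finset.sum_nonneg fun i _ => Finset.sum_nonneg fun j _ => p₂ w i j
  have q₃ : 0 ≤ ∑ i, ∑ j, ∑ k, b₃ w i j k := Finset.sum_nonneg fun i _ =>
    Finset.sum_nonneg fun j _ => Finset.sum_nonneg fun k _ => p₃ w i j k
  refine ⟨fun n => if h : n < N then w ⟨n, h⟩ else Classical.arbitrary V, fun i hi => ?_,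
    fun i j hij hj => ?_, fun i j k hij hjk hk => ?_⟩
  · simp only [dif_pos hi]
    by_contra h
    have := Finset.single_le_sum (fun i _ => p₁ w i) (Finset.mem_univ (⟨i, hi⟩ : Fin N))
    have h' : b₁ w ⟨i, hi⟩ = 1 := if_neg h
    linarith
  · have hi := hij.trans hj
    simp only [dif_pos hi, dif_pos hj]
    by_contra h
    have s₁ := Finset.single_le_sum (fun j _ => p₂ w ⟨i, hi⟩ j) (Finset.mem_univ (⟨j, hj⟩ : Fin N))
    have s₂ := Finset.single_le_sum (f := fun i => ∑ j, b₂ w i j)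
      (fun i _ => Finset.sum_nonneg fun j _ => p₂ w i j) (Finset.mem_univ (⟨i, hi⟩ : Fin N))
    have h' : b₂ w ⟨i, hi⟩ ⟨j, hj⟩ = 1 := by
      simp only [hb₂, if_neg h]
      exact if_pos (Fin.mk_lt_mk.2 hij)
    linarith
  · have hj := hjk.trans hk
    have hi := hij.trans hj
    simp only [dif_pos hi, dif_pos hj, dif_pos hk]
    have s₁ := Finset.single_le_sum (fun k _ => p₃ w ⟨i, hi⟩ ⟨j, hj⟩ k)
      (Finset.mem_univ (⟨k, hk⟩ : Fin N))
    have s₂ := Finset.single_le_sum (f := fun j => ∑ k, b₃ w ⟨i, hi⟩ j k)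
      (fun j _ => Finset.sum_nonneg fun k _ => p₃ w _ j k) (Finset.mem_univ (⟨j, hj⟩ : Fin N))
    have s₃ := Finset.single_le_sum (f := fun i => ∑ j, ∑ k, b₃ w i j k)
      (fun i _ => Finset.sum_nonneg fun j _ => Finset.sum_nonneg fun k _ => p₃ w i j k)
      (Finset.mem_univ (⟨i, hi⟩ : Fin N))
    have h' : b₃ w ⟨i, hi⟩ ⟨j, hj⟩ ⟨k, hk⟩ = D (w ⟨i, hi⟩) (w ⟨j, hj⟩) (w ⟨k, hk⟩) / ε' :=
      if_pos ⟨Fin.mk_lt_mk.2 hij, Fin.mk_lt_mk.2 hjk⟩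
    have : D (w ⟨i, hi⟩) (w ⟨j, hj⟩) (w ⟨k, hk⟩) / ε' ≤ 1 := by linarith
    rwa [div_le_one hε'] at this

end Choice

section DenseTriple

variable {n : ℕ}

lemma edgeInd_swap₁₂ (H : H3 (Fin n)) (x y z : Fin n) : edgeInd H x y z = edgeInd H y x z := by
  unfold edgeInd
  rw [Finset.insert_comm]

lemma edgeInd_swap₂₃ (H : H3 (Fin n)) (x y z : Fin n) : edgeInd H x y z = edgeInd H x z y := by
  unfold edgeInd
  rw [Finset.pair_comm]

/-- Edge density between three cells. -/
noncomputable def cellEdgeDensity {T : Type} [DecidableEq T] (H : H3 (Fin n)) (A : Fin n → T)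
    (a b c : T) : ℝ :=
  𝔼 u : {u // A u = a}, 𝔼 v : {v // A v = b}, 𝔼 w : {w // A w = c},
    edgeInd H (u : Fin n) (v : Fin n) (w : Fin n)

lemma cellEdgeDensity_le_one {T : Type} [DecidableEq T] (H : H3 (Fin n)) (A : Fin n → T)
    (a b c : T) : cellEdgeDensity H A a b c ≤ 1 :=
  expect_le_one _ _ fun _ _ => expect_le_one _ _ fun _ _ => expect_le_one _ _ fun _ _ =>
    (edgeInd_mem_Icc _ _ _ _).2

lemma cellEdgeDensity_swap₁₂ {T : Type} [DecidableEq T] (H : H3 (Fin n)) (A : Fin n → T)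
    (a b c : T) : cellEdgeDensity H A a b c = cellEdgeDensity H A b a c := by
  unfold cellEdgeDensity
  rw [Finset.expect_comm]
  simp only [edgeInd_swap₁₂ H]

lemma cellEdgeDensity_swap₂₃ {T : Type} [DecidableEq T] (H : H3 (Fin n)) (A : Fin n → T)
    (a b c : T) : cellEdgeDensity H A a b c = cellEdgeDensity H A a c b := by
  unfold cellEdgeDensity
  refine Finset.expect_congr rfl fun u _ => ?_
  rw [Finset.expect_comm]
  refine Finset.expect_congr rfl fun v _ => Finset.expect_congr rfl fun w _ => ?_
  exact edgeInd_swap₂₃ _ _ _ _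

lemma exists_dense_triple [NeZero n] {H : H3 (Fin n)} {d η : ℝ} (hd0 : 0 < d) (hd1 : d ≤ 1)
    (hH : H.uniformlyDense d η) {T : Type} [DecidableEq T] (A : Fin n → T) (x : ℕ → T)
    {I : Finset ℕ} {a₀ : ℝ} (ha₀ : 0 < a₀) (hx : ∀ i ∈ I, a₀ ≤ mass A (x i))
    (hI : 24 / d ≤ I.card) (hη : (3 / n + 6 * η) * I.card < 9 * a₀ ^ 3) :
    ∃ i ∈ I, ∃ j ∈ I, ∃ k ∈ I, i < j ∧ j < k ∧ d / 2 ≤ cellEdgeDensity H A (x i) (x j) (x k) := by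
  by_contra! hcon
  have hdist : ∀ i ∈ I, ∀ j ∈ I, ∀ k ∈ I, i ≠ j → i ≠ k → j ≠ k →
      cellEdgeDensity H A (x i) (x j) (x k) < d / 2 := by
    intro i hi j hj k hk hij hik hjk
    rcases lt_or_gt_of_ne hij with h₁ | h₁ <;> rcases lt_or_gt_of_ne hjk with h₂ | h₂ <;>
      rcases lt_or_gt_of_ne hik with h₃ | h₃
    · exact hcon i hi j hj k hk h₁ h₂
    · omega
    · rw [cellEdgeDensity_swap₂₃]
      exact hcon i hi k hk j hj h₃ h₂
    · rw [cellEdgeDensity_swap₂₃, cellEdgeDensity_swap₁₂]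
      exact hcon k hk i hi j hj h₃ h₁
    · rw [cellEdgeDensity_swap₁₂]
      exact hcon j hj i hi k hk h₁ h₃
    · rw [cellEdgeDensity_swap₁₂, cellEdgeDensity_swap₂₃]
      exact hcon j hj k hk i hi h₂ h₃
    · omega
    · rw [cellEdgeDensity_swap₁₂, cellEdgeDensity_swap₂₃, cellEdgeDensity_swap₁₂]
      exact hcon k hk j hj i hi h₂ h₁
  set M : ℝ := (I.card : ℝ) with hM
  have hMpos : 0 < M := lt_of_lt_of_le (by positivity) hI
  set s : ℝ := a₀ / M with hs
  have hspos : 0 < s := div_pos ha₀ hMpos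
  have hmpos : ∀ i ∈ I, 0 < mass A (x i) := fun i hi => ha₀.trans_le (hx i hi)
  have hw := weighted_density hd0.le hd1 hH
    (fun v => ∑ i ∈ I, s / mass A (x i) * ind A (x i) v) (fun v => ⟨?_, ?_⟩)
  rotate_left
  · exact Finset.sum_nonneg fun i hi =>
      mul_nonneg (div_nonneg hspos.le (hmpos i hi).le) (ind_mem_Icc _ _ _).1
  · refine (Finset.sum_le_sum (g := fun _ => s / a₀) fun i hi => ?_).trans ?_
    · refine (mul_le_of_le_one_right (div_nonneg hspos.le (hmpos i hi).le)
        (ind_mem_Icc _ _ _).2).trans ?_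
      exact div_le_div_of_nonneg_left hspos.le ha₀ (hx i hi)
    · rw [Finset.sum_const, nsmul_eq_mul, ← hM, hs]
      apply le_of_eq
      field_simp
  have hmean : 𝔼 v, ∑ i ∈ I, s / mass A (x i) * ind A (x i) v = a₀ := by
    rw [Finset.expect_sum_comm]
    rw [Finset.sum_congr rfl (g := fun _ => s) fun i hi => ?_]
    · rw [Finset.sum_const, nsmul_eq_mul, ← hM, hs]
      field_simp
    · rw [← Finset.mul_expect]
      exact div_mul_cancel₀ _ (hmpos i hi).ne'
  have htriple : (𝔼 u, 𝔼 v, 𝔼 w, edgeInd H u v w * ((∑ i ∈ I, s / mass A (x i) * ind A (x i) u)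
        * (∑ i ∈ I, s / mass A (x i) * ind A (x i) v)
        * (∑ i ∈ I, s / mass A (x i) * ind A (x i) w)))
      = s ^ 3 * ∑ i ∈ I, ∑ j ∈ I, ∑ k ∈ I, cellEdgeDensity H A (x i) (x j) (x k) := by
    have e : ∀ u v w, edgeInd H u v w * ((∑ i ∈ I, s / mass A (x i) * ind A (x i) u)
        * (∑ i ∈ I, s / mass A (x i) * ind A (x i) v)
        * (∑ i ∈ I, s / mass A (x i) * ind A (x i) w))
        = ∑ i ∈ I, ∑ j ∈ I, ∑ k ∈ I, s ^ 3 * (ind A (x i) u * ind A (x j) v * ind A (x k) w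
          * edgeInd H u v w) / (mass A (x i) * mass A (x j) * mass A (x k)) := by
      intro u v w
      rw [Finset.sum_mul_sum, Finset.sum_mul, Finset.mul_sum]
      refine Finset.sum_congr rfl fun i hi => ?_
      rw [Finset.sum_mul, Finset.mul_sum]
      refine Finset.sum_congr rfl fun j hj => ?_
      rw [Finset.mul_sum, Finset.mul_sum]
      refine Finset.sum_congr rfl fun k hk => ?_
      have := (hmpos i hi).ne'
      have := (hmpos j hj).ne'
      have := (hmpos k hk).ne'
      field_simp
    simp only [e]
    simp only [Finset.expect_sum_comm, Finset.mul_sum]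
    refine Finset.sum_congr rfl fun i hi => Finset.sum_congr rfl fun j hj =>
      Finset.sum_congr rfl fun k hk => ?_
    unfold cellEdgeDensity
    rw [expect_cell₃ A (x i) (x j) (x k) (edgeInd H), mul_div_assoc']
    simp only [Finset.mul_expect, Finset.expect_div]
  rw [hmean, htriple] at hw
  have hsum : ∑ i ∈ I, ∑ j ∈ I, ∑ k ∈ I, cellEdgeDensity H A (x i) (x j) (x k)
      ≤ M ^ 3 * (d / 2) + 3 * M ^ 2 := by
    refine (Finset.sum_le_sum fun i hi => Finset.sum_le_sum fun j hj =>
      Finset.sum_le_sum (g := fun k => d / 2 + (if i = j then 1 else 0) + (if i = k then 1 else 0)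
        + (if j = k then 1 else 0)) fun k hk => ?_).trans ?_
    · have h1 := cellEdgeDensity_le_one H A (x i) (x j) (x k)
      by_cases hij : i = j
      · rw [if_pos hij]; split_ifs <;> linarith
      by_cases hik : i = k
      · rw [if_pos hik]; split_ifs <;> linarith
      by_cases hjk : j = k
      · rw [if_pos hjk]; split_ifs <;> linarith
      · rw [if_neg hij, if_neg hik, if_neg hjk]
        have := hdist i hi j hj k hk hij hik hjk
        linarith
    · simp only [Finset.sum_add_distrib, Finset.sum_const, nsmul_eq_mul, ← hM, Finset.sum_ite_eq,
        ← Finset.mul_sum]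
      have h1 : ∑ i ∈ I, (if i ∈ I then (1 : ℝ) else 0) = M := by
        rw [Finset.sum_congr rfl fun i hi => if_pos hi]
        simp [hM]
      rw [h1]
      apply le_of_eq
      ring
  have h5 := hw.trans (mul_le_mul_of_nonneg_left hsum (by positivity))
  have hsM : s * M = a₀ := by rw [hs]; field_simp
  have h6 : s ^ 3 * (M ^ 3 * (d / 2) + 3 * M ^ 2) * M = a₀ ^ 3 * (M * d / 2 + 3) := by
    rw [← hsM]; ring
  have h7 := mul_le_mul_of_nonneg_right h5 hMpos.le
  rw [h6] at h7
  have h8 : 24 ≤ M * d := (div_le_iff₀ hd0).1 hI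
  have ha3 : 0 < a₀ ^ 3 := by positivity
  nlinarith

end DenseTriple

section Embedding

lemma exists_sorted {α : Type} [LinearOrder α] {s : Finset α} (hs : s.card = 3) :
    ∃ i j k, i < j ∧ j < k ∧ s = {i, j, k} := by
  obtain ⟨x, y, z, hxy, hxz, hyz, rfl⟩ := Finset.card_eq_three.1 hs
  rcases lt_or_gt_of_ne hxy with h₁ | h₁ <;> rcases lt_or_gt_of_ne hyz with h₂ | h₂ <;>
    rcases lt_or_gt_of_ne hxz with h₃ | h₃
  · exact ⟨x, y, z, h₁, h₂, rfl⟩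
  · exact absurd (h₁.trans h₂) h₃.not_gt
  · exact ⟨x, z, y, h₃, h₂, by ext; simp; tauto⟩
  · exact ⟨z, x, y, h₃, h₁, by ext; simp; tauto⟩
  · exact ⟨y, x, z, h₁, h₃, by ext; simp; tauto⟩
  · exact ⟨y, z, x, h₂, h₃, by ext; simp; tauto⟩
  · exact absurd (h₂.trans h₁) h₃.not_gt
  · exact ⟨z, y, x, h₂, h₁, by ext; simp; tauto⟩

variable {W : Type} [DecidableEq W] {ℓ : ℕ}

/-- The edges of `F`, written as increasing triples of labels. -/
noncomputable def labelledEdges (F : H3 W) (σ : W ≃ Fin ℓ) : Finset (Fin ℓ × Fin ℓ × Fin ℓ) :=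
  Finset.univ.filter fun e => e.1 < e.2.1 ∧ e.2.1 < e.2.2 ∧
    {σ.symm e.1, σ.symm e.2.1, σ.symm e.2.2} ∈ F.edges

lemma mem_labelledEdges {F : H3 W} {σ : W ≃ Fin ℓ} {i j k : Fin ℓ} :
    (i, j, k) ∈ labelledEdges F σ ↔
      i < j ∧ j < k ∧ ({σ.symm i, σ.symm j, σ.symm k} : Finset W) ∈ F.edges := by
  simp [labelledEdges]

lemma hasMonoP3_of_lt {F : H3 W} {σ : W ≃ Fin ℓ} {v a b c : Fin ℓ} (hab : a < b) (hbc : b < c)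
    (h₁ : ({σ.symm a, σ.symm b, σ.symm v} : Finset W) ∈ F.edges)
    (h₂ : ({σ.symm b, σ.symm c, σ.symm v} : Finset W) ∈ F.edges) :
    hasMonoP3 F (σ.symm v) (fun x => ((σ x : Fin ℓ) : ℕ)) := by
  refine ⟨σ.symm a, σ.symm b, σ.symm c, h₁, h₂, ?_, Or.inl ?_⟩
  · exact fun h => (hab.trans hbc).ne (σ.symm.injective h)
  · simpa using ⟨hab, hbc⟩

/-- The colour assigned to a pair of labels by its role in the edges containing it. -/
noncomputable def roleColour {κ : Type} (E : Finset (Fin ℓ × Fin ℓ × Fin ℓ))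
    (R B G : Fin ℓ → Fin ℓ → κ) (i j : Fin ℓ) : Option κ :=
  if ∃ k, (i, j, k) ∈ E then some (R i j) else if ∃ m, (i, m, j) ∈ E then some (B i j)
    else if ∃ m, (m, i, j) ∈ E then some (G i j) else none

lemma roleColour_of_mem {F : H3 W} {σ : W ≃ Fin ℓ}
    (hσ : ∀ v, ¬ hasMonoP3 F v (fun x => ((σ x : Fin ℓ) : ℕ))) {κ : Type}
    (R B G : Fin ℓ → Fin ℓ → κ) {i j k : Fin ℓ} (h : (i, j, k) ∈ labelledEdges F σ) :
    roleColour (labelledEdges F σ) R B G i j = some (R i j) ∧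
      roleColour (labelledEdges F σ) R B G i k = some (B i k) ∧
      roleColour (labelledEdges F σ) R B G j k = some (G j k) := by
  have perm₁ : ∀ a b c : W, ({a, b, c} : Finset W) = {b, c, a} := by intros; ext; simp; tauto
  have perm₂ : ∀ a b c : W, ({a, b, c} : Finset W) = {a, c, b} := by intros; ext; simp; tauto
  obtain ⟨hij, hjk, he⟩ := mem_labelledEdges.1 h
  refine ⟨if_pos ⟨k, h⟩, ?_, ?_⟩
  · have h₁ : ¬ ∃ m, (i, k, m) ∈ labelledEdges F σ := by
      rintro ⟨m, hm⟩
      obtain ⟨_, hkm, hm⟩ := mem_labelledEdges.1 hm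
      exact hσ _ (hasMonoP3_of_lt hjk hkm (perm₁ _ _ _ ▸ he) (perm₁ _ _ _ ▸ hm))
    exact (if_neg h₁).trans (if_pos ⟨j, h⟩)
  · have h₁ : ¬ ∃ m, (j, k, m) ∈ labelledEdges F σ := by
      rintro ⟨m, hm⟩
      obtain ⟨_, hkm, hm⟩ := mem_labelledEdges.1 hm
      exact hσ _ (hasMonoP3_of_lt hij (hjk.trans hkm) he (perm₂ _ _ _ ▸ hm))
    have h₂ : ¬ ∃ m, (j, m, k) ∈ labelledEdges F σ := by
      rintro ⟨m, hm⟩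
      obtain ⟨hjm, _, hm⟩ := mem_labelledEdges.1 hm
      exact hσ _ (hasMonoP3_of_lt hij hjm he hm)
    exact (if_neg h₁).trans ((if_neg h₂).trans (if_pos ⟨i, h⟩))

lemma expect_eq_le {n : ℕ} [NeZero n] {T : Type} [DecidableEq T] (A : Fin n → T) {a b : T} {a₀ : ℝ}
    (ha₀ : 0 < a₀) (hb : a₀ ≤ mass A b) :
    𝔼 x : {x // A x = a}, 𝔼 y : {y // A y = b}, (if (x : Fin n) = y then (1 : ℝ) else 0)
      ≤ 1 / (a₀ * n) := by
  have hn : (0 : ℝ) < n := by exact_mod_cast Nat.pos_of_ne_zero (NeZero.ne n)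
  have key : ∀ x : {x // A x = a}, 𝔼 y : {y // A y = b}, (if (x : Fin n) = y then (1 : ℝ) else 0)
      ≤ 1 / (a₀ * n) := by
    intro x
    rw [Fintype.expect_eq_sum_div_card, card_cell, Fintype.card_fin]
    refine div_le_div₀ zero_le_one ?_ (mul_pos ha₀ hn) (mul_le_mul_of_nonneg_right hb hn.le)
    rw [Finset.sum_boole]
    have : (Finset.univ.filter fun y : {y // A y = b} => (x : Fin n) = y).card ≤ 1 := by
      refine Finset.card_le_one.2 fun u hu v hv => ?_
      simp only [Finset.mem_filter, Finset.mem_univ, true_and] at hu hv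
      exact Subtype.ext (hu.symm.trans hv)
    exact_mod_cast this
  rcases isEmpty_or_nonempty {x // A x = a} with h | h
  · simp only [Finset.univ_eq_empty, Finset.expect_empty]
    positivity
  · exact Finset.expect_le Finset.univ_nonempty fun x _ => key x

lemma tprod_le {n : ℕ} {F : H3 W} {σ : W ≃ Fin ℓ} {H : H3 (Fin n)} (hH : H.free F)
    {p : Fin ℓ → Fin n → Prop} (w : ∀ i, {x // p i x}) :
    tprod (X := fun i => {x // p i x}) (labelledEdges F σ)
      (fun _ _ _ x y z => edgeInd H (x : Fin n) (y : Fin n) (z : Fin n)) w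
      ≤ ∑ q ∈ ltPairs (Fin ℓ), if (w q.1 : Fin n) = w q.2 then (1 : ℝ) else 0 := by
  have hnn : 0 ≤ ∑ q ∈ ltPairs (Fin ℓ), if (w q.1 : Fin n) = w q.2 then (1 : ℝ) else 0 :=
    Finset.sum_nonneg fun q _ => by split_ifs <;> simp
  have hle1 : tprod (X := fun i => {x // p i x}) (labelledEdges F σ)
      (fun _ _ _ x y z => edgeInd H (x : Fin n) (y : Fin n) (z : Fin n)) w ≤ 1 :=
    Finset.prod_le_one (fun e _ => (edgeInd_mem_Icc _ _ _ _).1) fun e _ => (edgeInd_mem_Icc _ _ _ _).2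
  by_cases hinj : Function.Injective fun i => (w i : Fin n)
  · have : ∃ e ∈ F.edges, e.image (fun v => (w (σ v) : Fin n)) ∉ H.edges := by
      by_contra! hcon
      exact hH ⟨fun v => (w (σ v) : Fin n), hinj.comp σ.injective, hcon⟩
    obtain ⟨e, heF, heH⟩ := this
    have hc : (e.image σ).card = 3 := by
      rw [Finset.card_image_of_injective _ σ.injective, F.card3 e heF]
    obtain ⟨i, j, k, hij, hjk, hs⟩ := exists_sorted hc
    have he : e = {σ.symm i, σ.symm j, σ.symm k} := by
      have := congrArg (Finset.image σ.symm) hs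
      rw [Finset.image_image] at this
      simpa using this
    have hmem : (i, j, k) ∈ labelledEdges F σ := mem_labelledEdges.2 ⟨hij, hjk, he ▸ heF⟩
    have hz : tprod (X := fun i => {x // p i x}) (labelledEdges F σ)
        (fun _ _ _ x y z => edgeInd H (x : Fin n) (y : Fin n) (z : Fin n)) w = 0 := by
      refine Finset.prod_eq_zero hmem ?_
      refine if_neg fun h => heH ?_
      have hw : ∀ i, (w (σ (σ.symm i)) : Fin n) = w i := fun i =>
        congrArg (fun i => (w i : Fin n)) (σ.apply_symm_apply i)
      rw [he]
      simpa [hw] using h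
    rw [hz]
    exact hnn
  · simp only [Function.Injective, not_forall] at hinj
    obtain ⟨i, j, hij, hne⟩ := hinj
    refine hle1.trans ?_
    have : ∃ q ∈ ltPairs (Fin ℓ), (w q.1 : Fin n) = w q.2 := by
      rcases lt_or_gt_of_ne hne with h | h
      · exact ⟨(i, j), by simp [ltPairs, h], hij⟩
      · exact ⟨(j, i), by simp [ltPairs, h], hij.symm⟩
    obtain ⟨q, hq, hw⟩ := this
    have := Finset.single_le_sum
      (f := fun q : Fin ℓ × Fin ℓ => if (w q.1 : Fin n) = w q.2 then (1 : ℝ) else 0)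
      (fun q _ => by split_ifs <;> simp) hq
    simpa [hw] using this

lemma copies_bound {n t K : ℕ} [NeZero n] {F : H3 W} {σ : W ≃ Fin ℓ}
    (hσ : ∀ v, ¬ hasMonoP3 F v (fun x => ((σ x : Fin ℓ) : ℕ))) {H : H3 (Fin n)} (hH : H.free F)
    {A : Fin n → Fin t} {y : Fin ℓ → Fin t} {a₀ : ℝ} (ha₀ : 0 < a₀) (hy : ∀ i, a₀ ≤ mass A (y i))
    {c : Fin n → Fin n → Fin K} {p : Fin t → Fin t → Fin K → ℝ} {τ : ℝ}
    (hp0 : ∀ a b α, 0 ≤ p a b α) (hp1 : ∀ a b, ∑ α, p a b α ≤ 1)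
    (hreg : ∀ i j, i < j → PairReg τ c A p (y i) (y j)) (hτ : 0 ≤ τ)
    {f : Fin n × Fin n × Fin n → ℝ} (hf : ∀ ω, f ω ∈ Set.Icc (0 : ℝ) 1) {Φ : ℝ}
    (hΦ : Unif Φ fun ω => edgeInd H ω.1 ω.2.1 ω.2.2 - f ω) {R B G : Fin ℓ → Fin ℓ → Fin K}
    {p₀ θ ζ : ℝ} (hp₀ : 0 < p₀) (hp₀1 : p₀ ≤ 1) (hθ : 0 < θ) (hθ1 : θ ≤ 1)
    (hR : ∀ i j k, i < j → j < k → p₀ ≤ p (y i) (y j) (R i j) ∧ p₀ ≤ p (y i) (y k) (B i k) ∧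
      p₀ ≤ p (y j) (y k) (G j k) ∧
      𝔼 x : {x // A x = y i}, 𝔼 x' : {x // A x = y j}, 𝔼 x'' : {x // A x = y k},
        (if c x x' = R i j then (1 : ℝ) else 0) * (if c x x'' = B i k then 1 else 0)
          * (if c x' x'' = G j k then 1 else 0)
          * (if f ((x : Fin n), (x' : Fin n), (x'' : Fin n)) < θ then 1 else 0)
        ≤ ζ * (p (y i) (y j) (R i j) * p (y i) (y k) (B i k) * p (y j) (y k) (G j k)))
    (hζ : (ℓ : ℝ) ^ 3 * ζ ≤ 1 / 2) (hζ0 : 0 ≤ ζ)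
    (hτp : (1 + (ℓ : ℝ) ^ 3) * ((ℓ : ℝ) ^ 2 * τ) ≤ p₀ ^ ℓ ^ 2 / 4)
    (hΦc : (ℓ : ℝ) ^ 3 * (Φ / a₀ ^ 3) ≤ θ ^ ℓ ^ 3 * (p₀ ^ ℓ ^ 2 / 4) / 2) :
    θ ^ ℓ ^ 3 * (p₀ ^ ℓ ^ 2 / 4) / 2 ≤ (ℓ : ℝ) ^ 2 * (1 / (a₀ * n)) := by
  have hn : (0 : ℝ) < n := by exact_mod_cast Nat.pos_of_ne_zero (NeZero.ne n)
  have hmass : ∀ i, 0 < mass A (y i) := fun i => ha₀.trans_le (hy i)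
  have : ∀ i, Nonempty {x // A x = y i} := by
    intro i
    refine Fintype.card_pos_iff.1 ?_
    have h := card_cell A (y i)
    rw [Fintype.card_fin] at h
    have : (0 : ℝ) < (Fintype.card {x // A x = y i} : ℝ) := h ▸ mul_pos (hmass i) hn
    exact_mod_cast this
  set E := labelledEdges F σ with hE
  set χ := roleColour E R B G with hχ
  have hple : ∀ a b α, p a b α ≤ 1 := fun a b α =>
    (Finset.single_le_sum (fun α _ => hp0 a b α) (Finset.mem_univ α)).trans (hp1 a b)
  set P : ∀ i j : Fin ℓ, {x // A x = y i} → {x // A x = y j} → ℝ := fun i j x x' =>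
    (χ i j).elim 1 fun α => if c x x' = α then 1 else 0 with hP
  set q : Fin ℓ → Fin ℓ → ℝ := fun i j => (χ i j).elim 1 (p (y i) (y j)) with hq
  have hΦ0 : 0 ≤ Φ := (abs_nonneg _).trans
    (hΦ (fun _ _ => 1) (fun _ _ => 1) (fun _ _ => 1) (fun _ _ => one_mem_Icc)
      (fun _ _ => one_mem_Icc) fun _ _ => one_mem_Icc)
  have hq01 : ∀ i j, q i j ∈ Set.Icc (0 : ℝ) 1 := by
    intro i j
    simp only [hq]
    cases χ i j with
    | none => exact one_mem_Icc
    | some α => exact ⟨hp0 _ _ _, hple _ _ _⟩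
  have hqp : ∀ i j, i < j → p₀ ≤ q i j := by
    intro i j hij
    simp only [hq, hχ, roleColour]
    split_ifs with h₁ h₂ h₃
    · obtain ⟨k, hk⟩ := h₁
      obtain ⟨h, h', _⟩ := mem_labelledEdges.1 hk
      exact (hR i j k h h').1
    · obtain ⟨k, hk⟩ := h₂
      obtain ⟨h, h', _⟩ := mem_labelledEdges.1 hk
      exact (hR i k j h h').2.1
    · obtain ⟨k, hk⟩ := h₃
      obtain ⟨h, h', _⟩ := mem_labelledEdges.1 hk
      exact (hR k i j h h').2.2.1
    · exact hp₀1
  have main := counting (X := fun i => {x // A x = y i}) P (fun i j x x' => ?_) q (τ := τ)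
    (fun i j _ => hq01 i j) (fun i j hij g₁ g₂ hg₁ hg₂ => ?_) E
    (fun e he => ?_) (fun _ _ _ x x' x'' => edgeInd H (x : Fin n) (x' : Fin n) (x'' : Fin n))
    (fun _ _ _ x x' x'' => f ((x : Fin n), (x' : Fin n), (x'' : Fin n)))
    (fun _ _ _ _ _ _ => edgeInd_mem_Icc _ _ _ _) (fun _ _ _ _ _ _ => hf _)
    (δ := Φ / a₀ ^ 3) (θ := θ) (ζ := ζ)
    (fun i j k _ g₁ g₂ g₃ hg₁ hg₂ hg₃ =>
      unif_cell hΦ ha₀ (hy i) (hy j) (hy k) g₁ g₂ g₃ hg₁ hg₂ hg₃) hθ.le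
    (fun i j k hijk => ?_)
  rotate_left
  · simp only [hP]
    cases χ i j with
    | none => exact one_mem_Icc
    | some α => simp only [Option.elim]; split_ifs <;> simp
  · simp only [hP, hq]
    cases χ i j with
    | none => simpa using hτ
    | some α => exact pairReg_cell (hmass i) (hmass j) (hreg i j hij) α g₁ g₂ hg₁ hg₂
  · obtain ⟨i, j, k⟩ := e
    exact ⟨(mem_labelledEdges.1 he).1, (mem_labelledEdges.1 he).2.1⟩
  · obtain ⟨h, h', _⟩ := mem_labelledEdges.1 hijk
    obtain ⟨e₁, e₂, e₃⟩ := roleColour_of_mem hσ R B G hijk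
    have e₁' : χ i j = some (R i j) := e₁
    have e₂' : χ i k = some (B i k) := e₂
    have e₃' : χ j k = some (G j k) := e₃
    simp only [hP, hq, e₁', e₂', e₃', Option.elim_some]
    exact (hR i j k h h').2.2.2
  have hEcard : (E.card : ℝ) ≤ (ℓ : ℝ) ^ 3 := by
    have : E.card ≤ Fintype.card (Fin ℓ × Fin ℓ × Fin ℓ) := Finset.card_le_univ _
    have h2 : Fintype.card (Fin ℓ × Fin ℓ × Fin ℓ) = ℓ ^ 3 := by
      simp only [Fintype.card_prod, Fintype.card_fin]; ring
    exact_mod_cast h2 ▸ this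
  have hEcard' : E.card ≤ ℓ ^ 3 := by exact_mod_cast hEcard
  have hLcard' : (ltPairs (Fin ℓ)).card ≤ ℓ ^ 2 := by
    have : (ltPairs (Fin ℓ)).card ≤ Fintype.card (Fin ℓ × Fin ℓ) := Finset.card_le_univ _
    have h2 : Fintype.card (Fin ℓ × Fin ℓ) = ℓ ^ 2 := by
      simp only [Fintype.card_prod, Fintype.card_fin]; ring
    exact h2 ▸ this
  have hLcard : ((ltPairs (Fin ℓ)).card : ℝ) ≤ (ℓ : ℝ) ^ 2 := by exact_mod_cast hLcard'
  have upper : 𝔼 w, tprod (X := fun i => {x // A x = y i}) E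
      (fun _ _ _ x x' x'' => edgeInd H (x : Fin n) (x' : Fin n) (x'' : Fin n)) w
      ≤ (ℓ : ℝ) ^ 2 * (1 / (a₀ * n)) := by
    refine (Finset.expect_le_expect fun w _ => tprod_le hH w).trans ?_
    rw [Finset.expect_sum_comm]
    refine (Finset.sum_le_sum (g := fun _ => 1 / (a₀ * n)) fun r hr => ?_).trans ?_
    · have hlt : r.1 < r.2 := by simpa [ltPairs] using hr
      rw [expect_coord₂ (X := fun i => {x // A x = y i}) hlt.ne
        fun x x' => if (x : Fin n) = x' then (1 : ℝ) else 0]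
      exact expect_eq_le A ha₀ (hy r.2)
    · rw [Finset.sum_const, nsmul_eq_mul]
      exact mul_le_mul_of_nonneg_right hLcard (by positivity)
  have hprod : p₀ ^ ℓ ^ 2 ≤ ∏ r ∈ ltPairs (Fin ℓ), q r.1 r.2 := by
    refine (pow_le_pow_of_le_one hp₀.le hp₀1 hLcard').trans ?_
    rw [← Finset.prod_const]
    exact Finset.prod_le_prod (fun _ _ => hp₀.le) fun r hr => hqp _ _ (by simpa [ltPairs] using hr)
  have hpp : 0 < p₀ ^ ℓ ^ 2 := pow_pos hp₀ _
  have hbr : p₀ ^ ℓ ^ 2 / 4 ≤ (1 - E.card * ζ) * ∏ r ∈ ltPairs (Fin ℓ), q r.1 r.2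
      - (1 + E.card) * ((ltPairs (Fin ℓ)).card * τ) := by
    have h1 : (E.card : ℝ) * ζ ≤ 1 / 2 := (mul_le_mul_of_nonneg_right hEcard hζ0).trans hζ
    have h2 : (1 + (E.card : ℝ)) * ((ltPairs (Fin ℓ)).card * τ) ≤ p₀ ^ ℓ ^ 2 / 4 := by
      refine le_trans ?_ hτp
      gcongr
    have h3 : (1 / 2) * p₀ ^ ℓ ^ 2 ≤ (1 - E.card * ζ) * ∏ r ∈ ltPairs (Fin ℓ), q r.1 r.2 :=
      mul_le_mul (by linarith) hprod hpp.le (by linarith)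
    linarith
  have hθp : θ ^ ℓ ^ 3 ≤ θ ^ E.card := pow_le_pow_of_le_one hθ.le hθ1 hEcard'
  have h4 := mul_le_mul hθp hbr (by positivity) (by positivity)
  have h5 : (E.card : ℝ) * (Φ / a₀ ^ 3) ≤ (ℓ : ℝ) ^ 3 * (Φ / a₀ ^ 3) :=
    mul_le_mul_of_nonneg_right hEcard (by positivity)
  linarith

end Embedding

section Assembly

lemma cell_nonempty {V T : Type} [Fintype V] [Nonempty V] {A : V → T} {a : T} (h : 0 < mass A a) :
    Nonempty {x // A x = a} := by
  by_contra hne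
  have : mass A a = 0 := by
    unfold mass
    refine Finset.expect_eq_zero fun x _ => ?_
    unfold ind
    exact if_neg fun hx => hne ⟨⟨x, hx⟩⟩
  exact h.ne' this

lemma good_colours {n t K : ℕ} [NeZero n] {H : H3 (Fin n)} {A : Fin n → Fin t} {a b e : Fin t}
    {a₀ : ℝ} (ha₀ : 0 < a₀) (ha : a₀ ≤ mass A a) (hb : a₀ ≤ mass A b) (he : a₀ ≤ mass A e)
    {c : Fin n → Fin n → Fin K} {p : Fin t → Fin t → Fin K → ℝ} {τ : ℝ}
    (hp0 : ∀ a b α, 0 ≤ p a b α) (hp1 : ∀ a b, ∑ α, p a b α ≤ 1)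
    (hab : PairReg τ c A p a b) (hae : PairReg τ c A p a e) (hbe : PairReg τ c A p b e)
    {F : Fin K → Fin K → Fin K → ℝ} (hF : ∀ α β γ, F α β γ ∈ Set.Icc (0 : ℝ) 1)
    {f : Fin n × Fin n × Fin n → ℝ} {Φ ε d θ ζ p₀ : ℝ}
    (hΦ : Unif Φ fun ω => edgeInd H ω.1 ω.2.1 ω.2.2 - f ω)
    (hε : 𝔼 x : {x // A x = a}, 𝔼 y : {x // A x = b}, 𝔼 z : {x // A x = e},
      |f ((x : Fin n), (y : Fin n), (z : Fin n)) - F (c x y) (c x z) (c y z)| ≤ ε)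
    (hd : d / 2 ≤ cellEdgeDensity H A a b e) (hθ : 0 < θ) (hζ : 0 < ζ) (hp₀ : 0 < p₀)
    (hθd : θ ≤ d / 32) (hεd : ε ≤ d / 16) (hΦd : Φ / a₀ ^ 3 ≤ d / 16)
    (hτd : 3 * (K : ℝ) ^ 3 * τ ≤ d / 8) (hpd : 3 * K * p₀ ≤ d / 16) (hζd : ε / (ζ * θ) ≤ d / 16)
    {S : Fin K → Fin K → Fin K → Prop}
    (hS : ∀ α β γ, p₀ ≤ p a b α → p₀ ≤ p a e β → p₀ ≤ p b e γ →
      𝔼 x : {x // A x = a}, 𝔼 y : {x // A x = b}, 𝔼 z : {x // A x = e},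
          (if c x y = α then (1 : ℝ) else 0) * (if c x z = β then 1 else 0)
            * (if c y z = γ then 1 else 0)
            * (if f ((x : Fin n), (y : Fin n), (z : Fin n)) < θ then 1 else 0)
          ≤ ζ * (p a b α * p a e β * p b e γ) → S α β γ) :
    d / 16 ≤ ∑ α, p a b α * ∑ γ, p b e γ * ∑ β, if S α β γ then p a e β else 0 := by
  have hma := ha₀.trans_le ha
  have hmb := ha₀.trans_le hb
  have hme := ha₀.trans_le he
  have := cell_nonempty hma
  have := cell_nonempty hmb
  have := cell_nonempty hme
  have hu := unif_cell hΦ ha₀ ha hb he (fun _ _ => 1) (fun _ _ => 1) (fun _ _ => 1)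
    (fun _ _ => one_mem_Icc) (fun _ _ => one_mem_Icc) (fun _ _ => one_mem_Icc)
  simp only [mul_one, Finset.expect_sub_distrib] at hu
  have habs : |(𝔼 x : {x // A x = a}, 𝔼 y : {x // A x = b}, 𝔼 z : {x // A x = e},
      f ((x : Fin n), (y : Fin n), (z : Fin n))) - 𝔼 x : {x // A x = a}, 𝔼 y : {x // A x = b},
        𝔼 z : {x // A x = e}, F (c x y) (c x z) (c y z)| ≤ ε := by
    simp only [← Finset.expect_sub_distrib]
    refine le_trans (Finset.abs_expect_le _ _) (le_trans (Finset.expect_le_expect fun x _ => ?_) hε)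
    refine le_trans (Finset.abs_expect_le _ _) (Finset.expect_le_expect fun y _ => ?_)
    exact Finset.abs_expect_le _ _
  have hD : 3 * d / 8 ≤ 𝔼 x : {x // A x = a}, 𝔼 y : {x // A x = b},
        𝔼 z : {x // A x = e}, F (c x y) (c x z) (c y z) := by
    unfold cellEdgeDensity at hd
    have h1 := (abs_le.1 hu).2
    have h2 := (abs_le.1 habs).2
    linarith
  have key := sum_good_colours_ge (c₁ := fun (x : {x // A x = a}) (y : {x // A x = b}) => c x y)
    (c₂ := fun (x : {x // A x = a}) (z : {x // A x = e}) => c x z)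
    (c₃ := fun (y : {x // A x = b}) (z : {x // A x = e}) => c y z)
    (hp0 a b) (hp0 a e) (hp0 b e) (hp1 a b) (hp1 a e) (hp1 b e)
    (pairReg_cell hma hmb hab) (pairReg_cell hma hme hae) (pairReg_cell hmb hme hbe) hF
    (f := fun x y z => f ((x : Fin n), (y : Fin n), (z : Fin n))) hε hD hθ hζ hp₀
  rw [Fintype.card_fin] at key
  refine le_trans (by linarith) (key.trans ?_)
  refine Finset.sum_le_sum fun α _ => mul_le_mul_of_nonneg_left ?_ (hp0 _ _ _)
  refine Finset.sum_le_sum fun γ _ => mul_le_mul_of_nonneg_left ?_ (hp0 _ _ _)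
  refine Finset.sum_le_sum fun β _ => ?_
  split_ifs with h1 h2
  · exact le_rfl
  · exact absurd (hS _ _ _ h1.2.1 h1.2.2.1 h1.2.2.2.1 h1.2.2.2.2) h2
  · exact hp0 _ _ _
  · exact le_rfl

lemma sorted_triple_unique {i j k i' j' k' : ℕ} (h₁ : i < j) (h₂ : j < k) (h₁' : i' < j')
    (h₂' : j' < k') (h : ({i, j, k} : Finset ℕ) = {i', j', k'}) : i = i' ∧ j = j' ∧ k = k' := by
  have a : i ∈ ({i', j', k'} : Finset ℕ) := h ▸ by simp
  have b : j ∈ ({i', j', k'} : Finset ℕ) := h ▸ by simp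
  have c : k ∈ ({i', j', k'} : Finset ℕ) := h ▸ by simp
  simp only [Finset.mem_insert, Finset.mem_singleton] at a b c
  omega

/-- The density needed to embed a 3-graph with a labelling of its vertices, along a sequence of
vertices selecting the cells of a regular partition. -/
lemma embedding_bound {W : Type} [DecidableEq W] {F : H3 W} {ℓ : ℕ} {σ : W ≃ Fin ℓ}
    (hσ : ∀ v, ¬ hasMonoP3 F v (fun x => ((σ x : Fin ℓ) : ℕ)))
    {d : ℝ} (hd0 : 0 < d) (hd1 : d ≤ 1) {M N : ℕ} (hM : 24 / d ≤ M)
    (hred : ∀ (κ : Type) [Fintype κ] [Nonempty κ] (T : Finset ℕ), M ≤ T.card →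
      ∀ w : ℕ → ℕ → κ → ℝ, (∀ i k β, 0 ≤ w i k β) → (∀ i k, ∑ β, w i k β ≤ 1) →
      ∀ S : ℕ → ℕ → ℕ → κ → κ → κ → Prop, (∀ i ∈ T, ∀ j ∈ T, ∀ k ∈ T, i < j → j < k →
        d / 16 ≤ ∑ α, w i j α * ∑ γ, w j k γ * ∑ β, if S i j k α β γ then w i k β else 0) →
      ∃ I ⊆ T, I.card = ℓ ∧ ∃ R B G : ℕ → ℕ → κ, ∀ i ∈ I, ∀ j ∈ I, ∀ k ∈ I, i < j → j < k →
        S i j k (R i j) (B i k) (G j k))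
    (hram : ∀ S : Finset ℕ, N ≤ S.card → ∀ P : Finset ℕ → Prop, ∃ T ⊆ S, T.card = M ∧
      ((∀ e ⊆ T, e.card = 3 → P e) ∨ (∀ e ⊆ T, e.card = 3 → ¬ P e)))
    {n t K : ℕ} [NeZero n] {H : H3 (Fin n)} (hH : H.free F) {η : ℝ} (hdense : H.uniformlyDense d η)
    {A : Fin n → Fin t} {c : Fin n → Fin n → Fin K} {p : Fin t → Fin t → Fin K → ℝ} {τ a₀ : ℝ}
    {x : ℕ → Fin n} (ha₀ : 0 < a₀) (hx : ∀ i < N, a₀ ≤ mass A (A (x i)))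
    (hp0 : ∀ a b α, 0 ≤ p a b α) (hp1 : ∀ a b, ∑ α, p a b α ≤ 1)
    (hreg : ∀ i j, i < j → j < N → PairReg τ c A p (A (x i)) (A (x j)))
    {F' : Fin K → Fin K → Fin K → ℝ} (hF' : ∀ α β γ, F' α β γ ∈ Set.Icc (0 : ℝ) 1)
    {f : Fin n × Fin n × Fin n → ℝ} (hf : ∀ ω, f ω ∈ Set.Icc (0 : ℝ) 1)
    {Φ ε θ ζ p₀ : ℝ} (hΦ : Unif Φ fun ω => edgeInd H ω.1 ω.2.1 ω.2.2 - f ω)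
    (hε : ∀ i j k, i < j → j < k → k < N →
      𝔼 u : {v // A v = A (x i)}, 𝔼 v : {v // A v = A (x j)}, 𝔼 w : {v // A v = A (x k)},
      |f ((u : Fin n), (v : Fin n), (w : Fin n)) - F' (c u v) (c u w) (c v w)| ≤ ε)
    (hη : (3 / n + 6 * η) * M < 9 * a₀ ^ 3) (hτ : 0 ≤ τ) (hp₀1 : p₀ ≤ 1) (hθ1 : θ ≤ 1)
    (hθ : 0 < θ) (hζ : 0 < ζ) (hp₀ : 0 < p₀)
    (hθd : θ ≤ d / 32) (hεd : ε ≤ d / 16) (hΦd : Φ / a₀ ^ 3 ≤ d / 16)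
    (hτd : 3 * (K : ℝ) ^ 3 * τ ≤ d / 8) (hpd : 3 * K * p₀ ≤ d / 16) (hζd : ε / (ζ * θ) ≤ d / 16)
    (hζl : (ℓ : ℝ) ^ 3 * ζ ≤ 1 / 2)
    (hτp : (1 + (ℓ : ℝ) ^ 3) * ((ℓ : ℝ) ^ 2 * τ) ≤ p₀ ^ ℓ ^ 2 / 4)
    (hΦc : (ℓ : ℝ) ^ 3 * (Φ / a₀ ^ 3) ≤ θ ^ ℓ ^ 3 * (p₀ ^ ℓ ^ 2 / 4) / 2) :
    θ ^ ℓ ^ 3 * (p₀ ^ ℓ ^ 2 / 4) / 2 ≤ (ℓ : ℝ) ^ 2 * (1 / (a₀ * n)) := by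
  obtain ⟨T, hTN, hTM, hT⟩ := hram (Finset.range N) (by simp) fun e =>
    ∃ i j k, i < j ∧ j < k ∧ e = {i, j, k} ∧
      d / 2 ≤ cellEdgeDensity H A (A (x i)) (A (x j)) (A (x k))
  have hlt : ∀ i ∈ T, i < N := fun i hi => Finset.mem_range.1 (hTN hi)
  have hcard : ∀ i j k : ℕ, i < j → j < k → ({i, j, k} : Finset ℕ).card = 3 := fun i j k h₁ h₂ =>
    Finset.card_eq_three.2 ⟨i, j, k, h₁.ne, (h₁.trans h₂).ne, h₂.ne, rfl⟩
  have hsub : ∀ i ∈ T, ∀ j ∈ T, ∀ k ∈ T, ({i, j, k} : Finset ℕ) ⊆ T := by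
    intro i hi j hj k hk e he
    simp only [Finset.mem_insert, Finset.mem_singleton] at he
    rcases he with rfl | rfl | rfl <;> assumption
  have hall : ∀ i ∈ T, ∀ j ∈ T, ∀ k ∈ T, i < j → j < k →
      d / 2 ≤ cellEdgeDensity H A (A (x i)) (A (x j)) (A (x k)) := by
    intro i hi j hj k hk hij hjk
    rcases hT with hT | hT
    · obtain ⟨i', j', k', h₁, h₂, he, h⟩ := hT _ (hsub i hi j hj k hk) (hcard i j k hij hjk)
      obtain ⟨rfl, rfl, rfl⟩ := sorted_triple_unique hij hjk h₁ h₂ he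
      exact h
    · exfalso
      obtain ⟨a, ha, b, hb, e, he, hab, hbe, h⟩ := exists_dense_triple hd0 hd1 hdense A
        (fun i => A (x i)) ha₀ (fun i hi => hx i (hlt i hi)) (hTM ▸ hM) (hTM ▸ hη)
      exact hT _ (hsub a ha b hb e he) (hcard a b e hab hbe) ⟨a, b, e, hab, hbe, rfl, h⟩
  have : Nonempty (Fin K) := ⟨c (x 0) (x 0)⟩
  obtain ⟨I, hIT, hI, R, B, G, hRBG⟩ := hred (Fin K) T hTM.ge
    (fun i k β => p (A (x i)) (A (x k)) β) (fun _ _ _ => hp0 _ _ _) (fun _ _ => hp1 _ _)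
    (fun i j k α β γ => p₀ ≤ p (A (x i)) (A (x j)) α ∧ p₀ ≤ p (A (x i)) (A (x k)) β ∧
      p₀ ≤ p (A (x j)) (A (x k)) γ ∧
      𝔼 u : {v // A v = A (x i)}, 𝔼 v : {v // A v = A (x j)}, 𝔼 w : {v // A v = A (x k)},
        (if c u v = α then (1 : ℝ) else 0) * (if c u w = β then 1 else 0)
          * (if c v w = γ then 1 else 0)
          * (if f ((u : Fin n), (v : Fin n), (w : Fin n)) < θ then 1 else 0)
        ≤ ζ * (p (A (x i)) (A (x j)) α * p (A (x i)) (A (x k)) β * p (A (x j)) (A (x k)) γ))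
    (fun i hi j hj k hk hij hjk => good_colours ha₀ (hx i (hlt i hi)) (hx j (hlt j hj))
      (hx k (hlt k hk)) hp0 hp1 (hreg i j hij (hlt j hj)) (hreg i k (hij.trans hjk) (hlt k hk))
      (hreg j k hjk (hlt k hk)) hF' hΦ (hε i j k hij hjk (hlt k hk)) (hall i hi j hj k hk hij hjk)
      hθ hζ hp₀ hθd hεd hΦd hτd hpd hζd
      fun _ _ _ h₁ h₂ h₃ h₄ => ⟨h₁, h₂, h₃, h₄⟩)
  have hmem : ∀ i, I.orderEmbOfFin hI i ∈ I := I.orderEmbOfFin_mem hI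
  exact copies_bound hσ hH (y := fun i => A (x (I.orderEmbOfFin hI i))) ha₀
    (fun i => hx _ (hlt _ (hIT (hmem i)))) hp0 hp1
    (fun i j hij => hreg _ _ ((I.orderEmbOfFin hI).lt_iff_lt.2 hij) (hlt _ (hIT (hmem j)))) hτ hf hΦ
    (R := fun i j => R (I.orderEmbOfFin hI i) (I.orderEmbOfFin hI j))
    (B := fun i j => B (I.orderEmbOfFin hI i) (I.orderEmbOfFin hI j))
    (G := fun i j => G (I.orderEmbOfFin hI i) (I.orderEmbOfFin hI j)) hp₀ hp₀1 hθ hθ1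
    (fun i j k hij hjk => hRBG _ (hmem i) _ (hmem j) _ (hmem k)
      ((I.orderEmbOfFin hI).lt_iff_lt.2 hij) ((I.orderEmbOfFin hI).lt_iff_lt.2 hjk))
    hζl hζ.le hτp hΦc

lemma exists_pos_le_forall {g : ℕ → ℝ} (hg : ∀ K, 0 < g K) (M : ℕ) : ∃ γ, 0 < γ ∧ ∀ K ≤ M, γ ≤ g K := by
  refine ⟨(Finset.range (M + 1)).inf' Finset.nonempty_range_add_one g, ?_, fun K hK => ?_⟩
  · exact (Finset.lt_inf'_iff _).2 fun K _ => hg K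
  · exact Finset.inf'_le _ (by simp; omega)

lemma exists_pos_mul_le {a₁ a₂ a₃ b₁ b₂ b₃ : ℝ} (ha₁ : 0 ≤ a₁) (ha₂ : 0 ≤ a₂) (ha₃ : 0 ≤ a₃)
    (hb₁ : 0 < b₁) (hb₂ : 0 < b₂) (hb₃ : 0 < b₃) :
    ∃ τ, 0 < τ ∧ a₁ * τ ≤ b₁ ∧ a₂ * τ ≤ b₂ ∧ a₃ * τ ≤ b₃ := by
  have key : ∀ a b : ℝ, 0 ≤ a → 0 < b → ∀ τ, 0 ≤ τ → τ ≤ b / (a + 1) → a * τ ≤ b := by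
    intro a b ha hb τ hτ h
    rw [le_div_iff₀ (by linarith)] at h
    linarith
  have h₁ : 0 < b₁ / (a₁ + 1) := by positivity
  have h₂ : 0 < b₂ / (a₂ + 1) := by positivity
  have h₃ : 0 < b₃ / (a₃ + 1) := by positivity
  have hpos := lt_min h₁ (lt_min h₂ h₃)
  exact ⟨_, hpos, key _ _ ha₁ hb₁ _ hpos.le (min_le_left _ _),
    key _ _ ha₂ hb₂ _ hpos.le ((min_le_right _ _).trans (min_le_left _ _)),
    key _ _ ha₃ hb₃ _ hpos.le ((min_le_right _ _).trans (min_le_right _ _))⟩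

/-- If some labelling of the vertices of `F` leaves every link graph without a monotone `P₃`, then
large uniformly dense 3-graphs contain `F`. -/
lemma not_uniformlyDense {W : Type} [DecidableEq W] {F : H3 W} {ℓ : ℕ} {σ : W ≃ Fin ℓ}
    (hσ : ∀ v, ¬ hasMonoP3 F v (fun x => ((σ x : Fin ℓ) : ℕ))) {d : ℝ} (hd0 : 0 < d) (hd1 : d ≤ 1) :
    ∃ η : ℝ, 0 < η ∧ ∃ n₀ : ℕ, ∀ n, n₀ ≤ n → ∀ H : H3 (Fin n), H.free F →
      ¬ H.uniformlyDense d η := by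
  obtain ⟨L, hL⟩ := reduced ℓ (d := d / 16) (by positivity)
  set M := max L ⌈24 / d⌉₊ with hMdef
  have hM : 24 / d ≤ M := (Nat.le_ceil _).trans (by exact_mod_cast le_max_right _ _)
  have hMpos : (0 : ℝ) < M := lt_of_lt_of_le (by positivity) hM
  obtain ⟨N', hN'⟩ := ramsey 3 M
  set N := N' + 1 with hN
  have hNpos : (0 : ℝ) < N := by rw [hN]; positivity
  set θ := d / 32 with hθdef
  have hθ : 0 < θ := by positivity
  have hθ1 : θ ≤ 1 := by rw [hθdef]; linarith
  set ζ : ℝ := 1 / (2 * ((ℓ : ℝ) ^ 3 + 1)) with hζdef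
  have hζ : 0 < ζ := by positivity
  have hζ1 : ζ ≤ 1 := by
    rw [hζdef, div_le_one (by positivity)]
    have : (0 : ℝ) ≤ (ℓ : ℝ) ^ 3 := by positivity
    linarith
  have hζl : (ℓ : ℝ) ^ 3 * ζ ≤ 1 / 2 := by
    rw [hζdef, mul_one_div, div_le_div_iff₀ (by positivity) (by norm_num)]
    linarith
  set ε' := ζ * θ * (d / 16) with hε'def
  have hε' : 0 < ε' := by positivity
  have hε'd : ε' ≤ d / 16 :=
    mul_le_of_le_one_left (by positivity) (mul_le_one₀ hζ1 hθ.le hθ1)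
  have hζd : ε' / (ζ * θ) ≤ d / 16 := by
    rw [hε'def, mul_div_cancel_left₀ _ (by positivity)]
  set ε := ε' / (4 * (N : ℝ) ^ 3) with hεdef
  have hε : 0 < ε := by positivity
  set p₀ : ℕ → ℝ := fun K => d / (48 * ((K : ℝ) + 1)) with hp₀def
  have hp₀ : ∀ K, 0 < p₀ K := fun K => by simp only [hp₀def]; positivity
  have hp₀1 : ∀ K, p₀ K ≤ 1 := fun K => by
    simp only [hp₀def]
    rw [div_le_one (by positivity)]
    have : (0 : ℝ) ≤ (K : ℝ) := by positivity
    linarith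
  have hpd : ∀ K : ℕ, 3 * K * p₀ K ≤ d / 16 := fun K => by
    simp only [hp₀def]
    rw [mul_div_assoc', div_le_div_iff₀ (by positivity) (by norm_num)]
    nlinarith
  have hτex : ∀ K : ℕ, ∃ τ, 0 < τ ∧ 3 * (K : ℝ) ^ 3 * τ ≤ d / 8 ∧
      (1 + (ℓ : ℝ) ^ 3) * (ℓ : ℝ) ^ 2 * τ ≤ p₀ K ^ ℓ ^ 2 / 4 ∧ (N : ℝ) ^ 2 * τ ≤ 1 / 4 := fun K =>
    exists_pos_mul_le (by positivity) (by positivity) (by positivity) (by positivity)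
      (by have := hp₀ K; positivity) (by norm_num)
  choose τ hτ hτd hτp hτN using hτex
  choose T hT using fun K => szemeredi_partition (hτ K) K
  set a₀ : ℕ → ℝ := fun K => 1 / (4 * N * ((T K : ℝ) + 1)) with ha₀def
  have ha₀ : ∀ K, 0 < a₀ K := fun K => by simp only [ha₀def]; positivity
  set cc : ℕ → ℝ := fun K => θ ^ ℓ ^ 3 * (p₀ K ^ ℓ ^ 2 / 4) / 2 with hccdef
  have hcc : ∀ K, 0 < cc K := fun K => by
    have := hp₀ K
    simp only [hccdef]
    positivity
  have hΦex : ∀ K : ℕ, ∃ Φ, 0 < Φ ∧ 1 * Φ ≤ d / 16 * a₀ K ^ 3 ∧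
      (ℓ : ℝ) ^ 3 * Φ ≤ cc K * a₀ K ^ 3 ∧ 1 * Φ ≤ 1 := fun K => by
    have := ha₀ K
    have := hcc K
    exact exists_pos_mul_le (by norm_num) (by positivity) (by norm_num) (by positivity)
      (by positivity) (by norm_num)
  choose Φ hΦ hΦd hΦc _ using hΦex
  obtain ⟨K₀, hK₀⟩ := strong_regularity hε Φ hΦ
  obtain ⟨γ, hγ, hγle⟩ := exists_pos_le_forall (g := fun K => min (a₀ K ^ 3) (cc K * a₀ K))
    (fun K => lt_min (pow_pos (ha₀ K) 3) (mul_pos (hcc K) (ha₀ K))) K₀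
  refine ⟨γ / (2 * M), by positivity, ⌈(M : ℝ) / γ⌉₊ + ⌈(ℓ : ℝ) ^ 2 / γ⌉₊ + 1, ?_⟩
  intro n hn H hH hdense
  have : NeZero n := ⟨by omega⟩
  have hn' : (M : ℝ) / γ + (ℓ : ℝ) ^ 2 / γ + 1 ≤ n := by
    have h₁ := Nat.le_ceil ((M : ℝ) / γ)
    have h₂ := Nat.le_ceil ((ℓ : ℝ) ^ 2 / γ)
    have h₃ : ((⌈(M : ℝ) / γ⌉₊ + ⌈(ℓ : ℝ) ^ 2 / γ⌉₊ + 1 : ℕ) : ℝ) ≤ n := by exact_mod_cast hn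
    push_cast at h₃
    linarith
  have hMγ : 0 ≤ (M : ℝ) / γ := by positivity
  have hℓγ : 0 ≤ (ℓ : ℝ) ^ 2 / γ := by positivity
  have hnpos : (0 : ℝ) < n := by linarith
  have hMn : (M : ℝ) ≤ γ * n := by
    have : (M : ℝ) / γ ≤ n := by linarith
    rwa [div_le_iff₀' hγ] at this
  have hℓn : (ℓ : ℝ) ^ 2 < γ * n := by
    have : (ℓ : ℝ) ^ 2 / γ < n := by linarith
    rwa [div_lt_iff₀' hγ] at this
  obtain ⟨K, hK, c, F', f, hF', hf, hdist, hunif⟩ := hK₀ (Fin n)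
    (fun ω => edgeInd H ω.1 ω.2.1 ω.2.2) (fun ω => edgeInd_mem_Icc H _ _ _)
  obtain ⟨t, ht, A, p, hp0, hp1, hreg⟩ := hT K (Fin n) c
  have ha := ha₀ K
  have hγ₁ : γ ≤ a₀ K ^ 3 := (hγle K hK).trans (min_le_left _ _)
  have hγ₂ : γ ≤ cc K * a₀ K := (hγle K hK).trans (min_le_right _ _)
  obtain ⟨x, hx₁, hx₂, hx₃⟩ := exists_choice (N := N) A (fun a b => PairReg (τ K) c A p a b)
    (D := fun x y z => 𝔼 u : {v // A v = A x}, 𝔼 v : {v // A v = A y}, 𝔼 w : {v // A v = A z},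
      |f ((u : Fin n), (v : Fin n), (w : Fin n)) - F' (c u v) (c u w) (c v w)|)
    (fun _ _ _ => Finset.expect_nonneg fun _ _ => Finset.expect_nonneg fun _ _ =>
      Finset.expect_nonneg fun _ _ => abs_nonneg _) hreg (ε := ε)
    ((expect_cells_le A (G := fun u v w => |f (u, v, w) - F' (c u v) (c u w) (c v w)|)
      (fun _ _ _ => abs_nonneg _)).trans (by rw [expect_triple] at hdist; exact hdist))
    ha.le hε' (hτ K).le hε.le (by
      have h₁ : (N : ℝ) * (t * a₀ K) ≤ 1 / 4 := by
        have : (t : ℝ) ≤ T K := by exact_mod_cast ht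
        have e : (N : ℝ) * (t * a₀ K) = t / (4 * ((T K : ℝ) + 1)) := by
          simp only [ha₀def]
          field_simp
        rw [e, div_le_div_iff₀ (by positivity) (by norm_num)]
        linarith
      have h₂ : (N : ℝ) ^ 3 * (ε / ε') = 1 / 4 := by
        rw [hεdef]
        field_simp
      have h₃ := hτN K
      linarith)
  have hfin := embedding_bound hσ hd0 hd1 hM
    (fun κ _ _ T hT => hL κ T ((le_max_left _ _).trans hT))
    (fun S hS => hN' S ((Nat.le_succ N').trans hS)) hH hdense ha hx₁ hp0 hp1 hx₂ hF' hf
    hunif hx₃ (by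
      have h₁ : 3 / (n : ℝ) * M ≤ 3 * γ := by
        rw [div_mul_eq_mul_div, div_le_iff₀ hnpos]
        linarith
      have h₂ : 6 * (γ / (2 * M)) * M = 3 * γ := by
        field_simp
        norm_num
      rw [add_mul]
      linarith) (hτ K).le (hp₀1 K) hθ1 hθ hζ (hp₀ K) le_rfl hε'd
    (by
      rw [div_le_iff₀ (by positivity)]
      linarith [hΦd K]) (hτd K) (hpd K) hζd hζl
    (by rw [← mul_assoc]; exact hτp K)
    (by
      rw [mul_div_assoc', div_le_iff₀ (by positivity)]
      exact hΦc K)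
  refine absurd hfin (not_le.2 ?_)
  rw [mul_one_div, div_lt_iff₀ (by positivity)]
  calc (ℓ : ℝ) ^ 2 < γ * n := hℓn
    _ ≤ cc K * a₀ K * n := by gcongr
    _ = cc K * (a₀ K * n) := by ring

end Assembly

end UTD

end

/-- `π_⋅(F) > 0` if and only if for every labeling `σ` of `V(F)` there is a
vertex `v` whose link graph contains a monotone `P₃` with respect to `σ`. -/
theorem stmt3 {V : Type} [DecidableEq V] [Fintype V] (F : H3 V) :
    0 < uniformTuranDensity F ↔
      ∀ σ : V ≃ Fin (Fintype.card V), ∃ v : V,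
        hasMonoP3 F v (fun x => ((σ x : Fin (Fintype.card V)) : ℕ)) := by
  constructor
  · intro h
    by_contra! hcon
    obtain ⟨σ, hσ⟩ := hcon
    refine h.not_ge (Real.sSup_nonpos fun d ⟨_, hd1, hd⟩ => le_of_not_gt fun hd0 => ?_)
    obtain ⟨η, hη, n₀, hn₀⟩ := UTD.not_uniformlyDense hσ hd0 hd1
    obtain ⟨n, hn, H, hH, hdense⟩ := hd η hη n₀
    exact hn₀ n hn H hH hdense
  · intro h
    refine lt_of_lt_of_le (by norm_num : (0 : ℝ) < 1 / 27) (le_csSup ⟨1, fun d hd => hd.2.1⟩ ?_)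
    exact ⟨by norm_num, by norm_num, UTD.one_div_mem_densities h⟩
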